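/- Let n ≥ 4 and let ρ be an injective group endomorphism of B_n/Z(B_n). Then ρ is half-twist preserving: for every half-twist b in B_n/Z(B_n) (every conjugate of σ̄_1), the image ρ(b) is a conjugate of σ̄_1 or a conjugate of σ̄_1^{−1}. -/

import Mathlib

/-- Relators for the braid group with generators `σ_0, …, σ_{m-1}`:
the braid relations `σ_i σ_j σ_i = σ_j σ_i σ_j` for `j = i+1`, and the
commutation relations `σ_i σ_j = σ_j σ_i` for `j ≥ i+2`. -/
def braidRels (m : ℕ) : Set (FreeGroup (Fin m)) :=
  { r | ∃ i j : Fin m,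
      ((i : ℕ) + 1 = (j : ℕ) ∧
        r = FreeGroup.of i * FreeGroup.of j * FreeGroup.of i *
            (FreeGroup.of j * FreeGroup.of i * FreeGroup.of j)⁻¹) ∨
      ((i : ℕ) + 2 ≤ (j : ℕ) ∧
        r = FreeGroup.of i * FreeGroup.of j * (FreeGroup.of j * FreeGroup.of i)⁻¹) }

/-- The braid group on `n` strands: the presented group with generators
`σ_1, …, σ_{n-1}` (indexed by `Fin (n-1)`) and the braid relators. -/
abbrev BraidGroup (n : ℕ) : Type := PresentedGroup (braidRels (n - 1))

/-- The standard generator `σ_{i+1}` of the braid group (0-indexed). -/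
def braidσ (n : ℕ) (i : Fin (n - 1)) : BraidGroup n := PresentedGroup.of i

/-- The element `δ = σ_1 σ_2 ⋯ σ_{n-1}` of the braid group. -/
def braidδ (n : ℕ) : BraidGroup n := (List.ofFn (braidσ n)).prod

/-- The full twist `z = (σ_1 σ_2 ⋯ σ_{n-1})^n`. -/
def fullTwist (n : ℕ) : BraidGroup n := braidδ n ^ n

/-- The braid group with `m` generators, i.e. on `m + 1` strands. -/
abbrev Br (m : ℕ) : Type := PresentedGroup (braidRels m)

/-- The generator of index `k`, with value `1` out of range. -/
def sg (m k : ℕ) : Br m := if h : k < m then PresentedGroup.of ⟨k, h⟩ else 1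

theorem sg_of_ge {m k : ℕ} (h : m ≤ k) : sg m k = 1 := dif_neg (by omega)

theorem sg_braid {m k : ℕ} (h : k + 1 < m) :
    sg m k * sg m (k + 1) * sg m k = sg m (k + 1) * sg m k * sg m (k + 1) := by
  have hk : k < m := by omega
  simp only [sg, h, hk, dif_pos]
  rw [← mul_inv_eq_one]
  have hr : FreeGroup.of (⟨k, hk⟩ : Fin m) * FreeGroup.of ⟨k + 1, h⟩ * FreeGroup.of ⟨k, hk⟩ *
      (FreeGroup.of ⟨k + 1, h⟩ * FreeGroup.of ⟨k, hk⟩ * FreeGroup.of ⟨k + 1, h⟩)⁻¹ ∈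
      braidRels m := ⟨⟨k, hk⟩, ⟨k + 1, h⟩, Or.inl ⟨rfl, rfl⟩⟩
  exact PresentedGroup.one_of_mem hr

theorem sg_comm {m i j : ℕ} (h : i + 2 ≤ j) : sg m i * sg m j = sg m j * sg m i := by
  by_cases hj : j < m
  · have hi : i < m := by omega
    simp only [sg, hi, hj, dif_pos]
    rw [← mul_inv_eq_one]
    have hr : FreeGroup.of (⟨i, hi⟩ : Fin m) * FreeGroup.of ⟨j, hj⟩ *
        (FreeGroup.of ⟨j, hj⟩ * FreeGroup.of ⟨i, hi⟩)⁻¹ ∈ braidRels m :=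
      ⟨⟨i, hi⟩, ⟨j, hj⟩, Or.inr ⟨h, rfl⟩⟩
    exact PresentedGroup.one_of_mem hr
  · rw [sg_of_ge (not_lt.1 hj)]; simp

theorem commute_sg {m i j : ℕ} (h : i + 2 ≤ j ∨ j + 2 ≤ i) : Commute (sg m i) (sg m j) := by
  rcases h with h | h
  · exact sg_comm h
  · exact (sg_comm h).symm

namespace Br

section
variable {H : Type*} [Group H] {m : ℕ}

/-- The homomorphism determined by the images of the generators. -/
def lift (f : ℕ → H)
    (hb : ∀ k, k + 1 < m → f k * f (k + 1) * f k = f (k + 1) * f k * f (k + 1))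
    (hc : ∀ i j, i + 2 ≤ j → j < m → f i * f j = f j * f i) : Br m →* H :=
  PresentedGroup.toGroup (f := fun i : Fin m => f i) (by
    rintro r ⟨i, j, ⟨h, rfl⟩ | ⟨h, rfl⟩⟩
    · have := hb i (by omega)
      rw [h] at this
      simp [this]
    · simp [hc i j h j.2])

theorem lift_sg (f : ℕ → H) (hb) (hc) {k : ℕ} (hk : k < m) :
    lift f hb hc (sg m k) = f k := by
  simp [lift, sg, hk]

theorem hom_ext {f g : Br m →* H} (h : ∀ k < m, f (sg m k) = g (sg m k)) : f = g := by
  refine PresentedGroup.ext fun x => ?_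
  have := h x x.2
  simpa [sg] using this

theorem closure_sg (m : ℕ) : Subgroup.closure {b | ∃ k < m, b = sg m k} = ⊤ := by
  rw [← PresentedGroup.closure_range_of]
  congr 1
  ext b
  constructor
  · rintro ⟨k, hk, rfl⟩
    exact ⟨⟨k, hk⟩, by simp [sg, hk]⟩
  · rintro ⟨x, rfl⟩
    exact ⟨x, x.2, by simp [sg]⟩

/-- A subgroup containing all generators is everything. -/
theorem mem_of_sg (S : Subgroup (Br m)) (h : ∀ k < m, sg m k ∈ S) (b : Br m) : b ∈ S := by
  have : (⊤ : Subgroup (Br m)) ≤ S := by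
    rw [← closure_sg, Subgroup.closure_le]
    rintro _ ⟨k, hk, rfl⟩
    exact h k hk
  exact this trivial

theorem commute_of_sg {x : Br m} (h : ∀ k < m, Commute x (sg m k)) (b : Br m) : Commute x b := by
  have := mem_of_sg (Subgroup.centralizer {x})
    (fun k hk => Subgroup.mem_centralizer_singleton_iff.2 (h k hk).symm) b
  exact (Subgroup.mem_centralizer_singleton_iff.1 this).symm

end

/-- The permutation of the strands, acting on `ℕ`. -/
def perm (m : ℕ) : Br m →* Equiv.Perm ℕ :=
  lift (fun k => Equiv.swap k (k + 1))
    (fun k _ => by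
      ext i; simp only [Equiv.Perm.mul_apply, Equiv.swap_apply_def]; split_ifs <;> omega)
    (fun i j h _ => by
      ext i; simp only [Equiv.Perm.mul_apply, Equiv.swap_apply_def]; split_ifs <;> omega)

theorem perm_sg {m k : ℕ} (hk : k < m) : perm m (sg m k) = Equiv.swap k (k + 1) :=
  lift_sg _ _ _ hk

theorem perm_apply_of_gt {m : ℕ} (b : Br m) {i : ℕ} (hi : m < i) : perm m b i = i := by
  have := mem_of_sg ((MulAction.stabilizer (Equiv.Perm ℕ) i).comap (perm m)) (fun k hk => by
    simp only [Subgroup.mem_comap, MulAction.mem_stabilizer_iff, perm_sg hk, Equiv.Perm.smul_def]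
    exact Equiv.swap_apply_of_ne_of_ne (by omega) (by omega)) b
  simpa using this

theorem perm_apply_le {m : ℕ} (b : Br m) {i : ℕ} (hi : i ≤ m) : perm m b i ≤ m := by
  by_contra h
  have := perm_apply_of_gt b (not_le.1 h)
  have := (perm m b).injective this
  omega

/-- The exponent sum. -/
def expo (m : ℕ) : Br m →* Multiplicative ℤ :=
  lift (fun _ => Multiplicative.ofAdd 1) (fun _ _ => rfl) (fun _ _ _ _ => rfl)

theorem expo_sg {m k : ℕ} (hk : k < m) : expo m (sg m k) = Multiplicative.ofAdd 1 :=
  lift_sg _ _ _ hk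

/-- The exponent sum as an integer. -/
def ex {m : ℕ} (b : Br m) : ℤ := (expo m b).toAdd

theorem ex_mul {m : ℕ} (a b : Br m) : ex (a * b) = ex a + ex b := by simp [ex]
theorem ex_inv {m : ℕ} (a : Br m) : ex a⁻¹ = - ex a := by simp [ex]
theorem ex_one {m : ℕ} : ex (1 : Br m) = 0 := by simp [ex]
theorem ex_zpow {m : ℕ} (a : Br m) (k : ℤ) : ex (a ^ k) = k * ex a := by simp [ex]
theorem ex_pow {m : ℕ} (a : Br m) (k : ℕ) : ex (a ^ k) = k * ex a := by simp [ex]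
theorem ex_sg {m k : ℕ} (hk : k < m) : ex (sg m k) = 1 := by simp [ex, expo_sg hk]
theorem ex_conj {m : ℕ} (a b : Br m) : ex (a * b * a⁻¹) = ex b := by
  rw [ex_mul, ex_mul, ex_inv]; ring

/-- The permutation action on pairs of strands recording crossings. -/
def crossPerm (k : ℕ) : Equiv.Perm (ℕ × ℕ × ℤ) where
  toFun p := (Equiv.swap k (k + 1) p.1, Equiv.swap k (k + 1) p.2.1,
    p.2.2 + if (p.1 = k ∧ p.2.1 = k + 1) ∨ (p.1 = k + 1 ∧ p.2.1 = k) then 1 else 0)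
  invFun p := (Equiv.swap k (k + 1) p.1, Equiv.swap k (k + 1) p.2.1,
    p.2.2 - if (p.1 = k ∧ p.2.1 = k + 1) ∨ (p.1 = k + 1 ∧ p.2.1 = k) then 1 else 0)
  left_inv p := by
    obtain ⟨i, j, v⟩ := p
    simp only [Equiv.swap_apply_self, Prod.mk.injEq, true_and]
    simp only [Equiv.swap_apply_def]; split_ifs <;> omega
  right_inv p := by
    obtain ⟨i, j, v⟩ := p
    simp only [Equiv.swap_apply_self, Prod.mk.injEq, true_and]
    simp only [Equiv.swap_apply_def]; split_ifs <;> omega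

theorem crossPerm_apply (k i j : ℕ) (v : ℤ) : crossPerm k (i, j, v) =
    (Equiv.swap k (k + 1) i, Equiv.swap k (k + 1) j,
    v + if (i = k ∧ j = k + 1) ∨ (i = k + 1 ∧ j = k) then 1 else 0) := rfl

/-- The action on pairs of strands recording crossings. -/
def crossHom (m : ℕ) : Br m →* Equiv.Perm (ℕ × ℕ × ℤ) :=
  lift crossPerm
    (fun k _ => by
      ext1 ⟨i, j, v⟩
      simp only [Equiv.Perm.mul_apply, crossPerm_apply, Equiv.swap_apply_def]
      by_cases h1 : i = k <;> by_cases h2 : i = k + 1 <;> by_cases h3 : i = k + 1 + 1 <;>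
      by_cases h4 : j = k <;> by_cases h5 : j = k + 1 <;> by_cases h6 : j = k + 1 + 1 <;>
      first | omega | (simp [h1, h2, h3, h4, h5, h6, show ¬ k = k + 1 + 1 by omega,
        show ¬ k + 1 + 1 = k by omega]))
    (fun k l h _ => by
      ext1 ⟨i, j, v⟩
      simp only [Equiv.Perm.mul_apply, crossPerm_apply, Prod.mk.injEq]
      refine ⟨?_, ?_, ?_⟩
      · simp only [Equiv.swap_apply_def]; split_ifs <;> omega
      · simp only [Equiv.swap_apply_def]; split_ifs <;> omega
      · have e : ∀ a b : ℕ, b + 2 ≤ a ∨ a + 2 ≤ b → ∀ i,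
            ((Equiv.swap a (a + 1) i = b ↔ i = b) ∧ 
             (Equiv.swap a (a + 1) i = b + 1 ↔ i = b + 1)) := by
          intro a b h i
          simp only [Equiv.swap_apply_def]; constructor <;> split_ifs <;> omega
        simp only [e k l (by omega), e l k (by omega)]
        ring)

/-- The number of crossings (with sign) of the strands starting at `i` and `j`. -/
def cr {m : ℕ} (b : Br m) (i j : ℕ) : ℤ := (crossHom m b (i, j, 0)).2.2

theorem crossHom_apply {m : ℕ} (b : Br m) (i j : ℕ) (v : ℤ) :
    crossHom m b (i, j, v) = (perm m b i, perm m b j, v + cr b i j) := by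
  let S : Subgroup (Br m) :=
    { carrier := {b | ∀ i j v, crossHom m b (i, j, v) = (perm m b i, perm m b j, v + cr b i j)}
      one_mem' := fun i j v => by simp [cr]
      mul_mem' := fun {a b} ha hb i j v => by
        have h1 : ∀ v, crossHom m (a * b) (i, j, v) = (perm m (a * b) i, perm m (a * b) j,
            v + (cr b i j + cr a (perm m b i) (perm m b j))) := fun v => by
          rw [map_mul, Equiv.Perm.mul_apply, hb, ha]; simp [add_assoc]
        rw [h1]
        have : cr (a * b) i j = cr b i j + cr a (perm m b i) (perm m b j) := by
          rw [cr, h1]; simp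
        rw [this]
      inv_mem' := fun {a} ha i j v => by
        have h1 : ∀ v, crossHom m a⁻¹ (i, j, v) = (perm m a⁻¹ i, perm m a⁻¹ j,
            v - cr a (perm m a⁻¹ i) (perm m a⁻¹ j)) := fun v => by
          rw [map_inv, Equiv.Perm.inv_eq_iff_eq, ha]; simp
        rw [h1]
        have : cr a⁻¹ i j = - cr a (perm m a⁻¹ i) (perm m a⁻¹ j) := by
          rw [cr, h1]; simp
        rw [this, sub_eq_add_neg] }
  refine mem_of_sg S (fun k hk i j v => ?_) b i j v
  rw [cr, perm_sg hk, crossHom, lift_sg _ _ _ hk]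
  simp [crossPerm_apply]

theorem cr_mul {m : ℕ} (a b : Br m) (i j : ℕ) :
    cr (a * b) i j = cr b i j + cr a (perm m b i) (perm m b j) := by
  have := crossHom_apply (a * b) i j 0
  rw [map_mul, Equiv.Perm.mul_apply, crossHom_apply, crossHom_apply] at this
  simpa using (congrArg (fun p => p.2.2) this).symm

theorem cr_one {m : ℕ} (i j : ℕ) : cr (1 : Br m) i j = 0 := by simp [cr]

theorem cr_inv {m : ℕ} (a : Br m) (i j : ℕ) :
    cr a⁻¹ (perm m a i) (perm m a j) = - cr a i j := by
  have := cr_mul a⁻¹ a i j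
  rw [inv_mul_cancel, cr_one] at this
  omega

theorem cr_sg {m k : ℕ} (hk : k < m) (i j : ℕ) : cr (sg m k) i j =
    if (i = k ∧ j = k + 1) ∨ (i = k + 1 ∧ j = k) then 1 else 0 := by
  rw [cr, crossHom, lift_sg _ _ _ hk, crossPerm_apply]; simp

/-- Crossing numbers of a conjugate of a pure braid. -/
theorem cr_conj {m : ℕ} (a b : Br m) (hb : perm m b = 1) (i j : ℕ) :
    cr (a * b * a⁻¹) (perm m a i) (perm m a j) = cr b i j := by
  rw [cr_mul, cr_mul]
  have h1 : ∀ i, perm m a⁻¹ (perm m a i) = i := fun i => by simp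
  rw [h1, h1, hb, cr_inv]
  simp

theorem cr_mul_pure {m : ℕ} (a b : Br m) (hb : perm m b = 1) (i j : ℕ) :
    cr (a * b) i j = cr a i j + cr b i j := by
  rw [cr_mul, hb]; simp [add_comm]

theorem cr_inv_pure {m : ℕ} (b : Br m) (hb : perm m b = 1) (i j : ℕ) :
    cr b⁻¹ i j = - cr b i j := by
  have := cr_inv b i j
  rwa [hb] at this

theorem cr_pow_pure {m : ℕ} (b : Br m) (hb : perm m b = 1) (i j : ℕ) (k : ℕ) :
    cr (b ^ k) i j = k * cr b i j := by
  induction k with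
  | zero => simp [cr_one]
  | succ k ih => rw [pow_succ, cr_mul_pure _ _ hb, ih]; push_cast; ring

theorem cr_zpow_pure {m : ℕ} (b : Br m) (hb : perm m b = 1) (i j : ℕ) (k : ℤ) :
    cr (b ^ k) i j = k * cr b i j := by
  obtain ⟨k, rfl | rfl⟩ := k.eq_nat_or_neg
  · rw [zpow_natCast, cr_pow_pure _ hb]
  · rw [zpow_neg, zpow_natCast, cr_inv_pure _ (by rw [map_pow, hb, one_pow]), cr_pow_pure _ hb]
    ring

theorem inv_braid {G : Type*} [Group G] {a b : G} (h : a * b * a = b * a * b) :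
    a⁻¹ * b⁻¹ * a⁻¹ = b⁻¹ * a⁻¹ * b⁻¹ := by
  have := congrArg (·⁻¹) h
  simpa [mul_assoc] using this

/-- The mirror automorphism. -/
def mirror (m : ℕ) : Br m →* Br m :=
  lift (fun k => (sg m k)⁻¹) (fun _ hk => inv_braid (sg_braid hk))
    (fun _ _ h _ => ((commute_sg (m := m) (Or.inl h)).inv_inv).eq)

theorem mirror_sg {m : ℕ} (k : ℕ) : mirror m (sg m k) = (sg m k)⁻¹ := by
  by_cases hk : k < m
  · exact lift_sg _ _ _ hk
  · rw [sg_of_ge (not_lt.1 hk)]; simp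

/-- The inclusion adding a strand on the right. -/
def incl (m : ℕ) : Br m →* Br (m + 1) :=
  lift (fun k => sg (m + 1) k) (fun _ hk => sg_braid (by omega)) (fun _ _ h _ => sg_comm h)

theorem incl_sg {m k : ℕ} (hk : k < m) : incl m (sg m k) = sg (m + 1) k := lift_sg _ _ _ hk

theorem perm_incl {m : ℕ} (b : Br m) : perm (m + 1) (incl m b) = perm m b := by
  have : (perm (m + 1)).comp (incl m) = perm m := hom_ext fun k hk => by
    simp [incl_sg hk, perm_sg hk, perm_sg (show k < m + 1 by omega)]
  exact DFunLike.congr_fun this b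

theorem ex_incl {m : ℕ} (b : Br m) : ex (incl m b) = ex b := by
  have : (expo (m + 1)).comp (incl m) = expo m := hom_ext fun k hk => by
    simp [incl_sg hk, expo_sg hk, expo_sg (show k < m + 1 by omega)]
  exact congrArg Multiplicative.toAdd (DFunLike.congr_fun this b)

theorem cr_incl {m : ℕ} (b : Br m) (i j : ℕ) : cr (incl m b) i j = cr b i j := by
  have : (crossHom (m + 1)).comp (incl m) = crossHom m := hom_ext fun k hk => by
    rw [MonoidHom.comp_apply, incl_sg hk, crossHom, crossHom, lift_sg _ _ _ hk,
      lift_sg _ _ _ (by omega)]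
  rw [cr, cr, ← this]; rfl

theorem cr_gt {m : ℕ} (b : Br m) {i : ℕ} (hi : m < i) (j : ℕ) : cr b i j = 0 ∧ cr b j i = 0 := by
  let S : Subgroup (Br m) :=
    { carrier := {b | ∀ j, cr b i j = 0 ∧ cr b j i = 0}
      one_mem' := fun j => by simp [cr_one]
      mul_mem' := fun {a b} ha hb j => by
        simp only [cr_mul, perm_apply_of_gt b hi, (ha _).1, (ha _).2, (hb _).1, (hb _).2]
        simp
      inv_mem' := fun {a} ha j => by
        have h := fun i j => cr_inv a i j
        have hi' := perm_apply_of_gt a hi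
        have hj : perm m a (perm m a⁻¹ j) = j := by simp
        have h1 := h i (perm m a⁻¹ j)
        have h2 := h (perm m a⁻¹ j) i
        rw [hi', hj] at h1 h2
        rw [h1, h2, (ha _).1, (ha _).2]; simp }
  refine mem_of_sg S (fun k hk j => ?_) b j
  simp only [cr_sg hk]
  constructor <;> rw [if_neg] <;> omega

end Br

/-- The free group on the loops around the `m + 1` strands. -/
abbrev Fr (m : ℕ) : Type := FreeGroup (Fin (m + 1))

/-- The letter of index `k`, with value `1` out of range. -/
def X (m k : ℕ) : Fr m := if h : k < m + 1 then FreeGroup.of ⟨k, h⟩ else 1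

namespace Fr

theorem X_fin {m : ℕ} (i : Fin (m + 1)) : X m i = FreeGroup.of i := by simp [X, i.is_le]

section
variable {H : Type*} [Group H] {m : ℕ}

/-- The homomorphism determined by the images of the letters. -/
def lift (f : ℕ → H) : Fr m →* H := FreeGroup.lift fun i : Fin (m + 1) => f i

theorem lift_X (f : ℕ → H) {k : ℕ} (hk : k ≤ m) : lift f (X m k) = f k := by
  simp [lift, X, Nat.lt_succ_of_le hk]

theorem hom_ext {f g : Fr m →* H} (h : ∀ k ≤ m, f (X m k) = g (X m k)) : f = g := by
  refine FreeGroup.ext_hom f g fun i => ?_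
  have := h i (by omega)
  rwa [X_fin] at this

end

theorem mem_of_X {m : ℕ} (S : Subgroup (Fr m)) (h : ∀ k ≤ m, X m k ∈ S) (x : Fr m) : x ∈ S := by
  have : x ∈ Subgroup.closure (Set.range (FreeGroup.of : Fin (m + 1) → Fr m)) := by
    rw [FreeGroup.closure_range_of]; trivial
  refine (Subgroup.closure_le S).2 ?_ this
  rintro _ ⟨i, rfl⟩
  have := h i (by omega)
  rwa [X_fin] at this

/-- The Artin endomorphism attached to the generator of index `k`. -/
def artinFun (m k : ℕ) : Fr m →* Fr m :=
  lift fun i => if i = k + 1 then X m k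
    else if i = k then (X m k)⁻¹ * X m (k + 1) * X m k else X m i

/-- The inverse Artin endomorphism attached to the generator of index `k`. -/
def artinInv (m k : ℕ) : Fr m →* Fr m :=
  lift fun i => if i = k then X m (k + 1)
    else if i = k + 1 then X m (k + 1) * X m k * (X m (k + 1))⁻¹ else X m i

/-- The Artin automorphism attached to the generator of index `k`. -/
def artinAut (m k : ℕ) (hk : k < m) : MulAut (Fr m) :=
  MonoidHom.toMulEquiv (artinFun m k) (artinInv m k)
    (hom_ext fun i hi => by
      have h1 : k ≤ m := by omega
      have h2 : k + 1 ≤ m := by omega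
      simp only [MonoidHom.comp_apply, MonoidHom.id_apply, artinFun, lift_X _ hi]
      split_ifs with h3 h4
      · subst h3; simp [artinInv, lift_X _ h1]
      · subst h4; simp [artinInv, lift_X _ h1, lift_X _ h2, mul_assoc]
      · simp [artinInv, lift_X _ hi, h3, h4])
    (hom_ext fun i hi => by
      have h1 : k ≤ m := by omega
      have h2 : k + 1 ≤ m := by omega
      simp only [MonoidHom.comp_apply, MonoidHom.id_apply, artinInv, lift_X _ hi]
      split_ifs with h3 h4
      · subst h3; simp [artinFun, lift_X _ h2]
      · subst h4; simp [artinFun, lift_X _ h1, lift_X _ h2, mul_assoc]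
      · simp [artinFun, lift_X _ hi, h3, h4])

theorem artinAut_apply {m k : ℕ} (hk : k < m) (x : Fr m) : artinAut m k hk x = artinFun m k x := rfl

theorem artinFun_fst {m k : ℕ} (hk : k < m) :
    artinFun m k (X m k) = (X m k)⁻¹ * X m (k + 1) * X m k := by
  simp [artinFun, lift_X _ hk.le]

theorem artinFun_snd {m k : ℕ} (hk : k < m) : artinFun m k (X m (k + 1)) = X m k := by
  simp [artinFun, lift_X _ (show k + 1 ≤ m from hk)]

theorem artinFun_other {m k i : ℕ} (h1 : i ≠ k) (h2 : i ≠ k + 1) :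
    artinFun m k (X m i) = X m i := by
  by_cases hi : i ≤ m
  · simp [artinFun, lift_X _ hi, h1, h2]
  · simp [X, show ¬ i < m + 1 by omega]

theorem mulAut_ext {m : ℕ} {f g : MulAut (Fr m)} (h : ∀ k ≤ m, f (X m k) = g (X m k)) : f = g := by
  have : f.toMonoidHom = g.toMonoidHom := hom_ext h
  ext x
  exact DFunLike.congr_fun this x

/-- The Artin action of the braid group on the free group. -/
def artin (m : ℕ) : Br m →* MulAut (Fr m) :=
  Br.lift (fun k => if h : k < m then artinAut m k h else 1)
    (fun k hk => by
      have h1 : k < m := by omega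
      refine mulAut_ext fun i hi => ?_
      simp only [h1, hk, dif_pos, MulAut.mul_apply, artinAut_apply]
      have e1 := artinFun_fst h1
      have e2 := artinFun_snd h1
      have e3 := artinFun_fst hk
      have e4 := artinFun_snd hk
      have e5 : artinFun m k (X m (k + 1 + 1)) = X m (k + 1 + 1) :=
        artinFun_other (by omega) (by omega)
      have e6 : artinFun m (k + 1) (X m k) = X m k := artinFun_other (by omega) (by omega)
      rcases eq_or_ne i k with rfl | g1
      · simp [e1, e2, e3, e5, e6, mul_assoc]
      rcases eq_or_ne i (k + 1) with rfl | g2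
      · simp [e1, e2, e3, e4, e5, e6, mul_assoc]
      rcases eq_or_ne i (k + 1 + 1) with rfl | g3
      · simp [e2, e4, e5, e6]
      simp [artinFun_other g1 g2, artinFun_other g2 g3])
    (fun k l h hl => by
      have h1 : k < m := by omega
      refine mulAut_ext fun i hi => ?_
      simp only [h1, hl, dif_pos, MulAut.mul_apply, artinAut_apply]
      have e1 := artinFun_fst h1
      have e2 := artinFun_snd h1
      have e3 := artinFun_fst hl
      have e4 := artinFun_snd hl
      have e5 : artinFun m k (X m l) = X m l := artinFun_other (by omega) (by omega)
      have e6 : artinFun m k (X m (l + 1)) = X m (l + 1) := artinFun_other (by omega) (by omega)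
      have e7 : artinFun m l (X m k) = X m k := artinFun_other (by omega) (by omega)
      have e8 : artinFun m l (X m (k + 1)) = X m (k + 1) := artinFun_other (by omega) (by omega)
      rcases eq_or_ne i k with rfl | g1
      · simp [e1, e7, e8]
      rcases eq_or_ne i (k + 1) with rfl | g2
      · simp [e2, e7, e8]
      rcases eq_or_ne i l with rfl | g3
      · simp [e3, e5, e6]
      rcases eq_or_ne i (l + 1) with rfl | g4
      · simp [e4, e5, e6]
      simp [artinFun_other g1 g2, artinFun_other g3 g4])

theorem artin_sg {m k : ℕ} (hk : k < m) (x : Fr m) : artin m (sg m k) x = artinFun m k x := by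
  rw [artin, Br.lift_sg _ _ _ hk, dif_pos hk, artinAut_apply]

end Fr

/-- The semidirect product of the free group and the braid group. -/
abbrev Gr (m : ℕ) : Type := Fr m ⋊[Fr.artin m] Br m

namespace Gr

open SemidirectProduct

/-- The image of a letter in the semidirect product. -/
abbrev x {m : ℕ} : Fr m →* Gr m := inl
/-- The image of a braid in the semidirect product. -/
abbrev s {m : ℕ} : Br m →* Gr m := inr

theorem s_mul_x {m : ℕ} (b : Br m) (a : Fr m) : s b * x a = x (Fr.artin m b a) * s b := by
  simp [x, s, inl_aut]

theorem s_snd {m k : ℕ} (hk : k < m) : s (sg m k) * x (X m (k + 1)) = x (X m k) * s (sg m k) := by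
  rw [s_mul_x, Fr.artin_sg hk, Fr.artinFun_snd hk]

theorem s_fst {m k : ℕ} (hk : k < m) : s (sg m k) * x (X m k) =
    (x (X m k))⁻¹ * x (X m (k + 1)) * x (X m k) * s (sg m k) := by
  rw [s_mul_x, Fr.artin_sg hk, Fr.artinFun_fst hk]; simp

theorem s_other {m k i : ℕ} (hk : k < m) (h1 : i ≠ k) (h2 : i ≠ k + 1) :
    s (sg m k) * x (X m i) = x (X m i) * s (sg m k) := by
  rw [s_mul_x, Fr.artin_sg hk, Fr.artinFun_other h1 h2]

end Gr

namespace Br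

/-- The element `σ_i ⋯ σ_m`, moving the last strand to position `i`. -/
def tau (m i : ℕ) : Br (m + 1) := ((List.range' i (m + 1 - i)).map (sg (m + 1))).prod

theorem tau_gt {m i : ℕ} (h : m < i) : tau m i = 1 := by
  rw [tau, show m + 1 - i = 0 by omega]; simp

theorem tau_succ {m i : ℕ} (h : i ≤ m) : tau m i = sg (m + 1) i * tau m (i + 1) := by
  rw [tau, tau, show m + 1 - i = (m + 1 - (i + 1)) + 1 by omega, List.range'_succ]; simp

/-- Induction from the top down. -/
theorem down_induction {m : ℕ} {p : ℕ → Prop} (h0 : p (m + 1)) (h1 : ∀ i ≤ m, p (i + 1) → p i) :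
    ∀ i ≤ m + 1, p i := by
  intro i hi
  induction hd : m + 1 - i generalizing i with
  | zero => rwa [show i = m + 1 by omega]
  | succ d ih => exact h1 i (by omega) (ih _ (by omega) (by omega))

theorem commute_sg_tau {m k : ℕ} : ∀ i ≤ m + 1, k + 2 ≤ i → Commute (sg (m + 1) k) (tau m i) := by
  refine down_induction (fun _ => ?_) (fun i hi ih h => ?_)
  · rw [tau_gt (by omega)]; exact Commute.one_right _
  · rw [tau_succ hi]
    exact (commute_sg (Or.inl h)).mul_right (ih (by omega))

theorem sg_mul_tau {m k : ℕ} (hk : k < m) :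
    ∀ i ≤ k, sg (m + 1) (k + 1) * tau m i = tau m i * sg (m + 1) k := by
  intro i hi
  induction hd : k - i generalizing i with
  | zero =>
    obtain rfl : i = k := by omega
    rw [tau_succ (by omega), tau_succ (by omega)]
    have h := (commute_sg_tau (m := m) (k := i) (i + 1 + 1) (by omega) (by omega)).eq
    have h2 := sg_braid (m := m + 1) (k := i) (by omega)
    simp only [mul_assoc] at *
    rw [← h, ← mul_assoc, ← mul_assoc, ← mul_assoc, ← mul_assoc, mul_assoc _ _ (sg _ _), ← h2]
    simp only [mul_assoc]
  | succ d ih =>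
    rw [tau_succ (by omega), ← mul_assoc, ← (sg_comm (m := m + 1) (show i + 2 ≤ k + 1 by omega)),
      mul_assoc, ih _ (by omega) (by omega), mul_assoc]

/-- The loop of the last strand around strand `i`. -/
def loop (m i : ℕ) : Br (m + 1) := (tau m (i + 1))⁻¹ * sg (m + 1) i ^ 2 * tau m (i + 1)

theorem sg_loop_snd {m k : ℕ} (hk : k < m) :
    sg (m + 1) k * loop m (k + 1) = loop m k * sg (m + 1) k := by
  have h := (commute_sg_tau (m := m) (k := k) (k + 1 + 1) (by omega) (by omega))
  have h2 := sg_braid (m := m + 1) (k := k) (by omega)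
  rw [loop, loop, tau_succ (show k + 1 ≤ m by omega)]
  set a := sg (m + 1) k
  set b := sg (m + 1) (k + 1)
  set t := tau m (k + 1 + 1)
  have h3 : b * (a * b ^ 2) = a ^ 2 * b * a := by
    have : b * (a * b ^ 2) = (b * a * b) * b := by simp only [pow_two, mul_assoc]
    rw [this, ← h2]
    simp only [pow_two, mul_assoc] at *
    rw [h2]
  calc a * (t⁻¹ * b ^ 2 * t) = t⁻¹ * (a * b ^ 2) * t := by
        rw [← mul_assoc, ← mul_assoc, (h.inv_right).eq]; simp only [mul_assoc]
    _ = t⁻¹ * (b⁻¹ * a ^ 2 * b * a) * t := by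
        congr 2; rw [mul_assoc, mul_assoc, eq_inv_mul_iff_mul_eq, h3, mul_assoc]
    _ = (b * t)⁻¹ * a ^ 2 * (b * t) * a := by
        simp only [mul_inv_rev, mul_assoc]; rw [h.eq]

theorem braid_sq_comm {G : Type*} [Group G] {a b : G} (h : a * b * a = b * a * b) :
    a * b ^ 2 * (a * b ^ 2) = b ^ 2 * (a * b ^ 2) * a :=
  calc a * b ^ 2 * (a * b ^ 2) = a * b * (b * a * b) * b := by simp only [pow_two, mul_assoc]
    _ = a * b * (a * b * a) * b := by rw [h]
    _ = (a * b * a) * (b * a * b) := by simp only [mul_assoc]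
    _ = (b * a * b) * (a * b * a) := by rw [h]
    _ = b * (a * b * a) * b * a := by simp only [mul_assoc]
    _ = b * (b * a * b) * b * a := by rw [h]
    _ = b ^ 2 * (a * b ^ 2) * a := by simp only [pow_two, mul_assoc]

theorem sg_loop_fst {m k : ℕ} (hk : k < m) : sg (m + 1) k * loop m k =
    (loop m k)⁻¹ * loop m (k + 1) * loop m k * sg (m + 1) k := by
  have h1 := sg_loop_snd hk
  have h := (commute_sg_tau (m := m) (k := k) (k + 1 + 1) (by omega) (by omega))
  have h5 := braid_sq_comm (sg_braid (m := m + 1) (k := k) (by omega))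
  have e1 : loop m k = sg (m + 1) k * loop m (k + 1) * (sg (m + 1) k)⁻¹ := by rw [h1]; simp
  have e2 : loop m (k + 1) = (tau m (k + 1 + 1))⁻¹ * sg (m + 1) (k + 1) ^ 2 *
    tau m (k + 1 + 1) := rfl
  set a := sg (m + 1) k
  set b := sg (m + 1) (k + 1)
  set t := tau m (k + 1 + 1)
  rw [mul_assoc, mul_assoc, eq_inv_mul_iff_mul_eq, e1, e2]
  have h6 : ∀ y, t⁻¹ * (a * y) = a * (t⁻¹ * y) := fun y => by
    rw [← mul_assoc, ← (h.inv_right).eq, mul_assoc]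
  have h7 : t⁻¹ * a⁻¹ = a⁻¹ * t⁻¹ := by rw [← mul_inv_rev, h.eq, mul_inv_rev]
  have h8 : t * a⁻¹ = a⁻¹ * t := (h.inv_left).eq.symm
  have h9 := congrArg (fun y => t⁻¹ * (y * a⁻¹) * t) h5
  have h10 : ∀ y, t * (a * y) = a * (t * y) := fun y => by
    rw [← mul_assoc, ← h.eq, mul_assoc]
  simp only [mul_assoc, h6, h8, h10, ← h.eq] at h9 ⊢
  simpa using h9

theorem sg_loop_other {m k i : ℕ} (hk : k < m) (hi : i ≤ m) (h1 : i ≠ k) (h2 : i ≠ k + 1) :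
    sg (m + 1) k * loop m i = loop m i * sg (m + 1) k := by
  rcases lt_or_ge i k with h | h
  · have h3 := sg_mul_tau hk (i + 1) h
    have h4 : Commute (sg (m + 1) i) (sg (m + 1) (k + 1)) := commute_sg (by omega)
    have h5 : sg (m + 1) k = (tau m (i + 1))⁻¹ * sg (m + 1) (k + 1) * tau m (i + 1) := by
      rw [mul_assoc, h3]; simp
    rw [loop, h5]
    simp only [mul_assoc, mul_inv_cancel_left]
    rw [← mul_assoc (_ ^ 2) (sg (m + 1) (k + 1)), (h4.pow_left 2).eq, mul_assoc]
  · have h3 : Commute (sg (m + 1) k) (sg (m + 1) i) := commute_sg (by omega)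
    have h4 := commute_sg_tau (m := m) (k := k) (i + 1) (by omega) (by omega)
    exact ((h4.inv_right.mul_right (h3.pow_right 2)).mul_right h4).eq

/-- The images of the letters as loops of the last strand. -/
def loopHom (m : ℕ) : Fr m →* Br (m + 1) := Fr.lift (loop m)

theorem loopHom_X {m k : ℕ} (hk : k ≤ m) : loopHom m (X m k) = loop m k := Fr.lift_X _ hk

theorem incl_mul_loopHom {m : ℕ} (b : Br m) (a : Fr m) :
    incl m b * loopHom m a = loopHom m (Fr.artin m b a) * incl m b := by
  let S : Subgroup (Br m) :=
    { carrier := {b | ∀ a, incl m b * loopHom m a * (incl m b)⁻¹ = loopHom m (Fr.artin m b a)}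
      one_mem' := fun a => by simp
      mul_mem' := fun {b c} hb hc a => by
        rw [map_mul, map_mul, MulAut.mul_apply, ← hb, ← hc]; simp only [mul_inv_rev, mul_assoc]
      inv_mem' := fun {b} hb a => by
        have := hb (Fr.artin m b⁻¹ a)
        rw [← MulAut.mul_apply, ← map_mul, mul_inv_cancel, map_one, MulAut.one_apply] at this
        rw [← this]; simp [mul_assoc] }
  have : b ∈ S := by
    refine mem_of_sg S (fun k hk a => ?_) b
    have : (MulAut.conj (incl m (sg m k))).toMonoidHom.comp (loopHom m) =
        (loopHom m).comp (Fr.artin m (sg m k)).toMonoidHom := by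
      refine Fr.hom_ext fun i hi => ?_
      simp only [MonoidHom.comp_apply, MulEquiv.coe_toMonoidHom, MulAut.conj_apply, incl_sg hk,
        Fr.artin_sg hk, loopHom_X hi]
      rw [mul_inv_eq_iff_eq_mul]
      rcases eq_or_ne i k with rfl | h1
      · rw [Fr.artinFun_fst hk, sg_loop_fst hk]
        simp [loopHom_X hi, loopHom_X (show i + 1 ≤ m by omega)]
      rcases eq_or_ne i (k + 1) with rfl | h2
      · rw [Fr.artinFun_snd hk, sg_loop_snd hk, loopHom_X (by omega)]
      rw [Fr.artinFun_other h1 h2, sg_loop_other hk hi h1 h2, loopHom_X hi]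
    exact DFunLike.congr_fun this a
  rw [← this a]; simp

end Br

namespace Gr
open SemidirectProduct

/-- The homomorphism from the semidirect product to the braid group with one more strand. -/
def toBr (m : ℕ) : Gr m →* Br (m + 1) :=
  SemidirectProduct.lift (Br.loopHom m) (Br.incl m) fun b => by
    ext1 a
    simp only [MonoidHom.comp_apply, MulEquiv.coe_toMonoidHom, MulAut.conj_apply]
    rw [Br.incl_mul_loopHom]; simp

theorem toBr_x {m : ℕ} (a : Fr m) : toBr m (x a) = Br.loopHom m a := lift_inl ..
theorem toBr_s {m : ℕ} (b : Br m) : toBr m (s b) = Br.incl m b := lift_inr ..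

/-- The projection to the braid group, forgetting the last strand. -/
abbrev pr {m : ℕ} : Gr m →* Br m := rightHom

theorem eq_x_mul_s {m : ℕ} (g : Gr m) : g = x g.left * s (pr g) := by
  simp [x, s, pr]

end Gr

namespace Gr
open SemidirectProduct

/-- The multiplier of the action of `σ_k` on coset representatives. -/
def mult (m k i : ℕ) : Gr m :=
  if i = k + 1 then 1 else if i = k then x (X m k)
  else if i < k then s (sg m (k - 1)) else if i ≤ m + 1 then s (sg m k) else 1

/-- The action of `σ_k` on pairs of a strand and a group element. -/
def cosetPerm (m k : ℕ) : Equiv.Perm (ℕ × Gr m) where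
  toFun p := (Equiv.swap k (k + 1) p.1, mult m k p.1 * p.2)
  invFun p := (Equiv.swap k (k + 1) p.1, (mult m k (Equiv.swap k (k + 1) p.1))⁻¹ * p.2)
  left_inv p := by simp
  right_inv p := by simp

theorem cosetPerm_apply (m k i : ℕ) (g : Gr m) :
    cosetPerm m k (i, g) = (Equiv.swap k (k + 1) i, mult m k i * g) := rfl

theorem cosetPerm_fst (m k : ℕ) (g : Gr m) :
    cosetPerm m k (k, g) = (k + 1, x (X m k) * g) := by
  simp [cosetPerm_apply, mult]

theorem cosetPerm_snd (m k : ℕ) (g : Gr m) : cosetPerm m k (k + 1, g) = (k, g) := by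
  simp [cosetPerm_apply, mult]

theorem cosetPerm_lt {m k i : ℕ} (h : i < k) (g : Gr m) :
    cosetPerm m k (i, g) = (i, s (sg m (k - 1)) * g) := by
  rw [cosetPerm_apply, mult, if_neg (by omega), if_neg (by omega), if_pos h,
    Equiv.swap_apply_of_ne_of_ne (by omega) (by omega)]

theorem cosetPerm_gt {m k i : ℕ} (h : k + 1 < i) (hi : i ≤ m + 1) (g : Gr m) :
    cosetPerm m k (i, g) = (i, s (sg m k) * g) := by
  rw [cosetPerm_apply, mult, if_neg (by omega), if_neg (by omega), if_neg (by omega), if_pos hi,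
    Equiv.swap_apply_of_ne_of_ne (by omega) (by omega)]

theorem cosetPerm_big {m k i : ℕ} (hk : k ≤ m) (hi : m + 1 < i) (g : Gr m) :
    cosetPerm m k (i, g) = (i, g) := by
  rw [cosetPerm_apply, mult, if_neg (by omega), if_neg (by omega), if_neg (by omega),
    if_neg (by omega), Equiv.swap_apply_of_ne_of_ne (by omega) (by omega), one_mul]

/-- The action of the braid group on coset representatives. -/
def cosetHom (m : ℕ) : Br (m + 1) →* Equiv.Perm (ℕ × Gr m) :=
  Br.lift (cosetPerm m)
    (fun k hk => by
      have hk : k < m := by omega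
      ext1 ⟨i, g⟩
      simp only [Equiv.Perm.mul_apply]
      rcases lt_or_ge (m + 1) i with h | h
      · simp only [cosetPerm_big hk.le h, cosetPerm_big (show k + 1 ≤ m from hk) h]
      rcases lt_trichotomy i k with h1 | rfl | h1
      · simp only [cosetPerm_lt h1, cosetPerm_lt (show i < k + 1 by omega), Prod.mk.injEq, true_and,
          ← mul_assoc, mul_left_inj, ← map_mul]
        have := sg_braid (m := m) (k := k - 1) (by omega)
        rw [show k - 1 + 1 = k by omega] at this
        simp [this]
      · simp only [cosetPerm_fst, cosetPerm_lt (show i < i + 1 by omega),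
          cosetPerm_gt (show i + 1 < i + 1 + 1 by omega) (show i + 1 + 1 ≤ m + 1 by omega)]
        simp only [Prod.mk.injEq, true_and, ← mul_assoc, mul_left_inj, Nat.add_sub_cancel]
        rw [s_snd hk, mul_assoc, s_fst hk]; simp [mul_assoc]
      rcases lt_trichotomy i (k + 1) with h2 | rfl | h2
      · omega
      · simp only [cosetPerm_fst, cosetPerm_snd, cosetPerm_lt (show k < k + 1 by omega),
          cosetPerm_gt (show k + 1 < k + 1 + 1 by omega) (show k + 1 + 1 ≤ m + 1 by omega)]
        simp only [Prod.mk.injEq, true_and, ← mul_assoc, mul_left_inj, Nat.add_sub_cancel]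
        rw [s_snd hk]
      rcases eq_or_lt_of_le (show k + 1 + 1 ≤ i from h2) with rfl | h3
      · simp only [cosetPerm_snd, cosetPerm_lt (show k < k + 1 by omega),
          cosetPerm_gt (show k + 1 < k + 1 + 1 by omega) h, Nat.add_sub_cancel]
      · simp only [cosetPerm_gt h2 h, cosetPerm_gt h3 h, Prod.mk.injEq, true_and,
          ← mul_assoc, mul_left_inj, ← map_mul]
        simp [sg_braid (m := m) (k := k) (by omega)])
    (fun k l hkl hl => by
      have hk : k < m := by omega
      ext1 ⟨i, g⟩
      simp only [Equiv.Perm.mul_apply]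
      rcases lt_or_ge (m + 1) i with h | h
      · simp only [cosetPerm_big hk.le h, cosetPerm_big (show l ≤ m by omega) h]
      rcases lt_trichotomy i k with h1 | rfl | h1
      · simp only [cosetPerm_lt h1, cosetPerm_lt (show i < l by omega), Prod.mk.injEq, true_and,
          ← mul_assoc, mul_left_inj, ← map_mul]
        rw [sg_comm (by omega)]
      · simp only [cosetPerm_fst, cosetPerm_lt (show i < l by omega),
          cosetPerm_lt (show i + 1 < l by omega)]
        simp only [Prod.mk.injEq, true_and, ← mul_assoc, mul_left_inj]
        rw [s_other (by omega) (by omega) (by omega)]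
      rcases lt_trichotomy i (k + 1) with h2 | rfl | h2
      · omega
      · simp only [cosetPerm_snd, cosetPerm_lt (show k < l by omega),
          cosetPerm_lt (show k + 1 < l by omega)]
      rcases lt_trichotomy i l with h3 | rfl | h3
      · simp only [cosetPerm_gt h2 h, cosetPerm_lt h3, Prod.mk.injEq, true_and,
          ← mul_assoc, mul_left_inj, ← map_mul]
        rw [sg_comm (by omega)]
      · simp only [cosetPerm_fst, cosetPerm_gt h2 h,
          cosetPerm_gt (show k + 1 < i + 1 by omega) (show i + 1 ≤ m + 1 by omega)]
        simp only [Prod.mk.injEq, true_and, ← mul_assoc, mul_left_inj]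
        rw [s_other (by omega) (by omega) (by omega)]
      rcases eq_or_lt_of_le (show l + 1 ≤ i from h3) with rfl | h3
      · simp only [cosetPerm_snd, cosetPerm_gt (show k + 1 < l + 1 by omega) h,
          cosetPerm_gt (show k + 1 < l by omega) (show l ≤ m + 1 by omega)]
      · simp only [cosetPerm_gt h2 h, cosetPerm_gt h3 h, Prod.mk.injEq, true_and,
          ← mul_assoc, mul_left_inj, ← map_mul]
        rw [sg_comm (by omega)])

/-- The cocycle of the action on coset representatives. -/
def cocyc {m : ℕ} (b : Br (m + 1)) (i : ℕ) : Gr m := (cosetHom m b (i, 1)).2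

theorem cosetHom_apply {m : ℕ} (b : Br (m + 1)) (i : ℕ) (g : Gr m) :
    cosetHom m b (i, g) = (Br.perm (m + 1) b i, cocyc b i * g) := by
  let S : Subgroup (Br (m + 1)) :=
    { carrier := {b | ∀ i g, cosetHom m b (i, g) = (Br.perm (m + 1) b i, cocyc b i * g)}
      one_mem' := fun i g => by simp [cocyc]
      mul_mem' := fun {a b} ha hb i g => by
        have h1 : ∀ g, cosetHom m (a * b) (i, g) = (Br.perm (m + 1) (a * b) i,
            cocyc a (Br.perm (m + 1) b i) * cocyc b i * g) := fun g => by
          rw [map_mul, Equiv.Perm.mul_apply, hb, ha]; simp [mul_assoc]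
        rw [h1]
        have : cocyc (a * b) i = cocyc a (Br.perm (m + 1) b i) * cocyc b i := by
          rw [cocyc, h1]; simp
        rw [this]
      inv_mem' := fun {a} ha i g => by
        have h1 : ∀ g, cosetHom m a⁻¹ (i, g) = (Br.perm (m + 1) a⁻¹ i,
            (cocyc a (Br.perm (m + 1) a⁻¹ i))⁻¹ * g) := fun g => by
          rw [map_inv, Equiv.Perm.inv_eq_iff_eq, ha]; simp
        rw [h1]
        have : cocyc a⁻¹ i = (cocyc a (Br.perm (m + 1) a⁻¹ i))⁻¹ := by
          rw [cocyc, h1]; simp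
        rw [this] }
  refine Br.mem_of_sg S (fun k hk i g => ?_) b i g
  rw [cocyc, Br.perm_sg hk, cosetHom, Br.lift_sg _ _ _ hk, cosetPerm_apply, cosetPerm_apply]
  simp

theorem cocyc_mul {m : ℕ} (a b : Br (m + 1)) (i : ℕ) :
    cocyc (a * b) i = cocyc a (Br.perm (m + 1) b i) * cocyc b i := by
  have := cosetHom_apply (a * b) i 1
  rw [map_mul, Equiv.Perm.mul_apply, cosetHom_apply, cosetHom_apply] at this
  simpa using (congrArg Prod.snd this).symm

theorem cocyc_one {m : ℕ} (i : ℕ) : cocyc (1 : Br (m + 1)) i = 1 := by simp [cocyc]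

theorem cocyc_inv {m : ℕ} (a : Br (m + 1)) (i : ℕ) :
    cocyc a⁻¹ (Br.perm (m + 1) a i) = (cocyc a i)⁻¹ := by
  have := cocyc_mul a⁻¹ a i
  rw [inv_mul_cancel, cocyc_one] at this
  exact eq_inv_of_mul_eq_one_left this.symm

theorem cocyc_sg {m k : ℕ} (hk : k ≤ m) (i : ℕ) : cocyc (sg (m + 1) k) i = mult m k i := by
  rw [cocyc, cosetHom, Br.lift_sg _ _ _ (by omega), cosetPerm_apply]; simp

theorem perm_tau {m : ℕ} : ∀ i ≤ m + 1, Br.perm (m + 1) (Br.tau m i) (m + 1) = i := by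
  refine Br.down_induction ?_ fun i hi ih => ?_
  · rw [Br.tau_gt (by omega)]; simp
  · rw [Br.tau_succ hi, map_mul, Equiv.Perm.mul_apply, ih, Br.perm_sg (by omega)]; simp

theorem cocyc_tau {m : ℕ} : ∀ i ≤ m + 1, cocyc (Br.tau m i) (m + 1) = 1 := by
  refine Br.down_induction ?_ fun i hi ih => ?_
  · rw [Br.tau_gt (by omega), cocyc_one]
  · rw [Br.tau_succ hi, cocyc_mul, ih, perm_tau _ (by omega), cocyc_sg hi]; simp [mult]

theorem mul_tau {m : ℕ} (b : Br (m + 1)) : ∀ i ≤ m + 1,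
    b * Br.tau m i = Br.tau m (Br.perm (m + 1) b i) * toBr m (cocyc b i) := by
  let S : Subgroup (Br (m + 1)) :=
    { carrier := {b | ∀ i ≤ m + 1,
        b * Br.tau m i = Br.tau m (Br.perm (m + 1) b i) * toBr m (cocyc b i)}
      one_mem' := fun i _ => by simp [cocyc_one]
      mul_mem' := fun {a b} ha hb i hi => by
        rw [mul_assoc, hb i hi, ← mul_assoc, ha _ (Br.perm_apply_le b hi), cocyc_mul, map_mul,
          map_mul, mul_assoc]; rfl
      inv_mem' := fun {a} ha i hi => by
        have h1 := ha _ (Br.perm_apply_le a⁻¹ hi)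
        have h2 := cocyc_inv a (Br.perm (m + 1) a⁻¹ i)
        have h3 : Br.perm (m + 1) a (Br.perm (m + 1) a⁻¹ i) = i := by simp
        rw [h3] at h1 h2
        rw [h2, map_inv (toBr m), inv_mul_eq_iff_eq_mul, ← mul_assoc, h1]; simp }
  refine Br.mem_of_sg S (fun k hk i hi => ?_) b
  have hk : k ≤ m := by omega
  rw [Br.perm_sg (by omega), cocyc_sg hk, mult]
  split_ifs with h1 h2 h3
  · subst h1; simp [Br.tau_succ hk]
  · subst h2
    rw [Equiv.swap_apply_left, toBr_x, Br.loopHom_X hk, Br.tau_succ hk, Br.loop]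
    simp [pow_two, mul_assoc]
  · rw [Equiv.swap_apply_of_ne_of_ne (by omega) (by omega), toBr_s, Br.incl_sg (by omega)]
    have := Br.sg_mul_tau (m := m) (k := k - 1) (by omega) i (by omega)
    rwa [show k - 1 + 1 = k by omega] at this
  · rw [Equiv.swap_apply_of_ne_of_ne (by omega) (by omega), toBr_s, Br.incl_sg (by omega)]
    exact (Br.commute_sg_tau i hi (by omega)).eq

/-- The component in the stabiliser of the last strand. -/
def ofBr {m : ℕ} (b : Br (m + 1)) : Gr m := cocyc b (m + 1)

theorem toBr_ofBr {m : ℕ} {b : Br (m + 1)} (h : Br.perm (m + 1) b (m + 1) = m + 1) :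
    toBr m (ofBr b) = b := by
  have := mul_tau b (m + 1) le_rfl
  rw [h, Br.tau_gt (by omega)] at this
  simpa [ofBr] using this.symm

theorem ofBr_mul {m : ℕ} (a : Br (m + 1)) {b : Br (m + 1)}
    (h : Br.perm (m + 1) b (m + 1) = m + 1) : ofBr (a * b) = ofBr a * ofBr b := by
  rw [ofBr, cocyc_mul, h]; rfl

theorem cocyc_last_toBr {m : ℕ} (g : Gr m) :
    Br.perm (m + 1) (toBr m g) (m + 1) = m + 1 ∧ ofBr (toBr m g) = g := by
  let S : Subgroup (Gr m) :=
    { carrier := {g | Br.perm (m + 1) (toBr m g) (m + 1) = m + 1 ∧ ofBr (toBr m g) = g}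
      one_mem' := by simp [ofBr, cocyc_one]
      mul_mem' := fun {a b} ha hb => by
        refine ⟨by rw [map_mul, map_mul, Equiv.Perm.mul_apply, hb.1, ha.1], ?_⟩
        rw [map_mul, ofBr_mul _ hb.1, ha.2, hb.2]
      inv_mem' := fun {a} ha => by
        refine ⟨by rw [map_inv, map_inv, Equiv.Perm.inv_eq_iff_eq, ha.1], ?_⟩
        have := cocyc_inv (toBr m a) (m + 1)
        rw [ha.1] at this
        rw [ofBr, map_inv, this, ← ofBr, ha.2] }
  have h1 : ∀ b : Br m, s b ∈ S := Br.mem_of_sg (S.comap s) fun k hk => by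
    have : Br.perm (m + 1) (sg (m + 1) k) (m + 1) = m + 1 := by
      rw [Br.perm_sg (by omega)]
      exact Equiv.swap_apply_of_ne_of_ne (by omega) (by omega)
    refine ⟨by rw [toBr_s, Br.incl_sg hk, this], ?_⟩
    rw [toBr_s, Br.incl_sg hk, ofBr, cocyc_sg hk.le, mult, if_neg (by omega), if_neg (by omega),
      if_neg (by omega), if_pos le_rfl]
  have h2 : ∀ a : Fr m, x a ∈ S := Fr.mem_of_X (S.comap x) fun k hk => by
    have e1 := perm_tau (m := m) (k + 1) (by omega)
    have e2 : Br.perm (m + 1) (Br.tau m (k + 1))⁻¹ (k + 1) = m + 1 := by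
      rw [map_inv, Equiv.Perm.inv_eq_iff_eq, e1]
    have e3 : Br.perm (m + 1) (sg (m + 1) k ^ 2) = 1 := by
      rw [map_pow, Br.perm_sg (by omega), pow_two, Equiv.swap_mul_self]
    have e4 := cocyc_inv (Br.tau m (k + 1)) (m + 1)
    rw [e1, cocyc_tau _ (by omega), inv_one] at e4
    refine ⟨?_, ?_⟩
    · rw [toBr_x, Br.loopHom_X hk, Br.loop, map_mul, map_mul, e3]
      simp
    · rw [toBr_x, Br.loopHom_X hk, Br.loop, ofBr, cocyc_mul, cocyc_mul, cocyc_tau _ (by omega), e1,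
        e3, Equiv.Perm.one_apply, e4, pow_two, cocyc_mul, cocyc_sg hk, cocyc_sg hk,
        Br.perm_sg (by omega)]
      simp [mult]
  rw [eq_x_mul_s g]
  exact S.mul_mem (h2 _) (h1 _)

theorem ofBr_toBr {m : ℕ} (g : Gr m) : ofBr (toBr m g) = g := (cocyc_last_toBr g).2

theorem toBr_injective (m : ℕ) : Function.Injective (toBr m) :=
  Function.LeftInverse.injective ofBr_toBr

theorem perm_toBr {m : ℕ} (g : Gr m) : Br.perm (m + 1) (toBr m g) = Br.perm m (pr g) := by
  have h : ∀ a : Fr m, Br.perm (m + 1) (toBr m (x a)) = 1 :=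
    Fr.mem_of_X (((Br.perm (m + 1)).comp ((toBr m).comp (x (m := m)))).ker) fun k hk => by
      rw [MonoidHom.mem_ker]
      simp only [MonoidHom.comp_apply]
      rw [toBr_x, Br.loopHom_X hk, Br.loop, map_mul, map_mul, map_pow, Br.perm_sg (by omega),
        pow_two, Equiv.swap_mul_self]
      simp
  conv_lhs => rw [eq_x_mul_s g]
  rw [map_mul, map_mul, h, toBr_s, Br.perm_incl, one_mul]

end Gr

theorem Br.loopHom_injective (m : ℕ) : Function.Injective (loopHom m) := fun a b h => by
  rw [← Gr.toBr_x, ← Gr.toBr_x] at h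
  exact SemidirectProduct.inl_injective (Gr.toBr_injective m h)

namespace FreeGroup

theorem of_commute {α : Type*} {i j : α} (h : Commute (of i) (of j)) : i = j := by
  classical
  by_contra hij
  have h1 : (of i * of j).toWord = (of j * of i).toWord := by rw [h.eq]
  have e : ∀ i j : α, of i * of j = mk [(i, true), (j, true)] := fun i j => rfl
  rw [e, e, toWord_mk, toWord_mk, IsReduced.reduce_eq, IsReduced.reduce_eq] at h1
  · simp at h1; exact hij h1.1
  · simp [IsReduced]
  · simp [IsReduced]

theorem exists_zpowers_of_commute {α : Type*} {x y : FreeGroup α} (h : Commute x y) :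
    ∃ r, x ∈ Subgroup.zpowers r ∧ y ∈ Subgroup.zpowers r := by
  let H := Subgroup.closure {x, y}
  have hc : ∀ a b : H, a * b = b * a := by
    have : IsMulCommutative H := Subgroup.isMulCommutative_closure (k := {x, y}) (by
      rintro a (rfl | rfl) b (rfl | rfl)
      · rfl
      · exact h.eq
      · exact h.eq.symm
      · rfl)
    exact fun a b => mul_comm' a b
  let e := IsFreeGroup.toFreeGroup H
  have hs : Subsingleton (IsFreeGroup.Generators H) := ⟨fun i j => of_commute
    (show of i * of j = of j * of i by
      simpa using congrArg e (hc (e.symm (of i)) (e.symm (of j))))⟩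
  have key : ∃ g : FreeGroup (IsFreeGroup.Generators H), ∀ z, z ∈ Subgroup.zpowers g := by
    by_cases hn : Nonempty (IsFreeGroup.Generators H)
    · obtain ⟨i⟩ := hn
      refine ⟨of i, fun z => ?_⟩
      have : z ∈ Subgroup.closure (Set.range (of : IsFreeGroup.Generators H → _)) := by
        rw [closure_range_of]; trivial
      refine (Subgroup.closure_le _).2 ?_ this
      rintro _ ⟨j, rfl⟩
      rw [Subsingleton.elim j i]
      exact Subgroup.mem_zpowers _
    · rw [not_nonempty_iff] at hn
      exact ⟨1, fun z => by rw [Subsingleton.elim z 1]; exact one_mem _⟩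
  obtain ⟨g, hg⟩ := key
  have h2 : ∀ z ∈ H, z ∈ Subgroup.zpowers ((e.symm g : H) : FreeGroup α) := fun z hz => by
    obtain ⟨k, hk⟩ := hg (e ⟨z, hz⟩)
    refine ⟨k, ?_⟩
    have := congrArg (fun t => ((e.symm t : H) : FreeGroup α)) hk
    simpa using this
  exact ⟨_, h2 x (Subgroup.subset_closure (by simp)), h2 y (Subgroup.subset_closure (by simp))⟩

theorem mem_zpowers_of_commute {α : Type*} {x y : FreeGroup α}
    (χ : FreeGroup α →* Multiplicative ℤ) (hx : χ x = Multiplicative.ofAdd 1)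
    (h : Commute x y) : y ∈ Subgroup.zpowers x := by
  obtain ⟨r, ⟨a, ha⟩, ⟨b, hb⟩⟩ := exists_zpowers_of_commute h
  simp only at ha hb
  have h1 : a * (χ r).toAdd = 1 := by
    rw [← ha, map_zpow] at hx
    simpa using congrArg Multiplicative.toAdd hx
  rcases Int.eq_one_or_neg_one_of_mul_eq_one h1 with rfl | rfl
  · exact ⟨b, by simp only; rw [← ha, ← hb, zpow_one]⟩
  · exact ⟨-b, by simp only; rw [← ha, ← hb]; simp⟩

theorem commute_of_pow {α : Type*} {x y : FreeGroup α} {n : ℕ} (hn : n ≠ 0)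
    (h : Commute (x ^ n) y) : Commute x y := by
  have : (y * x * y⁻¹) ^ n = x ^ n := by
    rw [conj_pow, ← h.eq]; simp
  have := pow_left_injective hn this
  rw [mul_inv_eq_iff_eq_mul] at this
  exact this.symm

end FreeGroup

namespace Fr

/-- The product `X_{k-1} ⋯ X_0`. -/
def wp (m : ℕ) : ℕ → Fr m
  | 0 => 1
  | k + 1 => X m k * wp m k

/-- The loop around all strands. -/
abbrev w (m : ℕ) : Fr m := wp m (m + 1)

theorem wp_succ (m k : ℕ) : wp m (k + 1) = X m k * wp m k := rfl

theorem artin_wp_lt {m k : ℕ} (hk : k < m) {l : ℕ} (hl : l ≤ k) :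
    artin m (sg m k) (wp m l) = wp m l := by
  induction l with
  | zero => simp [wp]
  | succ l ih =>
    rw [wp_succ, map_mul, ih (by omega), artin_sg hk, artinFun_other (by omega) (by omega)]

theorem artin_wp_gt {m k : ℕ} (hk : k < m) (l : ℕ) :
    artin m (sg m k) (wp m (k + 2 + l)) = wp m (k + 2 + l) := by
  induction l with
  | zero =>
    rw [show k + 2 + 0 = k + 1 + 1 from rfl, wp_succ, wp_succ, map_mul, map_mul,
      artin_wp_lt hk le_rfl, artin_sg hk, artinFun_snd hk, artin_sg hk, artinFun_fst hk]
    simp [mul_assoc]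
  | succ l ih =>
    rw [← add_assoc, wp_succ, map_mul, ih, artin_sg hk, artinFun_other (by omega) (by omega)]

theorem artin_w {m : ℕ} (b : Br m) : artin m b (w m) = w m := by
  have := Br.mem_of_sg ((MulAction.stabilizer (MulAut (Fr m)) (w m)).comap (artin m))
    (fun k hk => by
      have := artin_wp_gt hk (m - 1 - k)
      rw [show k + 2 + (m - 1 - k) = m + 1 by omega] at this
      simpa using this) b
  simpa using this

/-- The inclusion adding a letter. -/
def up (m : ℕ) : Fr m →* Fr (m + 1) := lift (X (m + 1))

theorem up_X {m k : ℕ} (hk : k ≤ m) : up m (X m k) = X (m + 1) k := lift_X _ hk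

theorem up_wp {m k : ℕ} (hk : k ≤ m + 1) : up m (wp m k) = wp (m + 1) k := by
  induction k with
  | zero => simp [wp]
  | succ k ih => rw [wp_succ, wp_succ, map_mul, ih (by omega), up_X (by omega)]

theorem artin_up {m : ℕ} (b : Br m) (a : Fr m) :
    artin (m + 1) (Br.incl m b) (up m a) = up m (artin m b a) := by
  let S : Subgroup (Br m) :=
    { carrier := {b | ∀ a, artin (m + 1) (Br.incl m b) (up m a) = up m (artin m b a)}
      one_mem' := fun a => by simp
      mul_mem' := fun {b c} hb hc a => by
        rw [map_mul, map_mul, map_mul, MulAut.mul_apply, MulAut.mul_apply, hc, hb]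
      inv_mem' := fun {b} hb a => by
        have := hb (artin m b⁻¹ a)
        have e : artin m b (artin m b⁻¹ a) = a := by simp
        rw [e] at this
        rw [← this]; simp }
  refine Br.mem_of_sg S (fun k hk a => ?_) b a
  rw [Br.incl_sg hk, artin_sg hk, artin_sg (by omega)]
  have : (artinFun (m + 1) k).comp (up m) = (up m).comp (artinFun m k) := by
    refine hom_ext fun i hi => ?_
    simp only [MonoidHom.comp_apply, up_X hi]
    rcases eq_or_ne i k with rfl | h1
    · rw [artinFun_fst hk, artinFun_fst (by omega)]
      simp [up_X hi, up_X (show i + 1 ≤ m by omega)]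
    rcases eq_or_ne i (k + 1) with rfl | h2
    · rw [artinFun_snd hk, artinFun_snd (by omega), up_X (by omega)]
    · rw [artinFun_other h1 h2, artinFun_other h1 h2, up_X hi]
  exact DFunLike.congr_fun this a

theorem artin_incl_last {m : ℕ} (b : Br m) :
    artin (m + 1) (Br.incl m b) (X (m + 1) (m + 1)) = X (m + 1) (m + 1) := by
  have := Br.mem_of_sg ((MulAction.stabilizer (MulAut (Fr (m + 1))) (X (m + 1) (m + 1))).comap
    ((artin (m + 1)).comp (Br.incl m))) (fun k hk => by
      simp only [Subgroup.mem_comap, MulAction.mem_stabilizer_iff, MonoidHom.comp_apply,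
        MulAut.smul_def]
      rw [Br.incl_sg hk, artin_sg (by omega), artinFun_other (by omega) (by omega)]) b
  simpa using this

/-- The exponent sum of the letter of index `k`. -/
def cnt (m k : ℕ) : Fr m →* Multiplicative ℤ :=
  lift fun i => if i = k then Multiplicative.ofAdd 1 else 1

theorem cnt_X {m i : ℕ} (hi : i ≤ m) (k : ℕ) :
    cnt m k (X m i) = if i = k then Multiplicative.ofAdd 1 else 1 := lift_X _ hi

theorem cnt_wp {m l : ℕ} (hl : l ≤ m + 1) (k : ℕ) :
    cnt m k (wp m l) = if k < l then Multiplicative.ofAdd 1 else 1 := by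
  induction l with
  | zero => simp [wp]
  | succ l ih =>
    rw [wp_succ, map_mul, ih (by omega), cnt_X (by omega)]
    split_ifs <;> first | omega | simp

end Fr

namespace Br
open Fr

theorem loop_last (m : ℕ) : loop m m = sg (m + 1) m ^ 2 := by
  rw [loop, tau_gt (by omega)]; simp

theorem tau_incl {m : ℕ} : ∀ i ≤ m + 1, tau (m + 1) i = incl (m + 1) (tau m i) * sg (m + 2) (m + 1) := by
  refine down_induction ?_ fun i hi ih => ?_
  · rw [tau_gt (m := m) (by omega), tau_succ (by omega), tau_gt (by omega)]; simp
  · rw [tau_succ (show i ≤ m + 1 by omega), tau_succ hi, ih, map_mul, incl_sg (by omega), mul_assoc]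

theorem loop_incl {m i : ℕ} (hi : i ≤ m) : loop (m + 1) i =
    (sg (m + 2) (m + 1))⁻¹ * incl (m + 1) (loop m i) * sg (m + 2) (m + 1) := by
  rw [loop, loop, tau_incl _ (by omega), map_mul, map_mul, map_pow, incl_sg (by omega)]
  simp [mul_assoc]

/-- The last strand going once around all the others. -/
abbrev W (m : ℕ) : Br (m + 1) := loopHom m (w m)

theorem loopHom_up {m : ℕ} (a : Fr m) : loopHom (m + 1) (up m a) =
    (sg (m + 2) (m + 1))⁻¹ * incl (m + 1) (loopHom m a) * sg (m + 2) (m + 1) := by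
  have : (loopHom (m + 1)).comp (up m) = (MulAut.conj (sg (m + 2) (m + 1))⁻¹).toMonoidHom.comp
      ((incl (m + 1)).comp (loopHom m)) := Fr.hom_ext fun i hi => by
    simp [up_X hi, loopHom_X hi, loopHom_X (show i ≤ m + 1 by omega), loop_incl hi]
  simpa using DFunLike.congr_fun this a

theorem W_succ (m : ℕ) :
    W (m + 1) = sg (m + 2) (m + 1) * incl (m + 1) (W m) * sg (m + 2) (m + 1) := by
  rw [W, w, wp_succ, map_mul, loopHom_X le_rfl, loop_last, ← up_wp le_rfl, loopHom_up]
  simp [pow_two, mul_assoc]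

theorem W_zero : W 0 = sg 1 0 * sg 1 0 := by
  rw [W, w, wp_succ, map_mul, loopHom_X le_rfl, loop_last]; simp [wp, pow_two]

theorem commute_incl_W {m : ℕ} (b : Br m) : Commute (incl m b) (W m) := by
  have := incl_mul_loopHom b (w m)
  rwa [artin_w] at this

/-- The full twist. -/
def zz : (m : ℕ) → Br m
  | 0 => 1
  | m + 1 => incl m (zz m) * W m

theorem zz_succ (m : ℕ) : zz (m + 1) = incl m (zz m) * W m := rfl

theorem commute_incl_incl {m : ℕ} (b : Br m) :
    Commute (sg (m + 2) (m + 1)) (incl (m + 1) (incl m b)) := by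
  have := mem_of_sg ((Subgroup.centralizer {sg (m + 2) (m + 1)}).comap
    ((incl (m + 1)).comp (incl m))) (fun k hk => by
      rw [Subgroup.mem_comap, Subgroup.mem_centralizer_singleton_iff, MonoidHom.comp_apply,
        incl_sg hk, incl_sg (by omega)]
      exact sg_comm (by omega)) b
  exact (Subgroup.mem_centralizer_singleton_iff.1 this).symm

theorem braid_core {G : Type*} [Group G] {a b A : G} (h : a * b * a = b * a * b)
    (hA : Commute b A) (hAA : Commute A (a * A * a)) :
    Commute b ((a * A * a) * (b * (a * A * a) * b)) := by
  have e1 : b * (a * A * a) * b * (a * A * a) = a * b * ((a * A * a) * A) * b * a :=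
    calc b * (a * A * a) * b * (a * A * a) = b * a * A * (a * b * a) * A * a := by
          simp only [mul_assoc]
      _ = b * a * (A * b) * a * (b * A) * a := by rw [h]; simp only [mul_assoc]
      _ = (b * a * b) * A * a * A * b * a := by rw [hA.eq]; simp only [mul_assoc, hA.eq]
      _ = _ := by rw [← h]; simp only [mul_assoc]
  have e2 : (a * A * a) * b * (a * A * a) * b = a * b * (A * (a * A * a)) * b * a :=
    calc (a * A * a) * b * (a * A * a) * b = a * A * (a * b * a) * A * a * b := by
          simp only [mul_assoc]
      _ = a * (A * b) * a * (b * A) * a * b := by rw [h]; simp only [mul_assoc]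
      _ = a * b * A * a * A * (b * a * b) := by rw [hA.eq]; simp only [mul_assoc, hA.eq]
      _ = _ := by rw [← h]; simp only [mul_assoc]
  have e3 : b * (a * A * a) * b * (a * A * a) = (a * A * a) * b * (a * A * a) * b := by
    rw [e1, e2, hAA.eq]
  change b * ((a * A * a) * (b * (a * A * a) * b)) = ((a * A * a) * (b * (a * A * a) * b)) * b
  calc b * ((a * A * a) * (b * (a * A * a) * b)) = b * (a * A * a) * b * (a * A * a) * b := by
        simp only [mul_assoc]
    _ = _ := by rw [e3]; simp only [mul_assoc]

theorem commute_sg_zz (m : ℕ) : Commute (sg (m + 1) m) (zz (m + 1)) := by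
  rcases m with _ | _ | m
  · rw [zz_succ, W_zero, zz]
    simp
  · rw [zz_succ, zz_succ, W_succ, W_zero, zz]
    simp only [map_one, one_mul, map_mul, incl_sg (show 0 < 1 by omega)]
    have := braid_core (A := 1) (sg_braid (m := 2) (k := 0) (by omega)) (Commute.one_right _)
      (Commute.one_left _)
    simpa using this
  · rw [zz_succ, zz_succ, map_mul, mul_assoc]
    refine (commute_incl_incl _).mul_right ?_
    rw [W_succ (m + 1), W_succ, map_mul, map_mul, incl_sg (by omega)]
    refine braid_core (sg_braid (by omega)) (commute_incl_incl _) ?_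
    have := (commute_incl_W (m := m + 1) (W m)).map (incl (m + 2))
    rwa [W_succ, map_mul, map_mul, incl_sg (by omega)] at this

theorem commute_zz {m : ℕ} (b : Br m) : Commute (zz m) b := by
  induction m with
  | zero => exact Commute.one_left _
  | succ m ih =>
    refine commute_of_sg (fun k hk => ?_) b
    rcases eq_or_lt_of_le (Nat.le_of_lt_succ hk) with rfl | hk
    · exact (commute_sg_zz _).symm
    · rw [← incl_sg hk, zz_succ]
      exact ((ih _).map (incl m)).mul_left (commute_incl_W _).symm

theorem artin_zz {m : ℕ} (a : Fr m) : artin m (zz m) a = (w m)⁻¹ * a * w m := by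
  apply loopHom_injective
  have h1 := incl_mul_loopHom (zz m) a
  have h2 := (commute_zz (loopHom m a)).eq
  rw [zz_succ, (commute_incl_W (zz m)).eq, mul_assoc, h1, ← mul_assoc, ← mul_assoc,
    mul_left_inj] at h2
  rw [map_mul, map_mul, map_inv, mul_assoc, eq_inv_mul_iff_mul_eq, h2]

theorem artin_incl_zz_lt {m k : ℕ} (hk : k ≤ m) :
    artin (m + 1) (incl m (zz m)) (X (m + 1) k) =
      (wp (m + 1) (m + 1))⁻¹ * X (m + 1) k * wp (m + 1) (m + 1) := by
  rw [← up_X hk, artin_up, artin_zz, map_mul, map_mul, map_inv, up_wp le_rfl]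

theorem ex_loopHom {m : ℕ} {k : ℕ} (hk : k ≤ m) : ex (loopHom m (X m k)) = 2 := by
  have := ex_conj (tau m (k + 1))⁻¹ (sg (m + 1) k ^ 2)
  rw [inv_inv, ex_pow, ex_sg (by omega)] at this
  rw [loopHom_X hk, loop, this]; rfl

theorem ex_wp {m k : ℕ} (hk : k ≤ m + 1) : ex (loopHom m (wp m k)) = 2 * k := by
  induction k with
  | zero => simp [wp, ex_one]
  | succ k ih => rw [wp_succ, map_mul, ex_mul, ih (by omega), ex_loopHom (by omega)]; push_cast; ring

theorem ex_zz (m : ℕ) : ex (zz m) = m * (m + 1) := by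
  induction m with
  | zero => simp [zz, ex_one]
  | succ m ih => rw [zz_succ, ex_mul, ex_incl, ih, ex_wp le_rfl]; push_cast; ring

theorem perm_loopHom {m : ℕ} (a : Fr m) : perm (m + 1) (loopHom m a) = 1 := by
  rw [← Gr.toBr_x, Gr.perm_toBr]; simp

theorem perm_zz (m : ℕ) : perm m (zz m) = 1 := by
  induction m with
  | zero => simp [zz]
  | succ m ih => rw [zz_succ, map_mul, perm_loopHom, perm_incl, ih, one_mul]

theorem perm_tau_lt {m k i : ℕ} (h : k < i) (hi : i ≤ m + 1) :
    perm (m + 1) (tau m i) k = k := by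
  refine down_induction (p := fun i => k < i → perm (m + 1) (tau m i) k = k) (fun _ => ?_)
    (fun i hi ih h => ?_) i hi h
  · rw [tau_gt (by omega)]; simp
  · rw [tau_succ hi, map_mul, Equiv.Perm.mul_apply, ih (by omega), perm_sg (by omega)]
    exact Equiv.swap_apply_of_ne_of_ne (by omega) (by omega)

theorem cr_loop {m k : ℕ} (hk : k ≤ m) (i j : ℕ) : cr (loopHom m (X m k)) i j =
    if (i = k ∧ j = m + 1) ∨ (i = m + 1 ∧ j = k) then 2 else 0 := by
  have hp : perm (m + 1) (sg (m + 1) k ^ 2) = 1 := by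
    rw [map_pow, perm_sg (by omega), pow_two, Equiv.swap_mul_self]
  have h1 := cr_conj (tau m (k + 1))⁻¹ _ hp (perm (m + 1) (tau m (k + 1)) i)
    (perm (m + 1) (tau m (k + 1)) j)
  have h2 : ∀ i, perm (m + 1) (tau m (k + 1))⁻¹ (perm (m + 1) (tau m (k + 1)) i) = i :=
    fun i => by simp
  rw [inv_inv, h2, h2] at h1
  rw [loopHom_X hk, loop, h1]
  have e1 : ∀ i, perm (m + 1) (tau m (k + 1)) i = k ↔ i = k := fun i => by
    rw [← (perm (m + 1) (tau m (k + 1))).injective.eq_iff (a := i),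
      perm_tau_lt (show k < k + 1 by omega) (by omega)]
  have e2 : ∀ i, perm (m + 1) (tau m (k + 1)) i = k + 1 ↔ i = m + 1 := fun i => by
    rw [← (perm (m + 1) (tau m (k + 1))).injective.eq_iff (a := i), Gr.perm_tau _ (by omega)]
  rw [pow_two, cr_mul, cr_sg (by omega), cr_sg (by omega), perm_sg (by omega)]
  have e3 : ∀ a, Equiv.swap k (k + 1) a = k ↔ a = k + 1 := fun a => by
    simp only [Equiv.swap_apply_def]; split_ifs <;> omega
  have e4 : ∀ a, Equiv.swap k (k + 1) a = k + 1 ↔ a = k := fun a => by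
    simp only [Equiv.swap_apply_def]; split_ifs <;> omega
  simp only [e1, e2, e3, e4]
  split_ifs <;> omega

theorem cr_loopHom_lt {m : ℕ} (a : Fr m) {i j : ℕ} (hi : i ≤ m) (hj : j ≤ m) :
    cr (loopHom m a) i j = 0 := by
  let S : Subgroup (Fr m) :=
    { carrier := {a | cr (loopHom m a) i j = 0}
      one_mem' := by simp [cr_one]
      mul_mem' := fun {a b} ha hb => by
        simp only [Set.mem_ofPred_eq] at *
        rw [map_mul, cr_mul_pure _ _ (perm_loopHom b), ha, hb, add_zero]
      inv_mem' := fun {a} ha => by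
        simp only [Set.mem_ofPred_eq] at *
        rw [map_inv, cr_inv_pure _ (perm_loopHom a), ha, neg_zero] }
  exact mem_of_X S (fun k hk => (cr_loop hk i j).trans (if_neg (by omega))) a

theorem cr_loopHom_last {m : ℕ} (a : Fr m) {i : ℕ} (hi : i ≤ m) :
    cr (loopHom m a) i (m + 1) = 2 * (cnt m i a).toAdd ∧
    cr (loopHom m a) (m + 1) i = 2 * (cnt m i a).toAdd := by
  let S : Subgroup (Fr m) :=
    { carrier := {a | cr (loopHom m a) i (m + 1) = 2 * (cnt m i a).toAdd ∧
        cr (loopHom m a) (m + 1) i = 2 * (cnt m i a).toAdd}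
      one_mem' := by simp [cr_one]
      mul_mem' := fun {a b} ha hb => by
        simp only [Set.mem_ofPred_eq] at *
        rw [map_mul, map_mul, cr_mul_pure _ _ (perm_loopHom b), cr_mul_pure _ _ (perm_loopHom b),
          ha.1, ha.2, hb.1, hb.2, toAdd_mul, mul_add]
        exact ⟨rfl, rfl⟩
      inv_mem' := fun {a} ha => by
        simp only [Set.mem_ofPred_eq] at *
        rw [map_inv, map_inv, cr_inv_pure _ (perm_loopHom a), cr_inv_pure _ (perm_loopHom a), ha.1,
          ha.2, toAdd_inv]
        constructor <;> ring }
  refine mem_of_X S (fun k hk => ?_) a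
  simp only [S, Subgroup.mem_mk, Submonoid.mem_mk, Subsemigroup.mem_mk, Set.mem_ofPred_eq,
    cr_loop hk, cnt_X hk]
  have h1 : k ≠ m + 1 := by omega
  have h2 : i ≠ m + 1 := by omega
  by_cases h : i = k
  · simp [h]
  · simp [h, h1.symm, h2, Ne.symm h]

theorem cr_zz {m i j : ℕ} (hi : i ≤ m) (hj : j ≤ m) (hij : i ≠ j) : cr (zz m) i j = 2 := by
  induction m with
  | zero => omega
  | succ m ih =>
    rw [zz_succ, cr_mul_pure _ _ (perm_loopHom _), cr_incl]
    rcases eq_or_lt_of_le hi with rfl | hi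
    · rw [(cr_gt (zz m) (show m < m + 1 by omega) j).1, (cr_loopHom_last _ (by omega)).2,
        cnt_wp le_rfl, if_pos (by omega)]; rfl
    rcases eq_or_lt_of_le hj with rfl | hj
    · rw [(cr_gt (zz m) (show m < m + 1 by omega) i).2, (cr_loopHom_last _ (by omega)).1,
        cnt_wp le_rfl, if_pos (by omega)]; rfl
    · rw [ih (by omega) (by omega), cr_loopHom_lt _ (by omega) (by omega), add_zero]

end Br

namespace Br
open Fr

section
variable {G : Type*} [Group G] {m : ℕ}

theorem braid_map (f : Br m →* G) {k : ℕ} (h : k + 1 < m) :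
    f (sg m k) * f (sg m (k + 1)) * f (sg m k) = f (sg m (k + 1)) * f (sg m k) * f (sg m (k + 1)) := by
  simp only [← map_mul, sg_braid h]

theorem eq_of_commute_of_braid {a b : G} (h : a * b * a = b * a * b) (hc : Commute a b) :
    a = b := by
  have h1 : a * b * a = a * b * b := by rw [h, ← hc.eq]
  exact mul_left_cancel h1

/-- If two adjacent generators have equal images, then all generators do. -/
theorem map_eq_of_adjacent (f : Br m →* G) {k : ℕ} (hk : k + 1 < m)
    (h : f (sg m k) = f (sg m (k + 1))) {i : ℕ} (hi : i < m) : f (sg m i) = f (sg m k) := by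
  have up : ∀ j, k + 1 + j < m → f (sg m (k + 1 + j)) = f (sg m k) ∧
      f (sg m (k + j)) = f (sg m k) := by
    intro j
    induction j with
    | zero => exact fun _ => ⟨h.symm, rfl⟩
    | succ j ih =>
      intro hj
      obtain ⟨h1, h2⟩ := ih (by omega)
      refine ⟨?_, by rw [show k + (j + 1) = k + 1 + j by omega, h1]⟩
      rw [← h1]
      refine (eq_of_commute_of_braid (braid_map f hj) ?_).symm
      change Commute (f (sg m (k + 1 + j))) (f (sg m (k + 1 + j + 1)))
      rw [h1, ← h2]
      exact (commute_sg (m := m) (Or.inl (by omega))).map f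
  have down : ∀ j, j ≤ k → f (sg m (k - j)) = f (sg m k) ∧ f (sg m (k - j + 1)) = f (sg m k) := by
    intro j
    induction j with
    | zero => exact fun _ => ⟨rfl, h.symm⟩
    | succ j ih =>
      intro hj
      obtain ⟨h1, h2⟩ := ih (by omega)
      have e : k - (j + 1) + 1 = k - j := by omega
      refine ⟨?_, by rw [e, h1]⟩
      rw [← h1, ← e]
      refine eq_of_commute_of_braid (braid_map f (by omega)) ?_
      rw [e, h1, ← h2]
      exact (commute_sg (m := m) (Or.inl (by omega))).map f
  rcases le_or_gt i k with hik | hik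
  · have := (down (k - i) (by omega)).1
    rwa [show k - (k - i) = i by omega] at this
  · have := (up (i - k - 1) (by omega)).1
    rwa [show k + 1 + (i - k - 1) = i by omega] at this

theorem map_eq_of_skip (hm : 4 ≤ m) (f : Br m →* G) {k : ℕ} (hk : k + 2 < m)
    (h : f (sg m k) = f (sg m (k + 2))) {i : ℕ} (hi : i < m) : f (sg m i) = f (sg m k) := by
  by_cases hk3 : k + 3 < m
  · rw [h]
    refine map_eq_of_adjacent f (k := k + 2) hk3 ?_ hi
    refine eq_of_commute_of_braid (braid_map f hk3) ?_
    rw [← h]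
    exact (commute_sg (m := m) (Or.inl (by omega))).map f
  · obtain ⟨k, rfl⟩ : ∃ l, k = l + 1 := ⟨k - 1, by omega⟩
    have e : f (sg m k) = f (sg m (k + 1)) := by
      refine eq_of_commute_of_braid (braid_map f (by omega)) ?_
      rw [h]
      exact (commute_sg (m := m) (Or.inl (by omega))).map f
    rw [← e]
    exact map_eq_of_adjacent f (k := k) (by omega) e hi

theorem eq_of_metabelian {a b c : G} (hab : a * b * a = b * a * b) (hbc : b * c * b = c * b * c)
    (hac : Commute a c) (h : Commute (b * a⁻¹) (c * a⁻¹)) : a = c := by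
  have h1 : b * a⁻¹ * c = c * a⁻¹ * b := by
    have := congrArg (· * a) h.eq
    simpa [mul_assoc] using this
  have h2 : a * b * c = c * b * a := by
    have e : b * c * a⁻¹ = a⁻¹ * c * b := by
      rw [mul_assoc, ← (hac.inv_left).eq, ← mul_assoc, h1, (hac.inv_left).eq]
    calc a * b * c = a * (b * c * a⁻¹) * a := by group
      _ = c * b * a := by rw [e]; group
  have h3 : a * b * (a * c) = c * b * (a * c) := by
    calc a * b * (a * c) = a * b * a * c := by group
      _ = b * (a * b * c) := by rw [hab]; group
      _ = b * c * b * a := by rw [h2]; group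
      _ = c * b * (a * c) := by rw [hbc, hac.eq]; group
  exact mul_right_cancel (mul_right_cancel h3)

end

theorem ker_expo_le {m : ℕ} (S : Subgroup (Br m)) [S.Normal]
    (h : ∀ i < m, sg m i * (sg m 0)⁻¹ ∈ S) : (expo m).ker ≤ S := by
  intro b hb
  have key : QuotientGroup.mk' S =
      (zpowersHom (Br m ⧸ S) (QuotientGroup.mk' S (sg m 0))).comp (expo m) := hom_ext fun k hk => by
    rw [MonoidHom.comp_apply, expo_sg hk, zpowersHom_apply]
    simp only [toAdd_ofAdd, zpow_one]
    refine (QuotientGroup.eq_iff_div_mem).2 ?_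
    rw [div_eq_mul_inv]
    exact h k hk
  have := DFunLike.congr_fun key b
  rw [MonoidHom.comp_apply, MonoidHom.mem_ker.1 hb, map_one] at this
  exact (QuotientGroup.eq_one_iff b).1 this

theorem ker_expo_perfect {m : ℕ} (hm : 4 ≤ m) :
    (expo m).ker ≤ ⁅(expo m).ker, (expo m).ker⁆ := by
  set K := (expo m).ker
  let f := QuotientGroup.mk' ⁅K, K⁆
  have hK : ∀ i < m, sg m i * (sg m 0)⁻¹ ∈ K := fun i hi => by
    rw [MonoidHom.mem_ker, map_mul, map_inv, expo_sg hi, expo_sg (by omega), mul_inv_cancel]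
  have hc : ∀ a ∈ K, ∀ b ∈ K, Commute (f a) (f b) := fun a ha b hb => by
    rw [← commutatorElement_eq_one_iff_commute, ← map_commutatorElement]
    exact (QuotientGroup.eq_one_iff _).2 (Subgroup.commutator_mem_commutator ha hb)
  have h02 : f (sg m 0) = f (sg m 2) := by
    have h := hc _ (hK 1 (by omega)) _ (hK 2 (by omega))
    rw [map_mul, map_mul, map_inv] at h
    exact eq_of_metabelian (braid_map f (by omega)) (braid_map f (by omega))
      ((commute_sg (Or.inl (by omega))).map f) h
  refine ker_expo_le _ fun i hi => ?_
  rw [← QuotientGroup.eq_one_iff]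
  change f (sg m i * (sg m 0)⁻¹) = 1
  rw [map_mul, map_inv, map_eq_of_skip hm f (by omega) h02 hi, mul_inv_cancel]

theorem exists_toBr {m : ℕ} {b : Br (m + 1)} (h : perm (m + 1) b (m + 1) = m + 1) :
    ∃ a c, b = loopHom m a * incl m c ∧ perm m c = perm (m + 1) b := by
  refine ⟨(Gr.ofBr b).left, Gr.pr (Gr.ofBr b), ?_, ?_⟩
  · conv_lhs => rw [← Gr.toBr_ofBr h, Gr.eq_x_mul_s (Gr.ofBr b), map_mul, Gr.toBr_x, Gr.toBr_s]
  · rw [← Gr.perm_toBr, Gr.toBr_ofBr h]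

/-- Comparison of the components of two braids fixing the last strand. -/
theorem loop_incl_inj {m : ℕ} {a a' : Fr m} {c c' : Br m}
    (h : loopHom m a * incl m c = loopHom m a' * incl m c') : a = a' ∧ c = c' := by
  have h1 : Gr.x a * Gr.s c = Gr.x a' * Gr.s c' := by
    apply Gr.toBr_injective
    rw [map_mul, map_mul, Gr.toBr_x, Gr.toBr_s, Gr.toBr_x, Gr.toBr_s, h]
  have h2 := congrArg Gr.pr h1
  have h3 := congrArg SemidirectProduct.left h1
  simpa using And.intro h3 h2

instance : Subsingleton (Br 0) := ⟨fun a b => by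
  have h : ∀ a : Br 0, a ∈ (⊥ : Subgroup (Br 0)) := mem_of_sg _ (fun k hk => by omega)
  rw [Subgroup.mem_bot.1 (h a), Subgroup.mem_bot.1 (h b)]⟩

theorem zz_zpow_succ (m : ℕ) (k : ℤ) :
    zz (m + 1) ^ k = incl m (zz m ^ k) * loopHom m (w m ^ k) := by
  rw [zz_succ, (commute_incl_W _).mul_zpow, ← map_zpow, W, ← map_zpow]

theorem zz_zpow_succ' (m : ℕ) (k : ℤ) :
    zz (m + 1) ^ k = loopHom m (w m ^ k) * incl m (zz m ^ k) := by
  rw [zz_zpow_succ, map_zpow (loopHom m)]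
  exact ((commute_incl_W _).zpow_right k).eq

theorem mul_zz_zpow (m : ℕ) (a : Fr m) (k : ℤ) :
    loopHom m a * incl m (zz m ^ k) * zz (m + 1) ^ (-k) = loopHom m (a * w m ^ (-k)) := by
  rw [zz_zpow_succ, mul_assoc, ← mul_assoc (incl m _), ← map_mul, zpow_neg (zz m),
    mul_inv_cancel, map_one, one_mul, map_mul]

theorem commute_zz_zpow {m : ℕ} (b : Br m) (k : ℤ) : Commute b (zz m ^ k) :=
  (commute_zz b).symm.zpow_right k

theorem mem_zpowers_X_zero (a : Fr 0) : a ∈ Subgroup.zpowers (X 0 0) :=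
  mem_of_X _ (fun k hk => by rw [Nat.le_zero.1 hk]; exact Subgroup.mem_zpowers _) a

theorem w_zero : w 0 = X 0 0 := by rw [w, wp_succ]; simp [wp]

theorem mem_zpowers_one (p : Br 1) (hp : perm 1 p = 1) : ∃ k : ℤ, p = zz 1 ^ k := by
  obtain ⟨a, c, rfl, -⟩ := exists_toBr (m := 0) (b := p) (by rw [hp]; rfl)
  obtain ⟨k, rfl⟩ := mem_zpowers_X_zero a
  refine ⟨k, ?_⟩
  rw [zz_zpow_succ', w_zero, Subsingleton.elim c (zz 0 ^ k)]

/-- A pure braid commuting with all pure braids is a power of the full twist. -/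
theorem eq_zz_zpow_of_commute {m : ℕ} {b : Br m} (hb : perm m b = 1)
    (h : ∀ p, perm m p = 1 → Commute b p) : ∃ k : ℤ, b = zz m ^ k := by
  induction m with
  | zero => exact ⟨0, Subsingleton.elim _ _⟩
  | succ m ih =>
    rcases Nat.eq_zero_or_pos m with rfl | hm
    · exact mem_zpowers_one b hb
    obtain ⟨a, c, rfl, hc⟩ := exists_toBr (b := b) (by rw [hb]; rfl)
    obtain ⟨k, rfl⟩ := ih (hc.trans hb) fun p hp => by
      have h1 := (h (incl m p) (by rw [perm_incl, hp])).eq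
      rw [mul_assoc, ← map_mul, ← mul_assoc, incl_mul_loopHom, mul_assoc, ← map_mul] at h1
      exact (loop_incl_inj h1).2
    refine ⟨k, ?_⟩
    have h1 : ∀ u, Commute (a * w m ^ (-k)) u := fun u => by
      have h2 := (h (loopHom m u) (perm_loopHom u)).mul_left
        (commute_zz_zpow (loopHom m u) (-k)).symm
      rw [mul_zz_zpow] at h2
      apply loopHom_injective
      simpa using h2.eq
    obtain ⟨i, hi⟩ := FreeGroup.mem_zpowers_of_commute (cnt m 0) (cnt_X (by omega) 0) (h1 (X m 0)).symm
    obtain ⟨j, hj⟩ := FreeGroup.mem_zpowers_of_commute (cnt m 1) (cnt_X hm 1) (h1 (X m 1)).symm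
    simp only at hi hj
    have h2 : a * w m ^ (-k) = 1 := by
      have := congrArg (cnt m 0) (hi.trans hj.symm)
      rw [map_zpow, map_zpow, cnt_X (by omega), cnt_X (by omega)] at this
      have : i = 0 := by simpa using congrArg Multiplicative.toAdd this
      rw [← hi, this, zpow_zero]
    rw [← mul_inv_eq_one, ← zpow_neg, mul_zz_zpow, h2, map_one]

theorem ex_zz_ne_zero {m : ℕ} (hm : 0 < m) : ex (zz m) ≠ 0 := by
  rw [ex_zz]; positivity

theorem zz_zpow_inj {m : ℕ} (hm : 0 < m) {i j : ℤ} (h : zz m ^ i = zz m ^ j) : i = j := by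
  have := congrArg ex h
  rw [ex_zpow, ex_zpow] at this
  exact mul_right_cancel₀ (ex_zz_ne_zero hm) this

/-- Pure roots of powers of the full twist are powers of the full twist. -/
theorem eq_zz_zpow_of_pow {m : ℕ} {p : Br m} (hp : perm m p = 1) {l : ℕ} (hl : l ≠ 0) {k : ℤ}
    (h : p ^ l = zz m ^ k) : ∃ j : ℤ, p = zz m ^ j := by
  induction m generalizing k with
  | zero => exact ⟨0, Subsingleton.elim _ _⟩
  | succ m ih =>
    rcases Nat.eq_zero_or_pos m with rfl | hm
    · exact mem_zpowers_one p hp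
    obtain ⟨a, c, rfl, hc⟩ := exists_toBr (b := p) (by rw [hp]; rfl)
    have h1 : c ^ l = zz m ^ k := by
      rw [← Gr.toBr_x, ← Gr.toBr_s, ← map_mul, ← map_pow, zz_zpow_succ', ← Gr.toBr_x,
        ← Gr.toBr_s, ← map_mul] at h
      have h2 := congrArg Gr.pr (Gr.toBr_injective m h)
      rw [map_pow, map_mul, map_mul] at h2
      simpa only [SemidirectProduct.rightHom_inl, SemidirectProduct.rightHom_inr, one_mul] using h2
    obtain ⟨j, rfl⟩ := ih (hc.trans hp) h1
    rw [← zpow_natCast, ← zpow_mul] at h1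
    have hj := zz_zpow_inj hm h1
    refine ⟨j, ?_⟩
    have h2 : (loopHom m a * incl m (zz m ^ j) * zz (m + 1) ^ (-j)) ^ l = 1 := by
      rw [(commute_zz_zpow _ _).mul_pow, h, ← zpow_natCast, ← zpow_mul, ← hj, ← zpow_add]
      simp
    rw [← mul_inv_eq_one, ← zpow_neg]
    rw [mul_zz_zpow, ← map_pow] at h2
    have h3 : (a * w m ^ (-j)) ^ l = 1 := loopHom_injective m (by rw [h2, map_one])
    rw [mul_zz_zpow, (pow_eq_one_iff_left hl).1 h3, map_one]

theorem perm_injOn {m : ℕ} {a b : Br m} (h : ∀ i ≤ m, perm m a i = perm m b i) :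
    perm m a = perm m b := by
  ext i
  rcases le_or_gt i m with hi | hi
  · exact h i hi
  · rw [perm_apply_of_gt _ hi, perm_apply_of_gt _ hi]

theorem perm_eq_one_of_commute {m : ℕ} (hm : 2 ≤ m) {b : Br m}
    (h : ∀ k < m, Commute (perm m b) (perm m (sg m k))) : perm m b = 1 := by
  have key : ∀ k < m, (perm m b k = k ∨ perm m b k = k + 1) ∧
      (perm m b (k + 1) = k ∨ perm m b (k + 1) = k + 1) ∧ perm m b k ≠ perm m b (k + 1) := by
    intro k hk
    have h1 := (h k hk).eq
    have h2 := DFunLike.congr_fun h1 k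
    rw [perm_sg hk, Equiv.Perm.mul_apply, Equiv.Perm.mul_apply, Equiv.swap_apply_left] at h2
    have h3 : perm m b k ≠ perm m b (k + 1) := fun e => by
      have := (perm m b).injective e
      omega
    by_cases e1 : perm m b k = k
    · rw [e1, Equiv.swap_apply_left] at h2; omega
    by_cases e2 : perm m b k = k + 1
    · rw [e2, Equiv.swap_apply_right] at h2; omega
    · rw [Equiv.swap_apply_of_ne_of_ne e1 e2] at h2; omega
  rw [← map_one (perm m)]
  refine perm_injOn fun i hi => ?_
  rw [map_one, Equiv.Perm.one_apply]
  have k0 := key 0 (by omega)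
  have k1 := key 1 (by omega)
  simp only [zero_add, Nat.reduceAdd] at k0 k1
  rcases Nat.eq_zero_or_pos i with rfl | h0
  · omega
  have k2 := key (i - 1) (by omega)
  rw [show i - 1 + 1 = i by omega] at k2
  rcases eq_or_lt_of_le hi with rfl | hi
  · have k3 := key (i - 2) (by omega)
    rw [show i - 2 + 1 = i - 1 by omega] at k3
    omega
  · have k3 := key i hi
    omega

theorem center_eq {m : ℕ} (hm : 2 ≤ m) :
    Subgroup.center (Br m) = Subgroup.zpowers (zz m) := by
  ext b
  constructor
  · intro h
    have hc : ∀ c, Commute b c := fun c => (Subgroup.mem_center_iff.1 h c).symm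
    obtain ⟨k, hk⟩ := eq_zz_zpow_of_commute (perm_eq_one_of_commute hm fun k _ => (hc _).map (perm m))
      fun p _ => hc p
    exact ⟨k, hk.symm⟩
  · rintro ⟨k, rfl⟩
    exact Subgroup.mem_center_iff.2 fun c => (commute_zz_zpow c k).eq

end Br

theorem FreeGroup.hom_eq_one {H α : Type*} [Group H]
    (hH : ∀ χ : H →* Multiplicative ℤ, χ = 1) (f : H →* FreeGroup α) : f = 1 := by
  let e := IsFreeGroup.toFreeGroup f.range
  have hi : IsEmpty (IsFreeGroup.Generators f.range) := ⟨fun i => by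
    let c : FreeGroup (IsFreeGroup.Generators f.range) →* Multiplicative ℤ :=
      FreeGroup.lift fun _ => Multiplicative.ofAdd 1
    have h1 := hH (c.comp (e.toMonoidHom.comp f.rangeRestrict))
    obtain ⟨h, hh⟩ := f.rangeRestrict_surjective (e.symm (of i))
    have h2 := DFunLike.congr_fun h1 h
    simp [hh, c] at h2⟩
  ext1 h
  have h1 : e (f.rangeRestrict h) = 1 := Subsingleton.elim _ _
  have h2 : f.rangeRestrict h = 1 := by simpa using h1
  exact congrArg Subtype.val h2

namespace Br

/-- Groups without homomorphisms onto the integers have no pure braid quotients. -/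
theorem hom_eq_one {H : Type*} [Group H] (hH : ∀ χ : H →* Multiplicative ℤ, χ = 1) {m : ℕ}
    (f : H →* Br m) (hf : ∀ h, perm m (f h) = 1) : f = 1 := by
  induction m with
  | zero => ext1 h; exact Subsingleton.elim _ _
  | succ m ih =>
    have hl : ∀ h, perm (m + 1) (f h) (m + 1) = m + 1 := fun h => by rw [hf]; rfl
    let g : H →* Gr m :=
      { toFun := fun h => Gr.ofBr (f h)
        map_one' := by rw [map_one]; exact Gr.cocyc_one _
        map_mul' := fun a b => by rw [map_mul, Gr.ofBr_mul _ (hl b)] }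
    have hg : ∀ h, Gr.toBr m (g h) = f h := fun h => Gr.toBr_ofBr (hl h)
    have h1 : Gr.pr.comp g = 1 := ih _ fun h => by
      rw [MonoidHom.comp_apply, ← Gr.perm_toBr, hg, hf]
    have h1' : ∀ h, Gr.pr (g h) = 1 := fun h => DFunLike.congr_fun h1 h
    let u : H →* Fr m :=
      { toFun := fun h => (g h).left
        map_one' := by simp
        map_mul' := fun a b => by
          have : (g a).right = 1 := h1' a
          rw [map_mul, SemidirectProduct.mul_left, this]; simp }
    have h2 := FreeGroup.hom_eq_one hH u
    ext1 h
    have h3 : (g h).left = 1 := DFunLike.congr_fun h2 h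
    rw [← hg, Gr.eq_x_mul_s (g h), h1', h3]; simp

theorem hom_eq_one_of_perfect {G : Type*} [Group G] {K : Subgroup G} (hK : K ≤ ⁅K, K⁆) {m : ℕ}
    (f : G →* Br m) (hf : ∀ k ∈ K, perm m (f k) = 1) {k : G} (hk : k ∈ K) : f k = 1 := by
  have := hom_eq_one (H := K) (fun χ => ?_) (f.comp K.subtype) fun h => hf h h.2
  · exact DFunLike.congr_fun this ⟨k, hk⟩
  · have h1 : ⁅K, K⁆ ≤ χ.ker.map K.subtype := Subgroup.commutator_le.2 fun a ha b hb => by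
      refine ⟨⟨a, ha⟩ * ⟨b, hb⟩ * ⟨a, ha⟩⁻¹ * ⟨b, hb⟩⁻¹, ?_, rfl⟩
      change χ _ = 1
      rw [map_mul, map_mul, map_mul, map_inv, map_inv, mul_comm (χ _)]
      simp
    ext1 h
    obtain ⟨h', h2, h3⟩ := h1 (hK h.2)
    rw [← Subtype.ext h3]
    exact h2

end Br

namespace FreeGroup

variable {α : Type*}

/-- The product of syllables. -/
def sprod (y : α) (l : List (Bool × FreeGroup α)) : FreeGroup α :=
  (l.map fun p => mk [(y, p.1)] * p.2).prod

/-- The condition for two syllables to be reduced. -/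
def SRel (p q : Bool × FreeGroup α) : Prop := p.2 = 1 → p.1 = q.1

section
variable {y : α}

theorem sprod_nil : sprod y ([] : List (Bool × FreeGroup α)) = 1 := rfl

theorem sprod_cons (p : Bool × FreeGroup α) (l : List (Bool × FreeGroup α)) :
    sprod y (p :: l) = mk [(y, p.1)] * p.2 * sprod y l := by simp [sprod]

theorem sprod_append (l l' : List (Bool × FreeGroup α)) :
    sprod y (l ++ l') = sprod y l * sprod y l' := by simp [sprod]

end

variable [DecidableEq α]

/-- A cyclically reduced word is shortest in its conjugacy class. -/
theorem length_le_norm_of_isConj {L : List (α × Bool)} (hL : IsCyclicallyReduced L)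
    {g : FreeGroup α} (h : IsConj (mk L) g) : L.length ≤ norm g := by
  obtain ⟨c, rfl⟩ := isConj_iff.1 h
  by_contra! hlt
  let M := 2 * norm c + 1
  have h1 : norm (mk L ^ M) = M * L.length := by
    have e : mk L ^ M = mk (List.replicate M L).flatten := by
      rw [pow_mk]
    rw [e, norm, toWord_mk, (hL.flatten_replicate M).isReduced.reduce_eq]
    simp
  have h2 : norm (mk L ^ M) ≤ norm c + M * norm (c * mk L * c⁻¹) + norm c := by
    have e : mk L ^ M = c⁻¹ * (c * mk L * c⁻¹) ^ M * c := by rw [conj_pow]; group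
    have e2 : ∀ (g : FreeGroup α) (k : ℕ), norm (g ^ k) ≤ k * norm g := fun g k => by
      induction k with
      | zero => simp
      | succ k ih =>
        rw [pow_succ]
        calc _ ≤ _ := norm_mul_le _ _
          _ ≤ _ := by rw [add_mul, one_mul]; omega
    rw [e]
    calc _ ≤ norm (c⁻¹ * (c * mk L * c⁻¹) ^ M) + norm c := norm_mul_le _ _
      _ ≤ norm c⁻¹ + norm ((c * mk L * c⁻¹) ^ M) + norm c := by
        have := norm_mul_le c⁻¹ ((c * mk L * c⁻¹) ^ M); omega
      _ ≤ _ := by rw [norm_inv_eq]; have := e2 (c * mk L * c⁻¹) M; omega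
  have h3 : M * (norm (c * mk L * c⁻¹) + 1) ≤ M * L.length := Nat.mul_le_mul_left _ hlt
  rw [mul_add, ← h1] at h3
  omega

/-- The elements whose reduced word avoids a letter. -/
def avoid (y : α) : Subgroup (FreeGroup α) where
  carrier := {a | ∀ p ∈ a.toWord, p.1 ≠ y}
  one_mem' := by simp
  mul_mem' := fun {a b} ha hb p hp => by
    have h := (toWord_mul_sublist a b).subset hp
    rcases List.mem_append.1 h with h | h
    · exact ha p h
    · exact hb p h
  inv_mem' := fun {a} ha p hp => by
    rw [toWord_inv, invRev, List.mem_reverse, List.mem_map] at hp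
    obtain ⟨q, hq, rfl⟩ := hp
    exact ha q hq

theorem mem_avoid {y : α} {a : FreeGroup α} : a ∈ avoid y ↔ ∀ p ∈ a.toWord, p.1 ≠ y := Iff.rfl

theorem of_mem_avoid {x y : α} (h : x ≠ y) : of x ∈ avoid y := by
  rw [mem_avoid, toWord_of]; simpa using h

theorem avoid_induction {y : α} {a : FreeGroup α} (ha : a ∈ avoid y) (S : Subgroup (FreeGroup α))
    (hS : ∀ x, x ≠ y → of x ∈ S) : a ∈ S := by
  rw [mem_avoid] at ha
  rw [← mk_toWord (x := a)]
  generalize a.toWord = L at ha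
  induction L with
  | nil => exact one_mem S
  | cons p L ih =>
    rw [show mk (p :: L) = mk [p] * mk L by rw [mul_mk]; rfl]
    refine mul_mem ?_ (ih fun q hq => ha q (List.mem_cons_of_mem _ hq))
    have := hS _ (ha p List.mem_cons_self)
    obtain ⟨x, _ | _⟩ := p
    · exact inv_mem this
    · exact this

/-- The word made of syllables `y ^ ±1 * a`. -/
def syll (y : α) (l : List (Bool × FreeGroup α)) : List (α × Bool) :=
  l.flatMap fun p => (y, p.1) :: p.2.toWord

variable {y : α}

theorem mk_syll (l : List (Bool × FreeGroup α)) : mk (syll y l) = sprod y l := by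
  induction l with
  | nil => rfl
  | cons p l ih =>
    rw [sprod_cons, ← ih, show mk [(y, p.1)] * p.2 = mk ((y, p.1) :: p.2.toWord) by
      conv_lhs => rw [← mk_toWord (x := p.2), mul_mk]
      rfl, mul_mk]
    simp [syll]

theorem syll_isReduced {l : List (Bool × FreeGroup α)} (hl : l.IsChain SRel)
    (hA : ∀ p ∈ l, p.2 ∈ avoid y) : IsReduced (syll y l) := by
  induction l with
  | nil => simp [syll]
  | cons p l ih =>
    have h1 := ih hl.tail fun q hq => hA q (List.mem_cons_of_mem _ hq)
    have h2 := mem_avoid.1 (hA p List.mem_cons_self)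
    change IsReduced ((y, p.1) :: (p.2.toWord ++ syll y l))
    rw [IsReduced, List.isChain_cons, List.isChain_append]
    refine ⟨?_, isReduced_toWord, h1, ?_⟩
    · intro q hq
      rcases hw : p.2.toWord with _ | ⟨q', L⟩
      · rw [hw] at hq
        rcases l with _ | ⟨r, l⟩
        · simp [syll] at hq
        · have : q = (y, r.1) := by simpa [syll, eq_comm] using hq
          rw [this]
          exact fun _ => (List.isChain_cons_cons.1 hl).1 (toWord_eq_nil_iff.1 hw)
      · rw [hw] at hq h2
        have : q = q' := by simpa [eq_comm] using hq
        rw [this]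
        exact fun e => absurd e.symm (h2 q' List.mem_cons_self)
    · intro q hq r hr
      have hq := h2 q (List.mem_of_getLast? hq)
      rcases l with _ | ⟨s, l⟩
      · simp [syll] at hr
      · have : r = (y, s.1) := by simpa [syll, eq_comm] using hr
        rw [this]
        exact fun e => absurd e hq

theorem syll_length (l : List (Bool × FreeGroup α)) :
    (syll y l).length = (l.map fun p => norm p.2 + 1).sum := by
  simp only [syll, List.length_flatMap, List.length_cons, norm]

/-- A nonempty list of syllables is a cyclic normal form. -/
structure IsCyc (y : α) (p : Bool × FreeGroup α) (l : List (Bool × FreeGroup α)) : Prop where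
  chain : (p :: l ++ [p]).IsChain SRel
  mem : ∀ q ∈ p :: l, q.2 ∈ avoid y

theorem IsCyc.isCyclicallyReduced {p : Bool × FreeGroup α} {l : List (Bool × FreeGroup α)}
    (h : IsCyc y p l) : IsCyclicallyReduced (syll y (p :: l)) := by
  have h1 : IsReduced (syll y (p :: l ++ [p])) := syll_isReduced h.chain fun q hq => by
    refine h.mem q ?_
    simp only [List.cons_append, List.mem_cons, List.mem_append] at hq ⊢
    simpa [or_comm, or_assoc] using hq
  rw [syll, List.flatMap_append, IsReduced, List.isChain_append] at h1
  refine ⟨h1.1, fun q hq r hr => h1.2.2 q hq r ?_⟩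
  have : r = (y, p.1) := by simpa [syll, eq_comm] using hr
  rw [this]
  simp

theorem IsCyc.length_le {p : Bool × FreeGroup α} {l : List (Bool × FreeGroup α)}
    (h : IsCyc y p l) {g : FreeGroup α} (hg : IsConj (sprod y (p :: l)) g) :
    ((p :: l).map fun p => norm p.2 + 1).sum ≤ norm g := by
  rw [← syll_length (y := y)]
  exact length_le_norm_of_isConj h.isCyclicallyReduced (by rwa [mk_syll])

/-- The linear normal form. -/
theorem exists_sprod (y : α) (g : FreeGroup α) : ∃ a l, g = a * sprod y l ∧ a ∈ avoid y ∧
    (∀ p ∈ l, p.2 ∈ avoid y) ∧ l.IsChain SRel := by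
  rw [← mk_toWord (x := g)]
  generalize g.toWord = L
  induction L with
  | nil => exact ⟨1, [], by simp [sprod, one_eq_mk], one_mem _, by simp, by simp⟩
  | cons p L ih =>
    obtain ⟨a, l, h1, h2, h3, h4⟩ := ih
    rw [show mk (p :: L) = mk [p] * mk L by rw [mul_mk]; rfl, h1]
    obtain ⟨x, e⟩ := p
    by_cases hx : x = y
    · subst hx
      by_cases hc : a = 1 ∧ ∃ b l', l = (!e, b) :: l'
      · obtain ⟨rfl, b, l', rfl⟩ := hc
        refine ⟨b, l', ?_, h3 _ List.mem_cons_self, fun p hp => h3 p (List.mem_cons_of_mem _ hp),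
          h4.tail⟩
        rw [sprod_cons, one_mul, ← mul_assoc, ← mul_assoc]
        have : mk [(x, e)] * mk [(x, !e)] = 1 := by
          cases e
          · exact inv_mul_cancel (of x)
          · exact mul_inv_cancel (of x)
        rw [this, one_mul]
      · refine ⟨1, (e, a) :: l, by rw [sprod_cons, one_mul, mul_assoc], one_mem _, ?_, ?_⟩
        · intro p hp
          rcases List.mem_cons.1 hp with rfl | hp
          · exact h2
          · exact h3 p hp
        · refine List.isChain_cons.2 ⟨fun q hq h => ?_, h4⟩
          by_contra hne
          refine hc ⟨h, q.2, l.tail, ?_⟩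
          obtain ⟨l', rfl⟩ := List.head?_eq_some_iff.1 hq
          obtain ⟨e', b⟩ := q
          simp only at hne
          have : e' = !e := by cases e <;> cases e' <;> simp_all
          simp [this]
    · refine ⟨mk [(x, e)] * a, l, by rw [mul_assoc], mul_mem ?_ h2, h3, h4⟩
      cases e
      · exact inv_mem (of_mem_avoid hx)
      · exact of_mem_avoid hx

/-- The cyclic normal form. -/
theorem exists_isCyc (y : α) (g : FreeGroup α) : ∃ g', IsConj g g' ∧
    (g' ∈ avoid y ∨ ∃ p l, g' = sprod y (p :: l) ∧ IsCyc y p l) := by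
  obtain ⟨a, l, rfl, h2, h3, h4⟩ := exists_sprod y g
  induction hk : l.length using Nat.strong_induction_on generalizing a l with
  | _ k ih =>
  rcases List.eq_nil_or_concat l with rfl | ⟨t, ⟨e, b⟩, rfl⟩
  · exact ⟨a, by rw [sprod_nil, mul_one], Or.inl h2⟩
  rw [List.concat_eq_append] at *
  have hconj : IsConj (a * sprod y (t ++ [(e, b)])) (sprod y (t ++ [(e, b * a)])) :=
    isConj_iff.2 ⟨a⁻¹, by simp [sprod, mul_assoc]⟩
  have hch : (t ++ [(e, b * a)]).IsChain SRel := by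
    rw [List.isChain_append] at h4 ⊢
    refine ⟨h4.1, by simp, fun p hp q hq => ?_⟩
    have h5 := h4.2.2 p hp (e, b) (by simp)
    have : q = (e, b * a) := by simpa [eq_comm] using hq
    rw [this]; exact h5
  have hb : b * a ∈ avoid y := mul_mem (h3 (e, b) (by simp)) h2
  rcases t with _ | ⟨⟨e', b'⟩, t⟩
  · refine ⟨_, hconj, Or.inr ⟨(e, b * a), [], rfl, ?_, ?_⟩⟩
    · simp [SRel]
    · simpa using hb
  by_cases hr : SRel (e, b * a) (e', b')
  · refine ⟨_, hconj, Or.inr ⟨(e', b'), t ++ [(e, b * a)], rfl, ?_, ?_⟩⟩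
    · rw [List.isChain_append]
      refine ⟨hch, by simp, fun p hp q hq => ?_⟩
      have h1 : p = (e, b * a) := by
        rw [← List.cons_append, List.getLast?_append] at hp; simpa [eq_comm] using hp
      have h5 : q = (e', b') := by simpa [eq_comm] using hq
      rw [h1, h5]; exact hr
    · intro q hq
      rw [← List.cons_append, List.mem_append] at hq
      rcases hq with hq | hq
      · exact h3 q (List.mem_append_left _ hq)
      · rw [List.mem_singleton.1 hq]; exact hb
  · simp only [SRel, Classical.not_imp] at hr
    have hee : e = !e' := by cases e <;> cases e' <;> simp_all
    obtain ⟨g', h5, h6⟩ := ih t.length (by simp at hk; omega) b' t (h3 (e', b') (by simp))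
      (fun p hp => h3 p (by simp [hp])) ((List.isChain_append.1 h4).1.tail) rfl
    refine ⟨g', hconj.trans (IsConj.trans (isConj_iff.2 ⟨(mk [(y, e')])⁻¹, ?_⟩) h5), h6⟩
    rw [List.cons_append, sprod_cons, sprod_append, sprod_cons, sprod_nil, hr.1, hee]
    have : (mk [(y, e')])⁻¹ = mk [(y, !e')] := rfl
    rw [inv_inv, ← this]
    group

end FreeGroup

namespace FreeGroup

variable {α : Type*}

section
variable (L R : Bool → FreeGroup α)

/-- The sign of the first syllable, or the given one. -/
def headSign (l : List (Bool × FreeGroup α)) (e : Bool) : Bool := (l.head?.map Prod.fst).getD e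

/-- The syllables of the image under `y ^ ε ↦ L ε * y ^ ε * R ε`. -/
def tr : List (Bool × FreeGroup α) → Bool → List (Bool × FreeGroup α)
  | [], _ => []
  | p :: l, e => (p.1, R p.1 * p.2 * L (headSign l e)) :: tr l e

variable {L R}

theorem headSign_tr (l : List (Bool × FreeGroup α)) (e : Bool) (b : FreeGroup α) :
    ∀ q ∈ (tr L R l e ++ [(e, b)]).head?, q.1 = headSign l e := by
  cases l with
  | nil => simp [tr, headSign]
  | cons p l => simp [tr, headSign]

theorem headSign_append (l : List (Bool × FreeGroup α)) (e : Bool) (b : FreeGroup α) :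
    ∀ q ∈ (l ++ [(e, b)]).head?, q.1 = headSign l e := by
  cases l with
  | nil => simp [headSign]
  | cons p l => simp [headSign]

theorem head?_append_singleton (l : List (Bool × FreeGroup α)) (e : Bool) (b : FreeGroup α) :
    ∃ q ∈ (l ++ [(e, b)]).head?, q.1 = headSign l e := by
  cases l with
  | nil => simp [headSign]
  | cons p l => simp [headSign]

theorem isChain_tr (hLR : ∀ ε, R ε * L (!ε) = 1) {l : List (Bool × FreeGroup α)} {e : Bool}
    {b b' : FreeGroup α} (h : (l ++ [(e, b)]).IsChain SRel) :
    (tr L R l e ++ [(e, b')]).IsChain SRel := by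
  induction l with
  | nil => simp [tr]
  | cons p l ih =>
    rw [List.cons_append, List.isChain_cons] at h
    rw [tr, List.cons_append, List.isChain_cons]
    refine ⟨fun q hq h1 => ?_, ih h.2⟩
    rw [headSign_tr l e b' q hq]
    obtain ⟨r, hr, hr'⟩ := head?_append_singleton l e b
    have h2 := h.1 r hr
    rw [SRel, hr'] at h2
    by_contra hne
    have h3 : headSign l e = !p.1 := by
      revert hne
      generalize headSign l e = u
      simp only
      cases p.1 <;> cases u <;> simp
    refine hne (h2 ?_)
    simp only at h1
    rw [h3, eq_inv_of_mul_eq_one_right (hLR p.1), mul_inv_eq_one] at h1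
    simpa using h1

theorem map_sprod {y : α} {T : FreeGroup α →* FreeGroup α}
    (hy : ∀ ε, T (mk [(y, ε)]) = L ε * mk [(y, ε)] * R ε) {l : List (Bool × FreeGroup α)}
    (hl : ∀ p ∈ l, T p.2 = p.2) (e : Bool) :
    T (sprod y l) * L e = L (headSign l e) * sprod y (tr L R l e) := by
  induction l with
  | nil => simp [sprod, tr, headSign]
  | cons p l ih =>
    have := ih fun q hq => hl q (List.mem_cons_of_mem _ hq)
    rw [sprod_cons, _root_.map_mul, mul_assoc, this, _root_.map_mul, hy, hl p List.mem_cons_self, tr,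
      sprod_cons]
    simp [headSign, mul_assoc]

end

variable {y : α}

theorem mem_tr_const {c : FreeGroup α} {l : List (Bool × FreeGroup α)} {e : Bool}
    {p : Bool × FreeGroup α} (hp : p ∈ l) :
    (p.1, c⁻¹ * p.2 * c) ∈ tr (fun _ => c) (fun _ => c⁻¹) l e := by
  induction l with
  | nil => simp at hp
  | cons q l ih =>
    rw [tr]
    rcases List.mem_cons.1 hp with rfl | hp
    · exact List.mem_cons_self
    · exact List.mem_cons_of_mem _ (ih hp)

theorem sprod_mem {l : List (Bool × FreeGroup α)} {S : Subgroup (FreeGroup α)} (hy : of y ∈ S)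
    (hl : ∀ p ∈ l, p.2 ∈ S) : sprod y l ∈ S := by
  refine list_prod_mem fun x hx => ?_
  obtain ⟨p, hp, rfl⟩ := List.mem_map.1 hx
  refine mul_mem ?_ (hl p hp)
  obtain ⟨_ | _, a⟩ := p
  · exact inv_mem hy
  · exact hy

theorem conj_hom_syll {c : FreeGroup α} {T : FreeGroup α →* FreeGroup α}
    (hy : T (of y) = c * of y * c⁻¹) (ε : Bool) :
    T (mk [(y, ε)]) = c * mk [(y, ε)] * c⁻¹ := by
  cases ε
  · change T (of y)⁻¹ = c * (of y)⁻¹ * c⁻¹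
    rw [_root_.map_inv, hy]; group
  · exact hy

variable [DecidableEq α]

theorem tr_mem_avoid {L R : Bool → FreeGroup α} (hL : ∀ ε, L ε ∈ avoid y) (hR : ∀ ε, R ε ∈ avoid y)
    {l : List (Bool × FreeGroup α)} (hl : ∀ p ∈ l, p.2 ∈ avoid y) (e : Bool) :
    ∀ p ∈ tr L R l e, p.2 ∈ avoid y := by
  induction l with
  | nil => simp [tr]
  | cons p l ih =>
    intro q hq
    rw [tr, List.mem_cons] at hq
    rcases hq with rfl | hq
    · exact mul_mem (mul_mem (hR _) (hl p List.mem_cons_self)) (hL _)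
    · exact ih (fun q hq => hl q (List.mem_cons_of_mem _ hq)) q hq

theorem IsCyc.norm_tr_le {L R : Bool → FreeGroup α} (hLR : ∀ ε, R ε * L (!ε) = 1)
    (hL : ∀ ε, L ε ∈ avoid y) (hR : ∀ ε, R ε ∈ avoid y) {T : FreeGroup α →* FreeGroup α}
    (hT : ∀ a ∈ avoid y, T a = a)
    (hy : ∀ ε, T (FreeGroup.mk [(y, ε)]) = L ε * FreeGroup.mk [(y, ε)] * R ε)
    {p : Bool × FreeGroup α} {l : List (Bool × FreeGroup α)} (h : IsCyc y p l)
    {g : FreeGroup α} (hg : IsConj (T (sprod y (p :: l))) g) :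
    ∀ q ∈ tr L R (p :: l) p.1, norm q.2 ≤ norm g := by
  have h1 := map_sprod hy (fun q hq => hT _ (h.mem q hq)) p.1
  have h2 : IsConj (sprod y (tr L R (p :: l) p.1)) (T (sprod y (p :: l))) := by
    rw [eq_mul_inv_of_mul_eq h1]
    exact isConj_iff.2 ⟨L p.1, rfl⟩
  have h3 : IsCyc y (p.1, R p.1 * p.2 * L (headSign l p.1)) (tr L R l p.1) :=
    ⟨isChain_tr (l := p :: l) hLR h.chain, tr_mem_avoid (l := p :: l) hL hR h.mem p.1⟩
  have h4 := h3.length_le (h2.trans hg)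
  intro q hq
  have h5 := List.single_le_sum (l := (tr L R (p :: l) p.1).map fun p => norm p.2 + 1) (by simp)
    (norm q.2 + 1) (List.mem_map.2 ⟨q, hq, rfl⟩)
  have h6 := h5.trans h4
  omega

theorem finite_norm_le [Finite α] (K : ℕ) : {g : FreeGroup α | norm g ≤ K}.Finite :=
  (List.finite_length_le (α × Bool) K).preimage toWord_injective.injOn

theorem mem_zpowers_of_norm_le [Finite α] {c a : FreeGroup α}
    (χ : FreeGroup α →* Multiplicative ℤ) (hc : χ c = Multiplicative.ofAdd 1) {K : ℕ}
    (h : ∀ N : ℕ, norm ((c ^ N)⁻¹ * a * c ^ N) ≤ K) : a ∈ Subgroup.zpowers c := by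
  obtain ⟨i, j, hij, he⟩ : ∃ i j : ℕ, i < j ∧ (c ^ i)⁻¹ * a * c ^ i = (c ^ j)⁻¹ * a * c ^ j := by
    have := (finite_norm_le (α := α) K).to_subtype
    obtain ⟨i, j, hne, he⟩ := Finite.exists_ne_map_eq_of_infinite
      (fun N : ℕ => (⟨_, h N⟩ : {g : FreeGroup α | norm g ≤ K}))
    have he := congrArg Subtype.val he
    rcases lt_or_gt_of_ne hne with h | h
    · exact ⟨i, j, h, he⟩
    · exact ⟨j, i, h, he.symm⟩
  obtain ⟨k, rfl⟩ := Nat.exists_eq_add_of_lt hij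
  refine mem_zpowers_of_commute χ hc (commute_of_pow (n := k + 1) (by omega) ?_)
  rw [add_assoc, pow_add] at he
  have h2 : a = (c ^ (k + 1))⁻¹ * a * c ^ (k + 1) := by
    have h3 := congrArg (fun t => c ^ i * t * (c ^ i)⁻¹) he
    simp only [mul_inv_rev] at h3
    rw [← mul_inv_rev, (Commute.pow_pow_self c i (k + 1)).eq] at h3
    calc a = c ^ i * ((c ^ i)⁻¹ * a * c ^ i) * (c ^ i)⁻¹ := by group
      _ = _ := h3
      _ = _ := by group
  rw [Commute, SemiconjBy]
  nth_rw 1 [h2]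
  group

/-- A class invariant under the powers of the twist `y ↦ c * y * c⁻¹` comes from `⟨c, y⟩` or
from words without `y`. -/
theorem exists_isConj_of_twist [Finite α] {c : FreeGroup α} (hcy : c ∈ avoid y)
    (χ : FreeGroup α →* Multiplicative ℤ) (hc : χ c = Multiplicative.ofAdd 1) {g : FreeGroup α}
    (h : ∀ N : ℕ, ∃ T : FreeGroup α →* FreeGroup α, (∀ a ∈ avoid y, T a = a) ∧
      T (of y) = c ^ N * of y * (c ^ N)⁻¹ ∧ IsConj (T g) g) :
    ∃ g', IsConj g g' ∧ (g' ∈ avoid y ∨ g' ∈ Subgroup.closure {c, of y}) := by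
  obtain ⟨g', h1, h2 | ⟨p, l, rfl, h2⟩⟩ := exists_isCyc y g
  · exact ⟨g', h1, Or.inl h2⟩
  refine ⟨_, h1, Or.inr (sprod_mem (Subgroup.subset_closure (by simp)) fun q hq => ?_)⟩
  have h3 : q.2 ∈ Subgroup.zpowers c := by
    refine mem_zpowers_of_norm_le χ hc (K := norm g) fun N => ?_
    obtain ⟨T, hT, hy, hg⟩ := h N
    have hN := (avoid y).pow_mem hcy N
    exact h2.norm_tr_le (L := fun _ => c ^ N) (R := fun _ => (c ^ N)⁻¹) (by simp) (fun _ => hN)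
      (fun _ => inv_mem hN) hT (conj_hom_syll hy) ((T.map_isConj h1.symm).trans hg) _
      (mem_tr_const hq)
  exact (Subgroup.zpowers_le.2 (Subgroup.subset_closure (by simp))) h3

theorem norm_sprod {l : List (Bool × FreeGroup α)} (hl : l.IsChain SRel)
    (hA : ∀ p ∈ l, p.2 ∈ avoid y) :
    norm (sprod y l) = (l.map fun p => norm p.2 + 1).sum := by
  rw [← syll_length (y := y), ← mk_syll, norm, toWord_mk, (syll_isReduced hl hA).reduce_eq]

/-- An element multiplied by the powers of `c` under the twist `y ↦ c * y * c⁻¹` is in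
`⟨c, y⟩`. -/
theorem mem_closure_of_twist [Finite α] {c : FreeGroup α} (hcy : c ∈ avoid y)
    (χ : FreeGroup α →* Multiplicative ℤ) (hc : χ c = Multiplicative.ofAdd 1) {g : FreeGroup α}
    (h : ∀ N : ℕ, ∃ T : FreeGroup α →* FreeGroup α, (∀ a ∈ avoid y, T a = a) ∧
      T (of y) = c ^ N * of y * (c ^ N)⁻¹ ∧ T g = c ^ N * g * (c ^ N)⁻¹) :
    g ∈ Subgroup.closure {c, of y} := by
  have hyc : of y ∈ Subgroup.closure {c, of y} := Subgroup.subset_closure (by simp)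
  have key : ∀ l : List (Bool × FreeGroup α), l.IsChain SRel → (∀ p ∈ l, p.2 ∈ avoid y) →
      (∀ N : ℕ, ∃ T : FreeGroup α →* FreeGroup α, (∀ a ∈ avoid y, T a = a) ∧
      T (of y) = c ^ N * of y * (c ^ N)⁻¹ ∧
      T (sprod y l) = c ^ N * sprod y l * (c ^ N)⁻¹) → sprod y l ∈ Subgroup.closure {c, of y} := by
    intro l hl hA hN
    refine sprod_mem hyc fun q hq => ?_
    refine (Subgroup.zpowers_le.2 (Subgroup.subset_closure (by simp)))
      (mem_zpowers_of_norm_le χ hc (K := norm (sprod y l)) fun N => ?_)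
    obtain ⟨T, hT, hy, hg⟩ := hN N
    have hN := (avoid y).pow_mem hcy N
    have h1 := map_sprod (L := fun _ => c ^ N) (R := fun _ => (c ^ N)⁻¹) (conj_hom_syll hy)
      (fun q hq => hT _ (hA q hq)) true
    rw [hg, inv_mul_cancel_right, mul_left_cancel_iff] at h1
    obtain ⟨e, he⟩ : ∃ e, (l ++ [(e, 1)]).IsChain SRel := by
      rcases List.eq_nil_or_concat l with rfl | ⟨t, p, rfl⟩
      · exact ⟨true, by simp⟩
      · rw [List.concat_eq_append] at *
        refine ⟨p.1, List.isChain_append.2 ⟨hl, by simp, fun r hr s hs => ?_⟩⟩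
        have h1 : r = p := by simpa [eq_comm] using hr
        have h2 : s = (p.1, 1) := by simpa [eq_comm] using hs
        rw [h1, h2]; exact fun _ => rfl
    have h1 := map_sprod (L := fun _ => c ^ N) (R := fun _ => (c ^ N)⁻¹) (conj_hom_syll hy)
      (fun q hq => hT _ (hA q hq)) e
    rw [hg, inv_mul_cancel_right, mul_left_cancel_iff] at h1
    have h2 := (List.isChain_append.1 (isChain_tr (L := fun _ => c ^ N)
      (R := fun _ => (c ^ N)⁻¹) (b' := 1) (by simp) he)).1
    have h3 := norm_sprod h2 (tr_mem_avoid (fun _ => hN) (fun _ => inv_mem hN) hA e)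
    have h5 := List.single_le_sum (l := (tr (fun _ => c ^ N) (fun _ => (c ^ N)⁻¹) l e).map
      fun p => norm p.2 + 1) (by simp) _ (List.mem_map.2 ⟨_, mem_tr_const hq, rfl⟩)
    rw [← h3, ← h1] at h5
    simp only at h5
    omega
  obtain ⟨a, l, rfl, ha, hA, hl⟩ := exists_sprod y g
  by_cases ha1 : a = 1
  · subst ha1
    rw [one_mul] at h ⊢
    exact key l hl hA h
  · have h1 := key ((true, a) :: l) (List.isChain_cons.2 ⟨fun q _ h => absurd h ha1, hl⟩)
      (fun q hq => by
        rcases List.mem_cons.1 hq with rfl | hq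
        · exact ha
        · exact hA q hq) fun N => by
        obtain ⟨T, hT, hy, hg⟩ := h N
        refine ⟨T, hT, hy, ?_⟩
        change T (of y * a * sprod y l) = c ^ N * (of y * a * sprod y l) * (c ^ N)⁻¹
        rw [mul_assoc, _root_.map_mul, hy, hg]
        group
    have h2 : a * sprod y l = (of y)⁻¹ * sprod y ((true, a) :: l) := by
      change _ = (of y)⁻¹ * (of y * a * sprod y l)
      group
    rw [h2]
    exact mul_mem (inv_mem hyc) h1

end FreeGroup

namespace FreeGroup

variable {α : Type*}

/-- The word with letters alternating between `x` and `y`, and alternating signs for each. -/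
def altWord : α → Bool → α → Bool → ℕ → List (α × Bool)
  | _, _, _, _, 0 => []
  | x, s, y, t, k + 1 => (x, s) :: altWord y t x (!s) k

theorem altWord_add_four (x : α) (s : Bool) (y : α) (t : Bool) (k : ℕ) :
    altWord x s y t (k + 4) = altWord x s y t 4 ++ altWord x s y t k := by
  simp [altWord]

theorem altWord_add_mul (x : α) (s : Bool) (y : α) (t : Bool) (j r : ℕ) :
    altWord x s y t (4 * j + r) =
      (List.replicate j (altWord x s y t 4)).flatten ++ altWord x s y t r := by
  induction j with
  | zero => simp
  | succ j ih =>
    rw [show 4 * (j + 1) + r = 4 * j + r + 4 by ring, altWord_add_four, ih, List.replicate_succ,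
      List.flatten_cons, List.append_assoc]

theorem isConj_altWord (x : α) (s : Bool) (y : α) (t : Bool) :
    ∃ k : ℤ, IsConj (mk (altWord x s y t 4)) ((of x * of y * (of x)⁻¹ * (of y)⁻¹) ^ k) := by
  have e : mk (altWord x s y t 4) = mk [(x, s)] * mk [(y, t)] * mk [(x, !s)] * mk [(y, !t)] := by
    simp [altWord, mul_mk]
  have hx : mk [(x, false)] = (of x)⁻¹ := rfl
  have hx' : mk [(x, true)] = of x := rfl
  have hy : mk [(y, false)] = (of y)⁻¹ := rfl
  have hy' : mk [(y, true)] = of y := rfl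
  rw [e]
  rcases s <;> rcases t <;> simp only [Bool.not_true, Bool.not_false, hx, hx', hy, hy']
  · exact ⟨1, isConj_iff.2 ⟨of y * of x, by group⟩⟩
  · exact ⟨-1, isConj_iff.2 ⟨of x, by group⟩⟩
  · exact ⟨-1, isConj_iff.2 ⟨of y, by group⟩⟩
  · exact ⟨1, isConj_iff.2 ⟨1, by group⟩⟩

variable [DecidableEq α] {x y : α}

/-- The signs of a letter in a word. -/
def signs (x : α) (L : List (α × Bool)) : List Bool := (L.filter fun p => p.1 = x).map Prod.snd

theorem signs_append (L M : List (α × Bool)) : signs x (L ++ M) = signs x L ++ signs x M := by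
  simp [signs]

theorem signs_syll {l : List (Bool × FreeGroup α)} (hl : ∀ p ∈ l, p.2 ∈ avoid x) :
    signs x (syll x l) = l.map Prod.fst := by
  induction l with
  | nil => rfl
  | cons p l ih =>
    have h1 := ih fun q hq => hl q (List.mem_cons_of_mem _ hq)
    have h2 : signs x p.2.toWord = [] := by
      rw [signs, List.map_eq_nil_iff, List.filter_eq_nil_iff]
      intro q hq; simpa using mem_avoid.1 (hl p List.mem_cons_self) q hq
    rw [show syll x (p :: l) = [(x, p.1)] ++ p.2.toWord ++ syll x l from rfl, signs_append,
      signs_append, h1, h2]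
    simp [signs]

theorem eq_altWord (hxy : x ≠ y) {s t : Bool} {L : List (α × Bool)} (hL : IsReduced L)
    (hmem : ∀ p ∈ L, p.1 = x ∨ p.1 = y) (hh : ∀ q ∈ L.head?, q.1 = x)
    (hx : ((!s) :: signs x L).IsChain (· ≠ ·)) (hy : ((!t) :: signs y L).IsChain (· ≠ ·)) :
    L = altWord x s y t L.length := by
  induction L generalizing x y s t with
  | nil => rfl
  | cons q L ih =>
    obtain ⟨z, e⟩ := q
    obtain rfl : z = x := hh (z, e) (by simp)
    have h1 : signs z ((z, e) :: L) = e :: signs z L := by simp [signs]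
    have h2 : signs y ((z, e) :: L) = signs y L := by simp [signs, hxy]
    rw [h1, List.isChain_cons_cons] at hx
    rw [h2] at hy
    obtain rfl : e = s := by have := hx.1; revert this; cases e <;> cases s <;> simp
    rw [List.length_cons, altWord]
    congr 1
    refine ih hxy.symm (List.IsChain.tail hL)
      (fun p hp => (hmem p (List.mem_cons_of_mem _ hp)).symm) (fun q hq => ?_) hy
      (by simpa using hx.2)
    obtain ⟨M, rfl⟩ := List.head?_eq_some_iff.1 hq
    rcases hmem q (by simp) with h | h
    · obtain ⟨z', e'⟩ := q
      simp only at h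
      subst h
      have h3 := (List.isChain_cons_cons.1 hL).1 rfl
      have h4 : signs z' ((z', e') :: M) = e' :: signs z' M := by simp [signs]
      rw [h4] at hx
      exact absurd h3 (List.isChain_cons_cons.1 hx.2).1
    · exact h

/-- Reading a reduced word as syllables. -/
theorem exists_syll (x : α) {L : List (α × Bool)} (hL : IsReduced L) :
    ∃ a l, L = toWord a ++ syll x l ∧ a ∈ avoid x ∧ (∀ p ∈ l, p.2 ∈ avoid x) ∧ l.IsChain SRel := by
  induction L with
  | nil => exact ⟨1, [], by simp [syll], one_mem _, by simp, by simp⟩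
  | cons q L ih =>
    obtain ⟨a, l, rfl, ha, hl, hc⟩ := ih (List.IsChain.tail hL)
    obtain ⟨z, e⟩ := q
    by_cases hz : z = x
    · subst hz
      refine ⟨1, (e, a) :: l, by simp [syll], one_mem _, ?_, List.isChain_cons.2 ⟨?_, hc⟩⟩
      · intro p hp
        rcases List.mem_cons.1 hp with rfl | hp
        · exact ha
        · exact hl p hp
      · intro r hr h1
        simp only at h1
        subst h1
        obtain ⟨M, rfl⟩ := List.head?_eq_some_iff.1 hr
        simp only [toWord_one, List.nil_append] at hL
        change IsReduced ((z, e) :: (z, r.1) :: _) at hL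
        exact (List.isChain_cons_cons.1 hL).1 rfl
    · have h1 : IsReduced ((z, e) :: a.toWord) :=
        (List.isChain_append.1 (show ((z, e) :: a.toWord ++ syll x l).IsChain _ from hL)).1
      have h2 : toWord (mk ((z, e) :: a.toWord)) = (z, e) :: a.toWord := by
        rw [toWord_mk, h1.reduce_eq]
      refine ⟨mk ((z, e) :: a.toWord), l, by rw [h2]; rfl, ?_, hl, hc⟩
      rw [mem_avoid, h2]
      intro p hp
      rcases List.mem_cons.1 hp with rfl | hp
      · exact hz
      · exact mem_avoid.1 ha p hp

theorem isCyc_of_isCyclicallyReduced {p : Bool × FreeGroup α} {l : List (Bool × FreeGroup α)}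
    (h : IsCyclicallyReduced (syll x (p :: l))) (hl : ∀ q ∈ p :: l, q.2 ∈ avoid x)
    (hc : (p :: l).IsChain SRel) : IsCyc x p l := by
  refine ⟨List.isChain_append.2 ⟨hc, by simp, fun q hq r hr hq1 => ?_⟩, hl⟩
  obtain rfl : r = p := by simpa [eq_comm] using hr
  obtain ⟨M, hM⟩ := List.getLast?_eq_some_iff.1 hq
  have h1 : syll x (r :: l) = syll x M ++ [(x, q.1)] := by
    rw [hM, syll, syll, List.flatMap_append]; simp [hq1]
  exact h.2 (x, q.1) (by rw [h1]; simp) (x, r.1) (by simp [syll]) rfl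

theorem norm_of_zpow (x : α) (n : ℤ) : norm (of x ^ n) = n.natAbs := by
  obtain ⟨k, rfl | rfl⟩ := n.eq_nat_or_neg
  · simp
  · simp

/-- The signs of `y` alternate in a class invariant under the transvections `y ↦ y * x ^ N`. -/
theorem IsCyc.alternating (hxy : x ≠ y) (hall : ∀ z, z ≠ y → z = x)
    {p : Bool × FreeGroup α} {l : List (Bool × FreeGroup α)} (h : IsCyc y p l) {g : FreeGroup α}
    (hg : IsConj (sprod y (p :: l)) g) (hT : ∀ N : ℕ, ∃ T : FreeGroup α →* FreeGroup α,
      T (of x) = of x ∧ T (of y) = of y * of x ^ N ∧ IsConj (T g) g) :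
    (p :: l ++ [p]).IsChain fun p q => p.1 ≠ q.1 := by
  have hz : ∀ a ∈ avoid y, a ∈ Subgroup.zpowers (of x) := fun a ha =>
    avoid_induction ha _ fun z hz => by rw [hall z hz]; exact Subgroup.mem_zpowers _
  have hx := of_mem_avoid hxy
  let L : ℕ → Bool → FreeGroup α := fun N ε => if ε then 1 else (of x ^ N)⁻¹
  let R : ℕ → Bool → FreeGroup α := fun N ε => if ε then of x ^ N else 1
  have hb : ∀ N, ∀ q ∈ tr (L N) (R N) (p :: l) p.1, norm q.2 ≤ norm g := fun N => by
    obtain ⟨T, h1, h2, h3⟩ := hT N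
    refine h.norm_tr_le ?_ ?_ ?_ (T := T) ?_ ?_ ((T.map_isConj hg).trans h3)
    · rintro (_ | _) <;> simp [L, R]
    · rintro (_ | _)
      · simpa [L] using pow_mem hx N
      · simp [L]
    · rintro (_ | _)
      · simp [R]
      · simpa [R] using pow_mem hx N
    · intro a ha
      obtain ⟨k, rfl⟩ := hz a ha
      simp [h1]
    · rintro (_ | _)
      · change T (of y)⁻¹ = (of x ^ N)⁻¹ * (of y)⁻¹ * 1
        rw [_root_.map_inv, h2]; group
      · change T (of y) = 1 * of y * of x ^ N
        rw [h2, one_mul]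
  have key : ∀ (l : List (Bool × FreeGroup α)) (e : Bool) (b : FreeGroup α),
      (∀ q ∈ l, q.2 ∈ avoid y) → (∀ N, ∀ q ∈ tr (L N) (R N) l e, norm q.2 ≤ norm g) →
      (l ++ [(e, b)]).IsChain fun p q => p.1 ≠ q.1 := by
    intro l e b hl hN
    induction l with
    | nil => simp
    | cons r l ih =>
      refine List.isChain_cons.2 ⟨fun q hq => ?_, ih (fun q hq => hl q (List.mem_cons_of_mem _ hq))
        fun N q hq => hN N q (List.mem_cons_of_mem _ hq)⟩
      rw [headSign_append l e b q hq]
      have h1 := fun N => hN N _ List.mem_cons_self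
      obtain ⟨k, hk⟩ := hz r.2 (hl r List.mem_cons_self)
      simp only at hk
      intro he
      rw [← he, ← hk] at h1
      have h2 := h1 (norm g + k.natAbs + 1)
      rcases hr : r.1 with _ | _
      · simp only [hr, L, R, Bool.false_eq_true, if_false, one_mul] at h2
        rw [← zpow_natCast, ← zpow_neg, ← zpow_add, norm_of_zpow] at h2
        omega
      · simp only [hr, L, R, if_true, mul_one] at h2
        rw [← zpow_natCast, ← zpow_add, norm_of_zpow] at h2
        omega
  exact key (p :: l) p.1 p.2 h.mem hb

theorem isConj_zpow_commutator (hxy : x ≠ y) (hall : ∀ z, z = x ∨ z = y) {g : FreeGroup α}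
    (hT : ∀ N : ℕ, ∃ T : FreeGroup α →* FreeGroup α,
      T (of x) = of x ∧ T (of y) = of y * of x ^ N ∧ IsConj (T g) g)
    (hT' : ∀ N : ℕ, ∃ T : FreeGroup α →* FreeGroup α,
      T (of y) = of y ∧ T (of x) = of x * of y ^ N ∧ IsConj (T g) g) :
    ∃ k : ℤ, IsConj g ((of x * of y * (of x)⁻¹ * (of y)⁻¹) ^ k) := by
  have hy : ∀ z, z ≠ y → z = x := fun z hz => (hall z).resolve_right hz
  have hx : ∀ z, z ≠ x → z = y := fun z hz => (hall z).resolve_left hz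
  obtain ⟨g', hg, h | ⟨p, l, rfl, h⟩⟩ := exists_isCyc y g
  · obtain ⟨n, rfl⟩ : g' ∈ Subgroup.zpowers (of x) :=
      avoid_induction h _ fun z hz => by rw [hy z hz]; exact Subgroup.mem_zpowers _
    refine ⟨0, ?_⟩
    obtain ⟨T, h1, h2, h3⟩ := hT' 1
    let χ : FreeGroup α →* Multiplicative ℤ :=
      FreeGroup.lift fun z => if z = y then Multiplicative.ofAdd 1 else 1
    have h4 : χ (T (of x ^ n)) = χ (of x ^ n) :=
      isConj_iff_eq.1 (χ.map_isConj (((T.map_isConj hg.symm).trans h3).trans hg))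
    have h5 : n = 0 := by
      simpa [h2, χ, hxy] using congrArg Multiplicative.toAdd h4
    simpa [h5] using hg
  have ha := h.alternating hxy hy hg.symm hT
  have hW := h.isCyclicallyReduced
  set t := p.2.toWord ++ syll y l with ht
  have hW0 : syll y (p :: l) = (y, p.1) :: t := rfl
  rw [hW0] at hW
  have hsy : signs y ((y, p.1) :: t ++ [(y, p.1)]) = (p :: l ++ [p]).map Prod.fst := by
    rw [signs_append, ← hW0, signs_syll h.mem]; simp [signs]
  have hp1 : p.2 ≠ 1 := fun e => by
    have h1 := h.chain
    rcases l with _ | ⟨q, l⟩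
    · simp at ha
    · exact (List.isChain_cons_cons.1 ha).1 ((List.isChain_cons_cons.1 h1).1 e)
  obtain ⟨q, w, hw⟩ := List.exists_cons_of_ne_nil (mt toWord_eq_nil_iff.1 hp1)
  have hqx : q.1 = x := hy _ (mem_avoid.1 (h.mem p List.mem_cons_self) q (by rw [hw]; simp))
  have htq : t = q :: (w ++ syll y l) := by rw [ht, hw]; rfl
  have hWr : IsCyclicallyReduced (t ++ [(y, p.1)]) := by
    refine ⟨List.isChain_append.2 ⟨List.IsChain.tail hW.1, by simp, fun r hr s hs => ?_⟩,
      fun r hr s hs => ?_⟩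
    · obtain rfl : s = (y, p.1) := by simpa [eq_comm] using hs
      exact hW.2 r (by rw [List.getLast?_cons]; rw [hr]; simp) _ (by simp)
    · obtain rfl : r = (y, p.1) := by simpa [eq_comm] using hr
      obtain rfl : s = q := by simpa [htq, eq_comm] using hs
      rw [htq] at hW
      exact (List.isChain_cons_cons.1 hW.1).1
  have hWg : IsConj (mk (t ++ [(y, p.1)])) g := by
    refine IsConj.trans (isConj_iff.2 ⟨mk [(y, p.1)], ?_⟩) hg.symm
    rw [← mk_syll, hW0, ← mul_mk, mul_assoc, mul_assoc, mul_inv_cancel, mul_one, mul_mk]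
    rfl
  obtain ⟨a, l', h1, h2, h3, h4⟩ := exists_syll x hWr.1
  obtain rfl : a = 1 := by
    by_contra ha1
    obtain ⟨r, w', hw'⟩ := List.exists_cons_of_ne_nil (mt toWord_eq_nil_iff.1 ha1)
    rw [hw', htq] at h1
    have : q = r := by simpa using congrArg List.head? h1
    exact mem_avoid.1 h2 r (by rw [hw']; simp) (this ▸ hqx)
  rw [toWord_one, List.nil_append] at h1
  rcases l' with _ | ⟨p', l'⟩
  · simp [syll] at h1
  rw [h1] at hWr hWg
  have hc' := isCyc_of_isCyclicallyReduced hWr h3 h4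
  have ha' := hc'.alternating hxy.symm hx (by rw [← mk_syll]; exact hWg) hT'
  have hsx : signs x (syll x (p' :: l') ++ [(x, p'.1)]) = (p' :: l' ++ [p']).map Prod.fst := by
    rw [signs_append, signs_syll h3]; simp [signs]
  have hax : (signs x (syll x (p' :: l') ++ [(x, p'.1)])).IsChain (· ≠ ·) := by
    rw [hsx, List.isChain_map]; exact ha'
  have hay : (signs y (t ++ [(y, p.1)])).IsChain (· ≠ ·) := by
    have : (signs y ((y, p.1) :: t ++ [(y, p.1)])).IsChain (· ≠ ·) := by
      rw [hsy, List.isChain_map]; exact ha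
    have e : signs y ((y, p.1) :: t ++ [(y, p.1)]) = p.1 :: signs y (t ++ [(y, p.1)]) := by
      simp [signs]
    rw [e] at this
    exact this.tail
  rw [h1] at hay
  obtain ⟨u, hu⟩ : ∃ u, ((!u) :: signs y (syll x (p' :: l'))).IsChain (· ≠ ·) := by
    rcases hs : signs y (syll x (p' :: l')) with _ | ⟨e, s⟩
    · exact ⟨true, by simp⟩
    · rw [hs] at hay
      exact ⟨e, List.isChain_cons_cons.2 ⟨by simp, hay⟩⟩
  have hfin := eq_altWord hxy (s := p'.1) hWr.1 (fun r _ => hall r.1)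
    (by simp [syll]) (by
      rw [signs_append] at hax
      have h5 := (List.isChain_append.1 hax).1
      have e : signs x (syll x (p' :: l')) = p'.1 :: l'.map Prod.fst := signs_syll h3
      rw [e] at h5 ⊢
      exact List.isChain_cons_cons.2 ⟨by simp, h5⟩) hu
  generalize (syll x (p' :: l')).length = k at hfin
  have hlast := congrArg List.getLast? (h1.trans hfin)
  rw [← Nat.div_add_mod k 4, altWord_add_mul] at hfin hlast
  have hr : k % 4 = 0 := by
    have hlt := Nat.mod_lt k (show 4 > 0 by norm_num)
    interval_cases hk : k % 4
    · rfl
    · simp [altWord, Ne.symm hxy] at hlast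
    · rw [hfin, signs_append, signs_append] at hax
      simp only [signs, altWord] at hax
      simp [Ne.symm hxy, List.isChain_append] at hax
    · simp [altWord, Ne.symm hxy] at hlast
  rw [hr] at hfin
  obtain ⟨j, hj⟩ := isConj_altWord x p'.1 y u
  refine ⟨j * (k / 4 : ℕ), hWg.symm.trans ?_⟩
  rw [hfin]
  simp only [altWord.eq_1, List.append_nil]
  rw [← pow_mk, zpow_mul, zpow_natCast]
  exact hj.pow _

end FreeGroup

namespace Fr

open FreeGroup (avoid)

theorem X_eq_of {m k : ℕ} (hk : k ≤ m) : X m k = FreeGroup.of ⟨k, Nat.lt_succ_of_le hk⟩ :=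
  dif_pos _

theorem X_mem_avoid {m k : ℕ} (hk : k ≤ m) :
    X (m + 1) k ∈ avoid (⟨m + 1, by omega⟩ : Fin (m + 1 + 1)) := by
  rw [X_eq_of (by omega)]
  exact FreeGroup.of_mem_avoid fun h => by rw [Fin.mk.injEq] at h; omega

theorem avoid_induction {m : ℕ} {a : Fr (m + 1)}
    (ha : a ∈ avoid (⟨m + 1, by omega⟩ : Fin (m + 1 + 1))) (S : Subgroup (Fr (m + 1)))
    (hS : ∀ k ≤ m, X (m + 1) k ∈ S) : a ∈ S :=
  FreeGroup.avoid_induction ha S fun i hi => by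
    rw [← X_fin]
    refine hS i (Nat.le_of_lt_succ (lt_of_le_of_ne (Nat.le_of_lt_succ i.2) fun h => hi ?_))
    exact Fin.ext h

theorem wp_mem {m : ℕ} (S : Subgroup (Fr m)) : ∀ l, (∀ k < l, X m k ∈ S) → wp m l ∈ S
  | 0, _ => one_mem S
  | l + 1, h => mul_mem (h l (Nat.lt_succ_self l)) (wp_mem S l fun k hk => h k (by omega))

theorem wp_mem_avoid (m : ℕ) :
    wp (m + 1) (m + 1) ∈ avoid (⟨m + 1, by omega⟩ : Fin (m + 1 + 1)) :=
  wp_mem _ _ fun k hk => X_mem_avoid (by omega)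

theorem artin_incl_zz_avoid {m : ℕ} {a : Fr (m + 1)}
    (ha : a ∈ avoid (⟨m + 1, by omega⟩ : Fin (m + 1 + 1))) :
    artin (m + 1) (Br.incl m (Br.zz m)) a = (wp (m + 1) (m + 1))⁻¹ * a * wp (m + 1) (m + 1) := by
  refine avoid_induction ha (((artin (m + 1) (Br.incl m (Br.zz m))).toMonoidHom).eqLocus
    (MulAut.conj (wp (m + 1) (m + 1))⁻¹).toMonoidHom) (fun k hk => ?_) |>.trans ?_
  · exact (Br.artin_incl_zz_lt hk).trans (by simp)
  · simp

/-- The powers of the twist of the first strands, normalised to fix the first generators. -/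
theorem exists_twist (m N : ℕ) : ∃ T : Fr (m + 1) →* Fr (m + 1),
    (∀ a ∈ avoid (⟨m + 1, by omega⟩ : Fin (m + 1 + 1)), T a = a) ∧
    T (X (m + 1) (m + 1)) =
      wp (m + 1) (m + 1) ^ N * X (m + 1) (m + 1) * (wp (m + 1) (m + 1) ^ N)⁻¹ ∧
    ∀ g, T g = wp (m + 1) (m + 1) ^ N * artin (m + 1) (Br.incl m (Br.zz m) ^ N) g *
      (wp (m + 1) (m + 1) ^ N)⁻¹ := by
  refine ⟨(MulAut.conj (wp (m + 1) (m + 1) ^ N)).toMonoidHom.comp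
    (artin (m + 1) (Br.incl m (Br.zz m) ^ N)).toMonoidHom, fun a ha => ?_, ?_, fun g => rfl⟩
  · have : artin (m + 1) (Br.incl m (Br.zz m) ^ N) a =
        (wp (m + 1) (m + 1) ^ N)⁻¹ * a * wp (m + 1) (m + 1) ^ N := by
      induction N with
      | zero => simp
      | succ N ih =>
        rw [pow_succ', map_mul, MulAut.mul_apply, ih, artin_incl_zz_avoid, pow_succ]
        · group
        · have := (avoid (⟨m + 1, by omega⟩ : Fin (m + 1 + 1))).pow_mem (wp_mem_avoid m) N
          exact mul_mem (mul_mem (inv_mem this) ha) this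
    change wp (m + 1) (m + 1) ^ N * artin (m + 1) (Br.incl m (Br.zz m) ^ N) a *
      (wp (m + 1) (m + 1) ^ N)⁻¹ = a
    rw [this]; group
  · change wp (m + 1) (m + 1) ^ N * artin (m + 1) (Br.incl m (Br.zz m) ^ N) _ *
      (wp (m + 1) (m + 1) ^ N)⁻¹ = _
    rw [← map_pow, artin_incl_last]

/-- Killing a generator while keeping the boundary word. -/
def kill (m j : ℕ) : Fr m →* Fr m :=
  lift fun i => if i = j then 1 else if i + 1 = j then X m j * X m i else X m i

theorem kill_X_self {m j : ℕ} (hj : j ≤ m) : kill m j (X m j) = 1 := by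
  rw [kill, lift_X _ hj, if_pos rfl]

theorem kill_X {m j i : ℕ} (hi : i ≤ m) (h1 : i ≠ j) (h2 : i + 1 ≠ j) :
    kill m j (X m i) = X m i := by
  rw [kill, lift_X _ hi, if_neg h1, if_neg h2]

theorem kill_wp {m j : ℕ} (hj : j + 1 ≤ m) : ∀ l, l ≤ m + 1 →
    (l ≤ j → kill m (j + 1) (wp m l) = wp m l) ∧
    (j + 2 ≤ l → kill m (j + 1) (wp m l) = wp m l)
  | 0, _ => by simp [wp]
  | l + 1, hl => by
    obtain ⟨h1, h2⟩ := kill_wp hj l (by omega)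
    refine ⟨fun h => ?_, fun h => ?_⟩
    · rw [wp_succ, map_mul, h1 (by omega), kill_X (by omega) (by omega) (by omega)]
    · rcases h.eq_or_lt with h | h
      · obtain rfl : l = j + 1 := by omega
        rw [wp_succ, map_mul, kill_X_self (by omega), wp_succ, map_mul,
          (kill_wp hj j (by omega)).1 le_rfl, kill, lift_X _ (by omega), if_neg (by omega),
          if_pos rfl]
        simp [mul_assoc]
      · rw [wp_succ, map_mul, h2 (by omega), kill_X (by omega) (by omega) (by omega)]

theorem kill_w {m j : ℕ} (hj : j + 1 ≤ m) : kill m (j + 1) (w m) = w m :=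
  (kill_wp hj (m + 1) le_rfl).2 (by omega)

theorem kill_artin_mem {m : ℕ} (hm : 1 ≤ m) {g : Fr (m + 1)}
    (hg : g ∈ Subgroup.closure {wp (m + 1) (m + 1), X (m + 1) (m + 1)}) :
    kill (m + 1) m g = g ∧
    kill (m + 1) m (artin (m + 1) (sg (m + 1) m) g) ∈ Subgroup.zpowers (w (m + 1)) := by
  obtain ⟨j, rfl⟩ := Nat.exists_eq_add_of_le' hm
  have hw := kill_w (m := j + 1 + 1) (j := j) (by omega)
  have hX : kill (j + 1 + 1) (j + 1) (X _ (j + 1 + 1)) = X _ (j + 1 + 1) :=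
    kill_X (by omega) (by omega) (by omega)
  have e : wp (j + 1 + 1) (j + 1 + 1) = (X _ (j + 1 + 1))⁻¹ * w (j + 1 + 1) := by
    rw [w, wp_succ _ (j + 1 + 1)]; group
  have hc : kill (j + 1 + 1) (j + 1) (wp (j + 1 + 1) (j + 1 + 1)) = wp (j + 1 + 1) (j + 1 + 1) := by
    rw [e, map_mul, map_inv, hX, hw]
  have hX' : kill (j + 1 + 1) (j + 1)
      (artin (j + 1 + 1) (sg (j + 1 + 1) (j + 1)) (X _ (j + 1 + 1))) = 1 := by
    rw [artin_sg (by omega), artinFun_snd (by omega), kill_X_self (by omega)]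
  constructor
  · refine (Subgroup.closure_le ((kill (j + 1 + 1) (j + 1)).eqLocus (MonoidHom.id _))).2 ?_ hg
    rintro _ (rfl | rfl)
    · exact hc
    · exact hX
  · refine (Subgroup.closure_le ((Subgroup.zpowers (w (j + 1 + 1))).comap
      ((kill (j + 1 + 1) (j + 1)).comp
        (artin (j + 1 + 1) (sg (j + 1 + 1) (j + 1))).toMonoidHom))).2 ?_ hg
    rintro _ (rfl | rfl)
    · rw [SetLike.mem_coe, Subgroup.mem_comap]
      change kill (j + 1 + 1) (j + 1) (artin (j + 1 + 1) (sg (j + 1 + 1) (j + 1)) _) ∈ _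
      rw [e, map_mul, map_inv, artin_w, map_mul, map_inv, hX', hw, inv_one, one_mul]
      exact Subgroup.mem_zpowers _
    · rw [SetLike.mem_coe, Subgroup.mem_comap]
      change kill (j + 1 + 1) (j + 1) (artin (j + 1 + 1) (sg (j + 1 + 1) (j + 1)) _) ∈ _
      rw [hX']; exact one_mem _

/-- An element fixed by the twist of the first strands. -/
theorem mem_closure_of_fixed {m : ℕ} {g : Fr (m + 1)}
    (h : artin (m + 1) (Br.incl m (Br.zz m)) g = g) :
    g ∈ Subgroup.closure {wp (m + 1) (m + 1), X (m + 1) (m + 1)} := by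
  have h1 := FreeGroup.mem_closure_of_twist (wp_mem_avoid m) (cnt (m + 1) 0)
    (by rw [cnt_wp (by omega)]; simp) (g := g) fun N => by
      have hN : artin (m + 1) (Br.incl m (Br.zz m) ^ N) g = g := by
        rw [map_pow]
        induction N with
        | zero => rfl
        | succ N ih => rw [pow_succ, MulAut.mul_apply, h, ih]
      obtain ⟨T, h1, h2, h3⟩ := exists_twist m N
      refine ⟨T, h1, by rw [← X_eq_of le_rfl]; exact h2, ?_⟩
      rw [h3, hN]
  rwa [← X_eq_of le_rfl] at h1

/-- A conjugacy class of the free group invariant under the braid group on at least three strands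
is the class of a power of the boundary word. -/
theorem isConj_zpow_w {m : ℕ} (hm : 1 ≤ m) {g : Fr (m + 1)}
    (h : ∀ b, IsConj (artin (m + 1) b g) g) : ∃ k : ℤ, IsConj g (w (m + 1) ^ k) := by
  have h' : ∀ g', IsConj g g' → ∀ b, IsConj (artin (m + 1) b g') g' := fun g' hg b =>
    ((artin (m + 1) b).toMonoidHom.map_isConj hg.symm).trans ((h b).trans hg)
  obtain ⟨g', hg, hg' | hg'⟩ := FreeGroup.exists_isConj_of_twist (wp_mem_avoid m) (cnt (m + 1) 0)
    (by rw [cnt_wp (by omega)]; simp) (g := g) fun N => by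
      obtain ⟨T, h1, h2, h3⟩ := exists_twist m N
      refine ⟨T, h1, by rw [← X_eq_of le_rfl]; exact h2, ?_⟩
      rw [h3]
      exact (isConj_iff.2 ⟨wp (m + 1) (m + 1) ^ N, rfl⟩ : IsConj _ _).symm.trans
        (h (Br.incl m (Br.zz m) ^ N))
  · have key : ∀ j, j ≤ m + 1 → ∃ a ∈ Subgroup.closure {b | ∃ k < j, b = X (m + 1) k},
        IsConj g a := by
      intro j hj
      induction hk : m + 1 - j generalizing j with
      | zero =>
        obtain rfl : j = m + 1 := by omega
        exact ⟨g', avoid_induction hg' _ fun k hk => Subgroup.subset_closure ⟨k, by omega, rfl⟩, hg⟩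
      | succ i ih =>
        obtain ⟨a, ha, hga⟩ := ih (j + 1) (by omega) (by omega)
        let e : Fr (m + 1) →* Fr (m + 1) := lift fun i => if i = j + 1 then 1 else X (m + 1) i
        have he : ∀ i ≤ m + 1, i ≠ j + 1 → e (X (m + 1) i) = X (m + 1) i := fun i hi hne => by
          simp only [e]; rw [lift_X _ hi, if_neg hne]
        have he0 : e (X (m + 1) (j + 1)) = 1 := by
          simp only [e]; rw [lift_X _ (by omega), if_pos rfl]
        have e1 : e a = a := by
          refine (Subgroup.closure_le (e.eqLocus (MonoidHom.id _))).2 ?_ ha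
          rintro _ ⟨k, hk, rfl⟩
          exact he k (by omega) (by omega)
        have e2 : e (artin (m + 1) (sg (m + 1) j) a) ∈
            Subgroup.closure {b | ∃ k < j, b = X (m + 1) k} := by
          refine (Subgroup.closure_le ((Subgroup.closure {b | ∃ k < j, b = X (m + 1) k}).comap
            (e.comp (artin (m + 1) (sg (m + 1) j)).toMonoidHom))).2 ?_ ha
          rintro _ ⟨k, hk, rfl⟩
          rw [SetLike.mem_coe, Subgroup.mem_comap]
          change e (artin (m + 1) (sg (m + 1) j) _) ∈ _
          rw [artin_sg (by omega)]
          rcases (Nat.lt_succ_iff.1 hk).eq_or_lt with rfl | hk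
          · rw [artinFun_fst (by omega), map_mul, map_mul, he0]
            simp
          · rw [artinFun_other (by omega) (by omega), he k (by omega) (by omega)]
            exact Subgroup.subset_closure ⟨k, hk, rfl⟩
        refine ⟨_, e2, hga.trans ?_⟩
        have := e.map_isConj (h' a hga (sg (m + 1) j)).symm
        rwa [e1] at this
    obtain ⟨a, ha, hga⟩ := key 0 (by omega)
    obtain rfl : a = 1 := by simpa using ha
    exact ⟨0, by simpa using hga⟩
  · rw [← X_eq_of le_rfl] at hg'
    obtain ⟨h1, k, hk⟩ := kill_artin_mem hm hg'
    refine ⟨k, hg.trans ?_⟩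
    have := (kill (m + 1) m).map_isConj (h' g' hg (sg (m + 1) m)).symm
    rw [h1, ← hk] at this
    exact this

end Fr

namespace Br

open Fr (w wp artin cnt)

theorem perm_sg_sq {m k : ℕ} (hk : k < m) : perm m (sg m k ^ 2) = 1 := by
  rw [map_pow, perm_sg hk, sq, Equiv.swap_mul_self]

theorem cr_sg_sq {m k : ℕ} (hk : k < m) (i j : ℕ) :
    (sg m k ^ 2).cr i j = if i = k ∧ j = k + 1 ∨ i = k + 1 ∧ j = k then 2 else 0 := by
  rw [sq, cr_mul, cr_sg hk, cr_sg hk, perm_sg hk]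
  have h : ∀ a, Equiv.swap k (k + 1) a = k ↔ a = k + 1 := fun a => by
    rw [← Equiv.eq_symm_apply]; simp
  have h' : ∀ a, Equiv.swap k (k + 1) a = k + 1 ↔ a = k := fun a => by
    rw [← Equiv.eq_symm_apply]; simp
  simp only [h, h']
  split_ifs <;> first | rfl | omega

/-- The exponent sum of the image of a braid under a homomorphism of braid groups. -/
theorem ex_hom {m m' : ℕ} (hm : 0 < m) (f : Br m →* Br m') (b : Br m) :
    ex (f b) = ex (f (sg m 0)) * ex b := by
  have : (expo m').comp f =
      ((zpowersHom (Multiplicative ℤ)) (expo m' (f (sg m 0)))).comp (expo m) :=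
    hom_ext fun k hk => by
      simp only [MonoidHom.comp_apply, expo_sg hk, zpowersHom_apply, toAdd_ofAdd, zpow_one]
      rcases Nat.lt_or_ge 1 m with h1 | h1
      · exact map_eq_of_adjacent ((expo m').comp f) h1
          (eq_of_commute_of_braid (braid_map ((expo m').comp f) h1) (Commute.all _ _)) hk
      · obtain rfl : k = 0 := by omega
        rfl
  have h := congrArg Multiplicative.toAdd (DFunLike.congr_fun this b)
  simp only [MonoidHom.comp_apply, zpowersHom_apply, toAdd_zpow, smul_eq_mul] at h
  exact h.trans (mul_comm _ _)

theorem cr_incl_zz_zpow {m : ℕ} (a : ℤ) (i j : ℕ) :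
    (incl m (zz m) ^ a).cr i j = a * (zz m).cr i j := by
  rw [cr_zpow_pure _ (by rw [perm_incl, perm_zz]), cr_incl]

/-- Comparison of linking numbers with the last two strands. -/
theorem eq_zero_of_commute {m : ℕ} (hm : 2 ≤ m) {t : Br (m + 1)} {a b : ℤ}
    (ht : perm (m + 1) t = Equiv.swap m (m + 1))
    (h : Commute t (sg (m + 1) 0 * incl m (zz m) ^ a * zz (m + 1) ^ b)) : a = 0 := by
  have hz : Commute (sg (m + 1) 0) (incl m (zz m)) := by
    rw [← incl_sg (by omega)]
    exact ((commute_zz _).symm).map (incl m)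
  have hzz : ∀ c : Br (m + 1), Commute c (zz (m + 1)) := fun c => (commute_zz c).symm
  have e : (sg (m + 1) 0 * incl m (zz m) ^ a * zz (m + 1) ^ b) ^ 2 =
      sg (m + 1) 0 ^ 2 * incl m (zz m) ^ (2 * a) * zz (m + 1) ^ (2 * b) := by
    rw [((hzz _).zpow_right b).mul_pow, (hz.zpow_right a).mul_pow, mul_comm 2 a, mul_comm 2 b,
      zpow_mul, zpow_mul]
    norm_cast
  have hp1 : perm (m + 1) (incl m (zz m) ^ (2 * a)) = 1 := by
    rw [map_zpow, perm_incl, perm_zz, one_zpow]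
  have hp2 : perm (m + 1) (zz (m + 1) ^ (2 * b)) = 1 := by
    rw [map_zpow, perm_zz, one_zpow]
  have h2 := (h.pow_right 2).eq
  rw [e] at h2
  have h3 := cr_conj t (sg (m + 1) 0 ^ 2 * incl m (zz m) ^ (2 * a) * zz (m + 1) ^ (2 * b))
    (by rw [map_mul, map_mul, hp1, hp2, perm_sg_sq (by omega)]; rfl) 0 (m + 1)
  rw [h2, mul_inv_cancel_right, ht, Equiv.swap_apply_right,
    Equiv.swap_apply_of_ne_of_ne (by omega) (by omega)] at h3
  rw [cr_mul_pure _ _ hp2, cr_mul_pure _ _ hp1, cr_mul_pure _ _ hp2, cr_mul_pure _ _ hp1,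
    cr_incl_zz_zpow, cr_incl_zz_zpow, cr_zpow_pure _ (perm_zz _), cr_zpow_pure _ (perm_zz _),
    cr_zz (m := m) (i := 0) (j := m) (by omega) (by omega) (by omega),
    cr_zz (m := m + 1) (i := 0) (j := m) (by omega) (by omega) (by omega),
    cr_zz (m := m + 1) (i := 0) (j := m + 1) (by omega) (by omega) (by omega),
    cr_sg_sq (by omega), cr_sg_sq (by omega),
    (cr_gt (zz m) (Nat.lt_succ_self m) 0).2, if_neg (by omega), if_neg (by omega)] at h3
  omega

/-- Sections of the projection forgetting the last strand. -/
theorem exists_loopHom_mul_incl {m : ℕ} (s : Br m →* Br (m + 1))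
    (hs : ∀ i < m, ∃ a, s (sg m i) = loopHom m a * sg (m + 1) i) (b : Br m) :
    ∃ a, s b = loopHom m a * incl m b := by
  let S : Subgroup (Br m) :=
    { carrier := {b | ∃ a, s b = loopHom m a * incl m b}
      one_mem' := ⟨1, by simp⟩
      mul_mem' := by
        rintro b b' ⟨a, ha⟩ ⟨a', ha'⟩
        refine ⟨a * artin m b a', ?_⟩
        rw [map_mul, ha, ha', map_mul, map_mul, mul_assoc, ← mul_assoc (incl m b),
          incl_mul_loopHom]
        simp only [mul_assoc]
      inv_mem' := by
        rintro b ⟨a, ha⟩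
        refine ⟨artin m b⁻¹ a⁻¹, ?_⟩
        rw [map_inv s, ha, mul_inv_rev, ← map_inv, ← map_inv, incl_mul_loopHom] }
  exact mem_of_sg S (fun k hk => by
    obtain ⟨a, ha⟩ := hs k hk
    exact ⟨a, by rw [ha, incl_sg hk]⟩) b

theorem isConj_w_zpow {m : ℕ} (hm : 2 ≤ m) {g : Fr m} (h : ∀ b, IsConj (artin m b g) g) :
    ∃ k : ℤ, IsConj g (w m ^ k) := by
  obtain ⟨j, rfl⟩ : ∃ j, m = j + 1 := ⟨m - 1, by omega⟩
  exact Fr.isConj_zpow_w (by omega) h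

theorem cnt_w {m k : ℕ} (hk : k ≤ m) : cnt m k (w m) = Multiplicative.ofAdd 1 := by
  rw [w, Fr.cnt_wp le_rfl, if_pos (by omega)]

theorem mem_zpowers_w {m : ℕ} {u : Fr m} {k : ℤ} (hk : k ≠ 0) (h : Commute (w m ^ k) u) :
    ∃ l : ℤ, w m ^ l = u := by
  have h1 : Commute (w m ^ k.natAbs) u := by
    rcases Int.natAbs_eq k with e | e <;> rw [e] at h
    · rwa [zpow_natCast] at h
    · rw [zpow_neg, zpow_natCast] at h
      exact Commute.inv_left_iff.1 h
  exact FreeGroup.mem_zpowers_of_commute (cnt m 0) (cnt_w (Nat.zero_le m))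
    (FreeGroup.commute_of_pow (Int.natAbs_ne_zero.2 hk) h1)

theorem exists_ex_loopHom {m : ℕ} (c : Fr m) : ∃ d : ℤ, ex (loopHom m c) = 2 * d := by
  refine Fr.mem_of_X
    (((AddSubgroup.zmultiples (2 : ℤ)).toSubgroup).comap ((expo (m + 1)).comp (loopHom m)))
    (fun k hk => ?_) c |> fun ⟨d, hd⟩ => ⟨d, ?_⟩
  · exact ⟨1, (ex_loopHom hk).symm⟩
  · exact hd.symm.trans (by simp [mul_comm])

theorem ex_W (m : ℕ) : ex (W m) = 2 * (m + 1) := by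
  rw [W, w, ex_wp le_rfl]; push_cast; ring

/-- The sections of the projection forgetting the last strand, up to conjugation. -/
theorem section_eq {m : ℕ} (hm : 2 ≤ m) (s : Br m →* Br (m + 1))
    (hs : ∀ i < m, ∃ a, s (sg m i) = loopHom m a * sg (m + 1) i) :
    ∃ h, ∃ k : ℤ, ∀ i < m, s (sg m i) = loopHom m h * (sg (m + 1) i * W m ^ k) * (loopHom m h)⁻¹ := by
  have hs' := exists_loopHom_mul_incl s hs
  obtain ⟨a, ha⟩ := hs' (zz m)
  have hzg : s (zz m) = zz (m + 1) * loopHom m (a * (w m)⁻¹) := by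
    rw [ha, zz_succ, (commute_incl_W (zz m)).eq, mul_assoc, incl_mul_loopHom, artin_zz,
      ← mul_assoc, ← map_mul]
    congr 2
    group
  generalize a * (w m)⁻¹ = g at hzg
  have hcomm : ∀ b, Commute (s b) (loopHom m g) := fun b => by
    have h1 : Commute (s b) (s (zz m)) := (commute_zz b).symm.map s
    have h2 : Commute (s b) (zz (m + 1)) := (commute_zz _).symm
    rw [hzg] at h1
    have := h2.inv_right.mul_right h1
    rwa [inv_mul_cancel_left] at this
  obtain ⟨k, hk⟩ := isConj_w_zpow hm (g := g) fun b => by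
    obtain ⟨c, hc⟩ := hs' b
    have h1 := (hcomm b).eq
    rw [hc, mul_assoc, incl_mul_loopHom, ← mul_assoc, ← mul_assoc] at h1
    have h2 := mul_right_cancel h1
    rw [← map_mul, ← map_mul] at h2
    refine isConj_iff.2 ⟨c, ?_⟩
    rw [loopHom_injective _ h2, mul_inv_cancel_right]
  obtain ⟨h, hh⟩ := isConj_iff.1 hk
  have hk0 : k ≠ 0 := by
    rintro rfl
    obtain ⟨c, hc⟩ := hs 0 (by omega)
    obtain ⟨d, hd⟩ := exists_ex_loopHom c
    have hex := ex_hom (by omega) s (zz m)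
    rw [zpow_zero, mul_inv_eq_one, mul_eq_left] at hh
    rw [hzg, hh, map_one, mul_one, hc, ex_mul, hd, ex_sg (by omega), ex_zz, ex_zz] at hex
    push_cast at hex
    have h1 : 2 * (((m : ℤ) + 1) * (m * d - 1)) = 0 := by linear_combination -hex
    rcases mul_eq_zero.1 (mul_eq_zero.1 h1 |>.resolve_left two_ne_zero) with h1 | h1
    · omega
    · have h2 : (m : ℤ) ∣ 1 := ⟨d, by linarith⟩
      have := Int.le_of_dvd one_pos h2
      omega
  have hu : ∀ i < m, ∃ l : ℤ,
      s (sg m i) = loopHom m h⁻¹ * (sg (m + 1) i * W m ^ l) * (loopHom m h⁻¹)⁻¹ := fun i hi => by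
    obtain ⟨c, hc⟩ := hs i hi
    have h1 := (hcomm (sg m i)).eq
    have hgk : g = h⁻¹ * w m ^ k * h := by rw [← hh]; group
    rw [hc, ← incl_sg hi, mul_assoc, incl_mul_loopHom, ← mul_assoc, ← mul_assoc] at h1
    have h2 := mul_right_cancel h1
    rw [← map_mul, ← map_mul] at h2
    have h3 := loopHom_injective _ h2
    obtain ⟨l, hl⟩ := mem_zpowers_w hk0 (u := h * c * artin m (sg m i) h⁻¹) (by
      rw [hgk, map_mul, map_mul, map_zpow, Fr.artin_w, map_inv] at h3
      rw [map_inv, Commute, SemiconjBy]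
      have := congrArg (fun x => h * x * (artin m (sg m i) h)⁻¹) h3
      simp only [mul_assoc, mul_inv_cancel_left, mul_inv_cancel, mul_one] at this ⊢
      exact this.symm)
    refine ⟨l, ?_⟩
    have hc' : c = h⁻¹ * w m ^ l * artin m (sg m i) h := by
      rw [hl, map_inv]; group
    have e : W m ^ l = loopHom m (w m ^ l) := (map_zpow _ _ _).symm
    have hcw : Commute (sg (m + 1) i) (W m ^ l) := by
      rw [← incl_sg hi]; exact (commute_incl_W _).zpow_right l
    rw [hc, hc', hcw.eq, e, map_mul, map_mul, mul_assoc, ← incl_sg hi, ← incl_mul_loopHom,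
      map_inv, inv_inv]
    simp only [mul_assoc]
  obtain ⟨l, hl⟩ := hu 0 (by omega)
  refine ⟨h⁻¹, l, fun i hi => ?_⟩
  obtain ⟨l', hl'⟩ := hu i hi
  have h0 : ex (sg m 0) = ex (sg m i) := by rw [ex_sg (by omega), ex_sg hi]
  have := ex_hom (by omega) s (sg m i)
  rw [ex_sg hi, mul_one, hl, hl', ex_conj, ex_conj, ex_mul, ex_mul, ex_zpow, ex_zpow, ex_W,
    ex_sg (by omega), ex_sg (by omega)] at this
  have h2 : l' = l := by
    have h3 : (l' : ℤ) * (2 * (m + 1)) = l * (2 * (m + 1)) := by linarith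
    exact mul_right_cancel₀ (by positivity) h3
  rw [hl', h2]

end Br

namespace FreeGroup

theorem mk_mem_zpowers {α : Type*} (a : α) {L : List (α × Bool)} (h : ∀ x ∈ L, x.1 = a) :
    mk L ∈ Subgroup.zpowers (of a) := by
  induction L with
  | nil => exact one_mem _
  | cons x L ih =>
    have e : mk (x :: L) = mk [x] * mk L := (mul_mk (L₁ := [x])).symm
    rw [e]
    refine mul_mem ?_ (ih fun y hy => h y (List.mem_cons_of_mem _ hy))
    obtain ⟨b, s⟩ := x
    obtain rfl : b = a := h _ List.mem_cons_self
    cases s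
    · exact ⟨-1, (zpow_neg_one _).trans rfl⟩
    · exact Subgroup.mem_zpowers _

theorem exists_isReduced_zpow {α : Type*} (a : α) (k : ℤ) :
    ∃ L : List (α × Bool), IsReduced L ∧ (∀ x ∈ L, x.1 = a) ∧ mk L = of a ^ k := by
  rcases Int.natAbs_eq k with e | e
  · refine ⟨List.replicate k.natAbs (a, true), List.isChain_replicate_of_rel _ fun _ => rfl,
      fun x hx => by rw [List.eq_of_mem_replicate hx], ?_⟩
    conv_rhs => rw [e, zpow_natCast]
    induction k.natAbs with
    | zero => rfl
    | succ n ih => rw [List.replicate_succ, pow_succ', ← ih]; rfl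
  · refine ⟨List.replicate k.natAbs (a, false), List.isChain_replicate_of_rel _ fun _ => rfl,
      fun x hx => by rw [List.eq_of_mem_replicate hx], ?_⟩
    conv_rhs => rw [e, zpow_neg, zpow_natCast, ← inv_pow]
    induction k.natAbs with
    | zero => rfl
    | succ n ih => rw [List.replicate_succ, pow_succ', ← ih]; rfl

theorem eq_of_mk_eq {α : Type*} [DecidableEq α] {L L' : List (α × Bool)} (h : IsReduced L)
    (h' : IsReduced L') (e : mk L = mk L') : L = L' := by
  rw [← h.reduce_eq, ← h'.reduce_eq, ← toWord_mk, ← toWord_mk, e]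

/-- Replacing the letter `1` by the product of the letters `1` and `2`. -/
def double : Fin 2 × Bool → List (Fin 3 × Bool)
  | (0, e) => [(0, e)]
  | (1, true) => [(1, true), (2, true)]
  | (1, false) => [(2, false), (1, false)]

theorem mk_flatMap_double (L : List (Fin 2 × Bool)) :
    mk (L.flatMap double) = lift ![of 0, of 1 * of 2] (mk L) := by
  induction L with
  | nil => rfl
  | cons x L ih =>
    have e : mk (x :: L) = mk [x] * mk L := (mul_mk (L₁ := [x])).symm
    rw [List.flatMap_cons, ← mul_mk, ih, e, _root_.map_mul]
    congr 1
    obtain ⟨i, s⟩ := x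
    fin_cases i <;> cases s <;> simp [double, lift_mk] <;> rfl

theorem isReduced_flatMap_double {L : List (Fin 2 × Bool)} (h : IsReduced L) :
    IsReduced (L.flatMap double) := by
  induction L with
  | nil => exact List.isChain_nil
  | cons x L ih =>
    rw [List.flatMap_cons]
    refine List.isChain_append.2 ⟨?_, ih h.tail, ?_⟩
    · obtain ⟨i, e⟩ := x
      fin_cases i <;> cases e <;> simp [double]
    · rcases L with _ | ⟨y, L⟩
      · simp
      · have h1 : x.1 = y.1 → x.2 = y.2 := (List.isChain_cons_cons.1 h).1
        obtain ⟨i, e⟩ := x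
        obtain ⟨j, e'⟩ := y
        revert h1
        fin_cases i <;> fin_cases j <;> cases e <;> cases e' <;> simp [double]

theorem mk_map_lift {α β : Type*} (f : α → β) (L : List (α × Bool)) :
    mk (L.map fun x => (f x.1, x.2)) = lift (fun a => of (f a)) (mk L) :=
  (map.mk (f := f) (L := L)).symm.trans (by
    rw [map_eq_lift]; rfl)

theorem exists_trim {u : FreeGroup (Fin 2)} (hu : u ∉ Subgroup.zpowers (of 0)) :
    ∃ (i l : ℤ) (V : List (Fin 2 × Bool)), u = of 0 ^ i * mk V * of 0 ^ l ∧ IsReduced V ∧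
      V ≠ [] ∧ (∀ x ∈ V.head?, x.1 = 1) ∧ ∀ x ∈ V.getLast?, x.1 = 1 := by
  let p : Fin 2 × Bool → Bool := fun x => x.1 = 0
  have hp : ∀ x, p x = true → x.1 = 0 := fun x h => by simpa [p] using h
  have hp' : ∀ x, ¬ p x = true → x.1 = 1 := fun x h => by
    have : x.1 ≠ 0 := fun h0 => h (by simpa [p] using h0)
    omega
  set L := u.toWord with hL
  set L1 := L.dropWhile p with hL1
  set V := L1.rdropWhile p with hV
  have hV1 : V ++ L1.rtakeWhile p = L1 := List.rdropWhile_append_rtakeWhile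
  have hLV : L.takeWhile p ++ (V ++ L1.rtakeWhile p) = L := by
    rw [hV1, List.takeWhile_append_dropWhile]
  obtain ⟨i, hi⟩ := mk_mem_zpowers (0 : Fin 2) (L := L.takeWhile p)
    fun x hx => hp x (List.mem_takeWhile_imp hx)
  obtain ⟨l, hl⟩ := mk_mem_zpowers (0 : Fin 2) (L := L1.rtakeWhile p)
    fun x hx => hp x (List.mem_rtakeWhile_imp hx)
  have e : u = of 0 ^ i * mk V * of 0 ^ l := by
    change (fun z : ℤ => of (0 : Fin 2) ^ z) i = _ at hi
    change (fun z : ℤ => of (0 : Fin 2) ^ z) l = _ at hl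
    simp only at hi hl
    rw [hi, hl, mul_mk, mul_mk, List.append_assoc, hLV, hL, mk_toWord]
  have hne : V ≠ [] := fun h => hu (by
    rw [e, h]
    exact mul_mem (mul_mem (Subgroup.zpow_mem _ (Subgroup.mem_zpowers _) _) (one_mem _))
      (Subgroup.zpow_mem _ (Subgroup.mem_zpowers _) _))
  refine ⟨i, l, V, e, ?_, hne, fun x hx => ?_, fun x hx => ?_⟩
  · have h1 : IsReduced (L.takeWhile p ++ (V ++ L1.rtakeWhile p)) := by
      rw [hLV]
      exact isReduced_toWord
    exact h1.right_of_append.left_of_append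
  · refine hp' x fun hpx => ?_
    have h1 : L1.head? = some x := by
      rw [← hV1, List.head?_append_of_ne_nil _ hne]; exact hx
    have := List.head?_dropWhile_not p L
    rw [← hL1, h1] at this
    simp [hpx] at this
  · refine hp' x ?_
    have := List.rdropWhile_last_not p L1 hne
    rw [List.getLast?_eq_some_getLast hne] at hx
    rwa [← Option.some.inj hx]

theorem isReduced_map {α β : Type*} {f : α → β} (hf : Function.Injective f)
    {L : List (α × Bool)} (h : IsReduced L) : IsReduced (L.map fun x => (f x.1, x.2)) :=
  (List.isChain_map _).2 (h.imp fun _ _ hab h => hab (hf h))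

/-- The multiplicative words in one letter, with a parameter. -/
theorem eq_conj_of_multiplicative {u : FreeGroup (Fin 2)} (hu : u ∉ Subgroup.zpowers (of 0))
    (h : lift ![of (0 : Fin 3), of 1 * of 2] u =
      lift ![of 0, of 1] u * lift ![of 0, of 2] u) :
    ∃ k : ℤ, u = of 0 ^ k * of 1 * (of 0 ^ k)⁻¹ := by
  obtain ⟨i, l, V, rfl, hV, hne, hhead, hlast⟩ := exists_trim hu
  obtain ⟨R, hR, hR0, hRe⟩ := exists_isReduced_zpow (0 : Fin 3) (l + i)
  have e1 := mk_map_lift ![(0 : Fin 3), 1] V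
  have e2 := mk_map_lift ![(0 : Fin 3), 2] V
  have g1 : (fun a => of (![(0 : Fin 3), 1] a)) = ![of 0, of 1] := by
    ext1 a; fin_cases a <;> rfl
  have g2 : (fun a => of (![(0 : Fin 3), 2] a)) = ![of 0, of 2] := by
    ext1 a; fin_cases a <;> rfl
  rw [g1] at e1
  rw [g2] at e2
  have key : mk (V.flatMap double) =
      mk (V.map (fun x => (![(0 : Fin 3), 1] x.1, x.2)) ++
        (R ++ V.map (fun x => (![(0 : Fin 3), 2] x.1, x.2)))) := by
    rw [← mul_mk, ← mul_mk, e1, e2, hRe, mk_flatMap_double]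
    simp only [_root_.map_mul, _root_.map_zpow, lift_apply_of, Matrix.cons_val_zero] at h
    rw [zpow_add]
    have h2 := congrArg (fun x => (of 0 ^ i)⁻¹ * x * (of 0 ^ l)⁻¹) h
    simp only [mul_assoc, inv_mul_cancel_left, mul_inv_cancel, mul_one] at h2 ⊢
    exact h2
  have hwords := eq_of_mk_eq (isReduced_flatMap_double hV) (List.isChain_append.2
    ⟨isReduced_map (by decide) hV, List.isChain_append.2
      ⟨hR, isReduced_map (by decide) hV, ?_⟩, ?_⟩) key
  · obtain _ | ⟨x, t⟩ := V
    · exact absurd rfl hne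
    obtain ⟨j, e⟩ := x
    obtain rfl : j = 1 := hhead _ rfl
    cases e with
    | false => simp [double] at hwords
    | true =>
      obtain _ | ⟨y, t⟩ := t
      · obtain _ | ⟨z, R⟩ := R
        · refine ⟨i, ?_⟩
          have hil : l = -i := by
            have h1 : of (0 : Fin 3) ^ (l + i) = 1 := hRe.symm
            have h2 := congrArg (fun x => Multiplicative.toAdd
              (lift (fun _ => Multiplicative.ofAdd (1 : ℤ)) x)) h1
            simp at h2
            omega
          rw [hil, zpow_neg]
          rfl
        · have := hR0 z List.mem_cons_self
          simp [double] at hwords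
      · exfalso
        obtain ⟨j, e⟩ := y
        simp only [List.flatMap_cons, double, List.map_cons, List.cons_append, List.nil_append,
          List.cons.injEq, Prod.mk.injEq] at hwords
        have := hwords.2.1.1
        revert this
        fin_cases j <;> decide
  · intro x hx y hy hxy
    have h0 : x.1 = 0 := hR0 x (List.mem_of_getLast? hx)
    rw [List.head?_map] at hy
    obtain ⟨v, hv, rfl⟩ := Option.mem_map.1 hy
    rw [h0, hhead v hv] at hxy
    simp at hxy
  · intro x hx y hy hxy
    rw [List.getLast?_map] at hx
    obtain ⟨v, hv, rfl⟩ := Option.mem_map.1 hx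
    rw [hlast v hv] at hxy
    exfalso
    obtain _ | ⟨z, R⟩ := R
    · rw [List.nil_append, List.head?_map] at hy
      obtain ⟨v', hv', rfl⟩ := Option.mem_map.1 hy
      rw [hhead v' hv'] at hxy
      simp at hxy
    · obtain rfl : z = y := by simpa using hy
      rw [hR0 z List.mem_cons_self] at hxy
      simp at hxy

end FreeGroup

namespace Br

open Fr (w wp artin cnt)

/-- A pure braid without linking commuting with the braids on the first strands is trivial. -/
theorem eq_one_of_commute_incl {j : ℕ} (hj : 1 ≤ j) {b : Br (j + 1)} (hb : perm (j + 1) b = 1)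
    (hcr : ∀ i k, i ≤ j + 1 → k ≤ j + 1 → b.cr i k = 0) (h : ∀ c, Commute b (incl j c)) :
    b = 1 := by
  obtain ⟨a, c, rfl, hc⟩ := exists_toBr (b := b) (by rw [hb]; rfl)
  rw [hb] at hc
  have key : ∀ d, artin j d a = a ∧ c * d = d * c := fun d => by
    have h1 := (h d).eq
    rw [mul_assoc, ← map_mul, ← mul_assoc, incl_mul_loopHom, mul_assoc, ← map_mul] at h1
    obtain ⟨h2, h3⟩ := loop_incl_inj h1
    exact ⟨h2.symm, h3⟩
  obtain ⟨k, rfl⟩ := eq_zz_zpow_of_commute hc fun d _ => (key d).2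
  have hpc : perm (j + 1) (incl j (zz j ^ k)) = 1 := by rw [perm_incl, hc]
  have hk : k = 0 := by
    have := hcr 0 1 (by omega) (by omega)
    rw [cr_mul_pure _ _ hpc, cr_loopHom_lt _ (by omega) (by omega), cr_incl,
      cr_zpow_pure _ (perm_zz _), cr_zz (by omega) (by omega) (by omega)] at this
    omega
  subst hk
  have h1 := (key (zz j)).1
  rw [artin_zz, mul_assoc, inv_mul_eq_iff_eq_mul] at h1
  obtain ⟨l, rfl⟩ := mem_zpowers_w (k := 1) one_ne_zero (u := a) (by
    rw [zpow_one]; exact h1.symm)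
  have hl : l = 0 := by
    have := hcr 0 (j + 1) (by omega) (by omega)
    have h0 : (incl j (zz j ^ (0 : ℤ))).cr 0 (j + 1) = 0 := by
      rw [cr_incl, zpow_zero, cr_one]
    rw [cr_mul_pure _ _ hpc, h0, (cr_loopHom_last _ (by omega)).1, map_zpow, cnt_w (by omega),
      toAdd_zpow, toAdd_ofAdd, smul_eq_mul] at this
    omega
  rw [hl, zpow_zero, zpow_zero, map_one, map_one, one_mul]

theorem sg_loopHom_down {m : ℕ} (S : Subgroup (Fr m)) (hX : X m m ∈ S)
    (hS : ∀ b, ∀ x ∈ S, artin m b x ∈ S) (x : Fr m) : x ∈ S := by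
  refine Fr.mem_of_X S (fun k hk => ?_) x
  induction h : m - k generalizing k with
  | zero =>
    obtain rfl : k = m := by omega
    exact hX
  | succ n ih =>
    have := hS (sg m k) _ (ih (k + 1) (by omega) (by omega))
    rwa [Fr.artin_sg (by omega), Fr.artinFun_snd (by omega)] at this

/-- The endomorphism of the free group induced by an endomorphism fixing the smaller braid
group. -/
theorem exists_free_hom {m : ℕ} (f : Br (m + 1) →* Br (m + 1))
    (hf : ∀ b, f (incl m b) = incl m b) {u : Fr m} (hu : f (sg (m + 1) m ^ 2) = loopHom m u) :
    ∃ φ : Fr m →* Fr m, (∀ x, f (loopHom m x) = loopHom m (φ x)) ∧ φ (X m m) = u ∧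
      ∀ b x, φ (artin m b x) = artin m b (φ x) := by
  have hconj : ∀ b x, loopHom m (artin m b x) = incl m b * loopHom m x * (incl m b)⁻¹ :=
    fun b x => by rw [incl_mul_loopHom, mul_inv_cancel_right]
  have hX : f (loopHom m (X m m)) = loopHom m u := by
    rw [loopHom_X le_rfl, loop_last, hu]
  have hr : ∀ x, f (loopHom m x) ∈ (loopHom m).range := by
    refine sg_loopHom_down ((loopHom m).range.comap (f.comp (loopHom m))) ⟨u, hX.symm⟩ ?_
    rintro b x ⟨y, hy⟩
    refine ⟨artin m b y, ?_⟩
    rw [MonoidHom.comp_apply] at hy ⊢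
    rw [hconj, hconj, map_mul, map_mul, map_inv, hf, hy]
  let e := MonoidHom.ofInjective (loopHom_injective m)
  let φ : Fr m →* Fr m := e.symm.toMonoidHom.comp ((f.comp (loopHom m)).codRestrict _ hr)
  have hφ : ∀ x, f (loopHom m x) = loopHom m (φ x) := fun x => by
    have : e (φ x) = ((f.comp (loopHom m)).codRestrict _ hr) x := e.apply_symm_apply _
    exact (congrArg Subtype.val this).symm
  refine ⟨φ, hφ, loopHom_injective m (by rw [← hφ, hX]), fun b x => loopHom_injective m ?_⟩
  rw [← hφ, hconj, hconj, map_mul, map_mul, map_inv, hf, hφ]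

theorem hom_eq_of_sq {m : ℕ} (hm : 1 ≤ m) (f : Br (m + 1) →* Br (m + 1))
    (hf : ∀ b, f (incl m b) = incl m b) (hp : perm (m + 1) (f (sg (m + 1) m)) = Equiv.swap m (m + 1))
    (h2 : f (sg (m + 1) m) ^ 2 = sg (m + 1) m ^ 2) : f (sg (m + 1) m) = sg (m + 1) m := by
  obtain ⟨φ, h1, hφX, hφ⟩ := exists_free_hom f hf (u := X m m)
    (by rw [map_pow, h2, loopHom_X le_rfl, loop_last])
  have hid : ∀ x, φ x = x := sg_loopHom_down (φ.eqLocus (MonoidHom.id _)) hφX fun b x hx => by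
    have hx' : φ x = x := hx
    exact (hφ b x).trans (by rw [hx']; rfl)
  have hpure : ∀ b, perm (m + 1) b = 1 → f b = b := fun b hb => by
    obtain ⟨a, c, rfl, -⟩ := exists_toBr (b := b) (by rw [hb]; rfl)
    rw [map_mul, h1, hid, hf]
  have hs : perm (m + 1) (sg (m + 1) m) = Equiv.swap m (m + 1) := perm_sg (by omega)
  obtain ⟨k, hk⟩ := eq_zz_zpow_of_commute (b := (sg (m + 1) m)⁻¹ * f (sg (m + 1) m))
    (by rw [map_mul, map_inv, hp, hs, inv_mul_cancel]) fun p hp' => by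
      have h3 := hpure (sg (m + 1) m * p * (sg (m + 1) m)⁻¹)
        (by rw [map_mul, map_mul, hp', map_inv, mul_one, mul_inv_cancel])
      rw [map_mul, map_mul, map_inv, hpure p hp', mul_inv_eq_iff_eq_mul] at h3
      rw [Commute, SemiconjBy, mul_assoc, h3]
      group
  have hex : ex (f (sg (m + 1) m)) = 1 := by
    have h0 : ex (f (sg (m + 1) 0)) = 1 := by
      rw [← incl_sg (by omega), hf, ex_incl, ex_sg (by omega)]
    rw [ex_hom (by omega), h0, ex_sg (by omega), one_mul]
  have hk0 := congrArg ex hk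
  rw [ex_mul, ex_inv, hex, ex_sg (by omega), ex_zpow] at hk0
  have hk1 : k = 0 := by
    have := ex_zz_ne_zero (m := m + 1) (by omega)
    rcases mul_eq_zero.1 (hk0.symm.trans (by norm_num)) with h | h
    · exact h
    · exact absurd h this
  rw [hk1, zpow_zero, inv_mul_eq_one] at hk
  exact hk.symm

end Br

namespace Br

open Fr (w wp artin cnt)

theorem cr_sq_map_last {j : ℕ} (f : Br (j + 2) →* Br (j + 2))
    (hf : f (sg (j + 2) j) = sg (j + 2) j)
    (hp : perm (j + 2) (f (sg (j + 2) (j + 1))) = Equiv.swap (j + 1) (j + 2)) (p q : ℕ) :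
    (f (sg (j + 2) (j + 1)) ^ 2).cr p q =
      if p = j + 1 ∧ q = j + 2 ∨ p = j + 2 ∧ q = j + 1 then 2 else 0 := by
  have hc : sg (j + 2) j * sg (j + 2) (j + 1) * sg (j + 2) j ^ 2 *
      (sg (j + 2) j * sg (j + 2) (j + 1))⁻¹ = sg (j + 2) (j + 1) ^ 2 := by
    have h := sg_braid (m := j + 2) (k := j) (by omega)
    rw [← conj_pow, h]
    group
  have hc' := congrArg f hc
  rw [map_mul, map_inv, map_mul, map_pow, map_pow, map_mul, hf] at hc'
  have hP : ∀ i, perm (j + 2) (sg (j + 2) j * f (sg (j + 2) (j + 1))) i =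
      Equiv.swap j (j + 1) (Equiv.swap (j + 1) (j + 2) i) := fun i => by
    rw [map_mul, hp, perm_sg (by omega)]; rfl
  have h1 := cr_conj (sg (j + 2) j * f (sg (j + 2) (j + 1))) (sg (j + 2) j ^ 2)
    (perm_sg_sq (by omega)) (Equiv.swap (j + 1) (j + 2) (Equiv.swap j (j + 1) p))
    (Equiv.swap (j + 1) (j + 2) (Equiv.swap j (j + 1) q))
  rw [hc', hP, hP, Equiv.swap_apply_self, Equiv.swap_apply_self, Equiv.swap_apply_self,
    Equiv.swap_apply_self] at h1
  have e1 : ∀ p, Equiv.swap (j + 1) (j + 2) (Equiv.swap j (j + 1) p) = j ↔ p = j + 1 := fun p => by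
    rw [Equiv.swap_apply_def, Equiv.swap_apply_def]
    split_ifs <;> omega
  have e2 : ∀ p, Equiv.swap (j + 1) (j + 2) (Equiv.swap j (j + 1) p) = j + 1 ↔ p = j + 2 :=
    fun p => by
      rw [Equiv.swap_apply_def, Equiv.swap_apply_def]
      split_ifs <;> omega
  rw [h1, cr_sg_sq (by omega)]
  simp only [e1, e2]

/-- The square of the image of the last generator is a word in the last loop and the loop around
all strands. -/
theorem exists_sq_eq_loopHom {j : ℕ} (hj : 1 ≤ j) (f : Br (j + 2) →* Br (j + 2))
    (hf : ∀ b, f (incl (j + 1) b) = incl (j + 1) b)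
    (hp : perm (j + 2) (f (sg (j + 2) (j + 1))) = Equiv.swap (j + 1) (j + 2)) :
    ∃ U : FreeGroup (Fin 2),
      f (sg (j + 2) (j + 1)) ^ 2 =
        loopHom (j + 1) (FreeGroup.lift ![w (j + 1), X (j + 1) (j + 1)] U) ∧
      cnt (j + 1) 0 (FreeGroup.lift ![w (j + 1), X (j + 1) (j + 1)] U) = 1 ∧
      cnt (j + 1) (j + 1) (FreeGroup.lift ![w (j + 1), X (j + 1) (j + 1)] U) =
        Multiplicative.ofAdd 1 := by
  have hcr := cr_sq_map_last f (by
    rw [← incl_sg (by omega), hf]) hp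
  obtain ⟨u, b, hub, hb⟩ := exists_toBr (b := f (sg (j + 2) (j + 1)) ^ 2) (by
    rw [map_pow, hp, sq, Equiv.swap_mul_self]; rfl)
  have hb1 : perm (j + 1) b = 1 := by rw [hb, map_pow, hp, sq, Equiv.swap_mul_self]
  have hbi : perm (j + 2) (incl (j + 1) b) = 1 := by rw [perm_incl, hb1]
  have hbc : ∀ p q, p ≤ j + 1 → q ≤ j + 1 → b.cr p q = 0 := fun p q hp hq => by
    have := hcr p q
    rw [hub, cr_mul_pure _ _ hbi, cr_loopHom_lt _ hp hq, cr_incl, if_neg (by omega)] at this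
    omega
  have hcomm : ∀ d, artin (j + 1) (incl j d) u = u ∧ b * incl j d = incl j d * b := fun d => by
    have h1 : Commute (f (sg (j + 2) (j + 1)) ^ 2) (incl (j + 1) (incl j d)) := by
      have := (commute_incl_incl d).map f
      rw [hf] at this
      exact this.pow_left 2
    have h2 := h1.eq
    rw [hub, mul_assoc, ← map_mul, ← mul_assoc, incl_mul_loopHom, mul_assoc, ← map_mul] at h2
    obtain ⟨h3, h4⟩ := loop_incl_inj h2
    exact ⟨h3.symm, h4⟩
  obtain rfl := eq_one_of_commute_incl hj hb1 hbc fun d => (hcomm d).2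
  rw [map_one, mul_one] at hub
  have hmem := Fr.mem_closure_of_fixed (hcomm (zz j)).1
  have hle : Subgroup.closure {wp (j + 1) (j + 1), X (j + 1) (j + 1)} ≤
      (FreeGroup.lift ![w (j + 1), X (j + 1) (j + 1)]).range := by
    rw [Subgroup.closure_le]
    rintro x (rfl | rfl)
    · refine ⟨(FreeGroup.of 1)⁻¹ * FreeGroup.of 0, ?_⟩
      rw [map_mul, map_inv, FreeGroup.lift_apply_of, FreeGroup.lift_apply_of]
      exact inv_mul_cancel_left _ _
    · exact ⟨FreeGroup.of 1, FreeGroup.lift_apply_of⟩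
  obtain ⟨U, rfl⟩ := hle hmem
  refine ⟨U, hub, ?_, ?_⟩
  · have := hcr 0 (j + 2)
    rw [hub, (cr_loopHom_last _ (by omega)).1, if_neg (by omega)] at this
    exact Multiplicative.toAdd.injective (by rw [toAdd_one]; omega)
  · have := hcr (j + 1) (j + 2)
    rw [hub, (cr_loopHom_last _ (by omega)).1, if_pos (by omega)] at this
    exact Multiplicative.toAdd.injective (by rw [toAdd_ofAdd]; omega)

theorem lift_one_eq_one {j : ℕ} {G : Type*} [Group G] (c : G) {U : FreeGroup (Fin 2)}
    (hU : cnt (j + 1) 0 (FreeGroup.lift ![w (j + 1), X (j + 1) (j + 1)] U) = 1) :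
    FreeGroup.lift ![c, 1] U = 1 := by
  have h : FreeGroup.lift ![c, 1] = (zpowersHom G c).comp ((cnt (j + 1) 0).comp
      (FreeGroup.lift ![w (j + 1), X (j + 1) (j + 1)])) := FreeGroup.ext_hom _ _ fun i => by
    rw [MonoidHom.comp_apply, MonoidHom.comp_apply, FreeGroup.lift_apply_of,
      FreeGroup.lift_apply_of]
    fin_cases i
    · change c = zpowersHom G c (cnt (j + 1) 0 (w (j + 1)))
      rw [cnt_w (by omega), zpowersHom_apply, toAdd_ofAdd, zpow_one]
    · change 1 = zpowersHom G c (cnt (j + 1) 0 (X (j + 1) (j + 1)))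
      rw [Fr.cnt_X le_rfl, if_neg (by omega), map_one]
  rw [h, MonoidHom.comp_apply, MonoidHom.comp_apply, hU, map_one]

/-- An endomorphism of the free group fixing the boundary word and sending each generator to the
same word in the generator and the boundary word gives a multiplicative word. -/
theorem lift_mul_lift_mul_lift {i : ℕ} {φ : Fr (i + 2) →* Fr (i + 2)} {U : FreeGroup (Fin 2)}
    (hφ : ∀ k ≤ i + 2, φ (X (i + 2) k) = FreeGroup.lift ![w (i + 2), X (i + 2) k] U)
    (hw : φ (w (i + 2)) = w (i + 2)) {G : Type*} [Group G] (a b c : G)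
    (h1 : FreeGroup.lift ![c, 1] U = 1) :
    FreeGroup.lift ![c, a] U * FreeGroup.lift ![c, b] U * FreeGroup.lift ![c, b⁻¹ * a⁻¹ * c] U =
      c := by
  let ψ : Fr (i + 2) →* G := Fr.lift fun k => if k = i + 2 then a else if k = i + 1 then b else
    if k = i then b⁻¹ * a⁻¹ * c else 1
  have hψ : ∀ k ≤ i + 2, ψ (X (i + 2) k) = if k = i + 2 then a else if k = i + 1 then b else
    if k = i then b⁻¹ * a⁻¹ * c else 1 := fun k hk => Fr.lift_X _ hk
  have hw' : ∀ η : Fr (i + 2) →* G, (∀ k < i, η (X (i + 2) k) = 1) →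
      η (w (i + 2)) = η (X (i + 2) (i + 2)) * η (X (i + 2) (i + 1)) * η (X (i + 2) i) := by
    intro η hη
    have h0 : η (wp (i + 2) i) = 1 := Fr.wp_mem η.ker i fun k hk => hη k hk
    change η (wp (i + 2) (i + 2 + 1)) = _
    rw [Fr.wp_succ, Fr.wp_succ, Fr.wp_succ, map_mul, map_mul, map_mul, h0, mul_one, mul_assoc]
  have hψw : ψ (w (i + 2)) = c := by
    rw [hw' ψ fun k hk => ?_, hψ _ le_rfl, hψ _ (by omega), hψ _ (by omega), if_pos rfl,
      if_neg (by omega), if_pos rfl, if_neg (by omega), if_neg (by omega), if_pos rfl]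
    · group
    · rw [hψ k (by omega), if_neg (by omega), if_neg (by omega), if_neg (by omega)]
  have hM : ∀ k ≤ i + 2, ψ (φ (X (i + 2) k)) = FreeGroup.lift ![c, ψ (X (i + 2) k)] U :=
    fun k hk => by
      rw [hφ k hk, ← MonoidHom.comp_apply]
      congr 1
      refine FreeGroup.ext_hom _ _ fun l => ?_
      rw [MonoidHom.comp_apply, FreeGroup.lift_apply_of, FreeGroup.lift_apply_of]
      fin_cases l
      · exact hψw
      · rfl
  have h2 := hw' (ψ.comp φ) fun k hk => by
    rw [MonoidHom.comp_apply, hM k (by omega), hψ k (by omega), if_neg (by omega),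
      if_neg (by omega), if_neg (by omega), h1]
  simp only [MonoidHom.comp_apply] at h2
  rw [hw, hψw, hM _ le_rfl, hM _ (by omega), hM _ (by omega), hψ _ le_rfl, hψ _ (by omega),
    hψ _ (by omega), if_pos rfl,
    if_neg (by omega), if_pos rfl, if_neg (by omega), if_neg (by omega), if_pos rfl] at h2
  exact h2.symm

/-- An endomorphism fixing the smaller braid group and having the right permutation on the last
generator is conjugation. -/
theorem ext_eq {m : ℕ} (hm : 2 ≤ m) (f : Br (m + 1) →* Br (m + 1))
    (hf : ∀ i < m, f (sg (m + 1) i) = sg (m + 1) i)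
    (hp : perm (m + 1) (f (sg (m + 1) m)) = Equiv.swap m (m + 1)) :
    ∃ g, ∀ i < m + 1, f (sg (m + 1) i) = g * sg (m + 1) i * g⁻¹ := by
  obtain ⟨i, rfl⟩ := Nat.exists_eq_add_of_le' hm
  have hfi : ∀ b, f (incl (i + 2) b) = incl (i + 2) b := fun b => by
    have : f.comp (incl (i + 2)) = incl (i + 2) := hom_ext fun k hk => by
      rw [MonoidHom.comp_apply, incl_sg hk, hf k hk]
    exact DFunLike.congr_fun this b
  obtain ⟨U, hu, hU0, hU1⟩ := exists_sq_eq_loopHom (by omega) f hfi hp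
  obtain ⟨φ, h1, hφX, hφ⟩ := exists_free_hom f hfi ((map_pow _ _ _).trans hu)
  have hφX' : ∀ k ≤ i + 2, φ (X (i + 2) k) = FreeGroup.lift ![w (i + 2), X (i + 2) k] U := by
    intro k hk
    induction h : i + 2 - k generalizing k with
    | zero =>
      obtain rfl : k = i + 2 := by omega
      exact hφX
    | succ n ih =>
      have h2 : artin (i + 2) (sg (i + 2) k) (X (i + 2) (k + 1)) = X (i + 2) k := by
        rw [Fr.artin_sg (by omega), Fr.artinFun_snd (by omega)]
      rw [← h2, hφ, ih (k + 1) (by omega) (by omega)]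
      change ((artin (i + 2) (sg (i + 2) k)).toMonoidHom.comp _) U = _
      congr 1
      refine FreeGroup.ext_hom _ _ fun l => ?_
      rw [MonoidHom.comp_apply, FreeGroup.lift_apply_of, FreeGroup.lift_apply_of]
      fin_cases l
      · exact Fr.artin_w _
      · rfl
  have hw : φ (w (i + 2)) = w (i + 2) := by
    have h2 : φ (w (i + 2)) = (w (i + 2))⁻¹ * φ (w (i + 2)) * w (i + 2) := by
      rw [← artin_zz, ← hφ, Fr.artin_w]
    obtain ⟨l, hl⟩ := mem_zpowers_w (k := 1) one_ne_zero (u := φ (w (i + 2))) (by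
      rw [zpow_one, Commute, SemiconjBy]
      nth_rw 1 [h2]
      group)
    have h3 := ex_hom (by omega) f (W (i + 2))
    have h0 : ex (f (sg (i + 2 + 1) 0)) = 1 := by rw [hf _ (by omega), ex_sg (by omega)]
    rw [h0, one_mul, h1, ← hl, map_zpow, ex_zpow, ex_W] at h3
    have : l = 1 := by
      push_cast at h3
      nlinarith
    rw [← hl, this, zpow_one]
  have hmul : ∀ {G : Type} [Group G] (a b c : G), FreeGroup.lift ![c, a * b] U =
      FreeGroup.lift ![c, a] U * FreeGroup.lift ![c, b] U := fun a b c => by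
    have h1 := lift_one_eq_one c hU0
    have e1 := lift_mul_lift_mul_lift hφX' hw a b c h1
    have e2 := lift_mul_lift_mul_lift hφX' hw (a * b) 1 c h1
    rw [h1, mul_one, inv_one, one_mul, mul_inv_rev] at e2
    exact mul_right_cancel (e2.trans e1.symm)
  have hUn : U ∉ Subgroup.zpowers (FreeGroup.of 0) := by
    rintro ⟨k, rfl⟩
    change cnt _ 0 (FreeGroup.lift _ (FreeGroup.of 0 ^ k)) = 1 at hU0
    change cnt _ _ (FreeGroup.lift _ (FreeGroup.of 0 ^ k)) = _ at hU1
    rw [map_zpow, FreeGroup.lift_apply_of, map_zpow] at hU0 hU1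
    change cnt _ _ (w (i + 2)) ^ k = _ at hU0 hU1
    rw [cnt_w (by omega)] at hU0 hU1
    rw [hU1] at hU0
    exact absurd (Multiplicative.ofAdd.injective (hU0.trans ofAdd_zero.symm)) one_ne_zero
  obtain ⟨k, hk⟩ := FreeGroup.eq_conj_of_multiplicative hUn (hmul _ _ _)
  have hsq : f (sg (i + 2 + 1) (i + 2)) ^ 2 =
      W (i + 2) ^ k * sg (i + 2 + 1) (i + 2) ^ 2 * (W (i + 2) ^ k)⁻¹ := by
    have h2 : FreeGroup.lift ![w (i + 2), X (i + 2) (i + 2)] U =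
        w (i + 2) ^ k * X (i + 2) (i + 2) * (w (i + 2) ^ k)⁻¹ := by
      rw [hk, map_mul, map_mul, map_inv, map_zpow, FreeGroup.lift_apply_of,
        FreeGroup.lift_apply_of]
      rfl
    rw [hu, h2, map_mul, map_mul, map_inv, map_zpow, ← loop_last, ← loopHom_X le_rfl]
  have hWp : perm (i + 2 + 1) (W (i + 2) ^ k) = 1 := by rw [map_zpow, perm_loopHom, one_zpow]
  have hc : ∀ b, W (i + 2) ^ k * incl (i + 2) b * (W (i + 2) ^ k)⁻¹ = incl (i + 2) b := fun b => by
    rw [((commute_incl_W b).zpow_right k).symm.eq, mul_inv_cancel_right]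
  let f' := (MulAut.conj (W (i + 2) ^ k)⁻¹).toMonoidHom.comp f
  have hf' : ∀ b, f' b = (W (i + 2) ^ k)⁻¹ * f b * W (i + 2) ^ k := fun b => by
    change (W (i + 2) ^ k)⁻¹ * f b * (W (i + 2) ^ k)⁻¹⁻¹ = _
    rw [inv_inv]
  have hlast := hom_eq_of_sq (by omega) f' (fun b => by
      rw [hf', hfi]; nth_rw 1 [← hc b]; group)
    (by rw [hf', map_mul, map_mul, map_inv, hWp, inv_one, one_mul, mul_one, hp])
    (by rw [← map_pow, hf', map_pow, hsq]; group)
  refine ⟨W (i + 2) ^ k, fun l hl => ?_⟩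
  rcases Nat.lt_succ_iff_lt_or_eq.1 hl with h | rfl
  · rw [hf l h, ← incl_sg h, hc]
  · nth_rw 2 [← hlast]
    rw [hf']
    group

end Br

namespace Br

open Fr (w wp artin cnt)

/-- The endomorphisms which are, up to mirror image and central twists, conjugations. -/
def Std {m : ℕ} (f : Br m →* Br m) : Prop :=
  ∃ (g : Br m) (ε k : ℤ), (ε = 1 ∨ ε = -1) ∧ ∀ i < m, f (sg m i) = g * (sg m i ^ ε * zz m ^ k) * g⁻¹

/-- Twisting an endomorphism by central elements. -/
def twist {m : ℕ} (f : Br m →* Br m) (k : ℤ) : Br m →* Br m where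
  toFun b := f b * zz m ^ (k * ex b)
  map_one' := by rw [map_one, ex_one, mul_zero, zpow_zero, mul_one]
  map_mul' a b := by
    rw [map_mul, ex_mul, mul_add, zpow_add, mul_assoc, mul_assoc,
      ← mul_assoc (zz m ^ _) (f b), (commute_zz_zpow (f b) _).symm.eq, mul_assoc]

theorem twist_apply {m : ℕ} (f : Br m →* Br m) (k : ℤ) (b : Br m) :
    twist f k b = f b * zz m ^ (k * ex b) := rfl

theorem perm_zz_zpow (m : ℕ) (k : ℤ) : perm m (zz m ^ k) = 1 := by
  rw [map_zpow, perm_zz, one_zpow]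

theorem perm_twist {m : ℕ} (f : Br m →* Br m) (k : ℤ) (b : Br m) :
    perm m (twist f k b) = perm m (f b) := by
  rw [twist_apply, map_mul, perm_zz_zpow, mul_one]

theorem Std.of_conj {m : ℕ} {f : Br m →* Br m} (h : Br m)
    (hf : Std ((MulAut.conj h).toMonoidHom.comp f)) : Std f := by
  obtain ⟨g, ε, k, hε, hk⟩ := hf
  refine ⟨h⁻¹ * g, ε, k, hε, fun i hi => ?_⟩
  have := hk i hi
  change h * f (sg m i) * h⁻¹ = _ at this
  rw [mul_inv_eq_iff_eq_mul, ← eq_inv_mul_iff_mul_eq] at this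
  rw [this]
  group

theorem Std.of_twist {m : ℕ} {f : Br m →* Br m} (l : ℤ) (hf : Std (twist f l)) : Std f := by
  obtain ⟨g, ε, k, hε, hk⟩ := hf
  refine ⟨g, ε, k - l, hε, fun i hi => ?_⟩
  have := hk i hi
  rw [twist_apply, ex_sg hi, mul_one, ← eq_mul_inv_iff_mul_eq, ← zpow_neg] at this
  rw [this, mul_assoc, (commute_zz_zpow g⁻¹ _).eq, sub_eq_add_neg, zpow_add]
  group

theorem Std.of_mirror {m : ℕ} {f : Br m →* Br m} (hf : Std (f.comp (mirror m))) : Std f := by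
  obtain ⟨g, ε, k, hε, hk⟩ := hf
  refine ⟨g, -ε, -k, by omega, fun i hi => ?_⟩
  have := hk i hi
  rw [MonoidHom.comp_apply, mirror_sg, map_inv, inv_eq_iff_eq_inv] at this
  rw [this, zpow_neg, zpow_neg, ← mul_inv_rev, ← (commute_zz_zpow _ k).eq]
  group

theorem std_of_section {m : ℕ} (hm : 2 ≤ m) {f : Br (m + 1) →* Br (m + 1)} {a b : ℤ}
    (hf : ∀ i < m, f (sg (m + 1) i) = sg (m + 1) i * incl m (zz m) ^ a * zz (m + 1) ^ b)
    (hp : perm (m + 1) (f (sg (m + 1) m)) = Equiv.swap m (m + 1)) : Std f := by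
  have ha : a = 0 := eq_zero_of_commute (b := b) hm hp (by
    rw [← hf 0 (by omega)]
    exact (commute_sg (Or.inr (by omega))).map f)
  obtain ⟨g, hg⟩ := ext_eq hm (twist f (-b)) (fun i hi => by
      rw [twist_apply, hf i hi, ha, zpow_zero, ex_sg (by omega), mul_one, mul_one, mul_assoc,
        ← zpow_add, add_neg_cancel, zpow_zero, mul_one])
    (by rw [perm_twist, hp])
  exact Std.of_twist (-b) ⟨g, 1, 0, Or.inl rfl, fun i hi => by
    rw [hg i hi, zpow_one, zpow_zero, mul_one]⟩

theorem std_of_lift {m : ℕ} (hm : 2 ≤ m) {f : Br (m + 1) →* Br (m + 1)} {g : Br m} {k : ℤ}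
    (hp : ∀ i < m + 1, perm (m + 1) (f (sg (m + 1) i)) = perm (m + 1) (sg (m + 1) i))
    (hf : ∀ i < m, ∃ a, f (sg (m + 1) i) =
      loopHom m a * incl m (g * (sg m i * zz m ^ k) * g⁻¹)) : Std f := by
  have hg : perm m g = 1 := perm_eq_one_of_commute hm fun i hi => by
    obtain ⟨a, ha⟩ := hf i hi
    have := hp i (by omega)
    rw [ha, ← incl_sg hi, map_mul, perm_loopHom, perm_incl, perm_incl, one_mul, map_mul, map_mul,
      map_mul, perm_zz_zpow, mul_one, map_inv, mul_inv_eq_iff_eq_mul] at this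
    exact this
  have hg' : perm (m + 1) (incl m g) = 1 := by rw [perm_incl, hg]
  let f' := twist ((MulAut.conj (incl m g)⁻¹).toMonoidHom.comp f) (-k)
  have hf' : ∀ b, f' b = (incl m g)⁻¹ * f b * incl m g * zz (m + 1) ^ (-k * ex b) := fun b => by
    rw [twist_apply]
    change (incl m g)⁻¹ * f b * (incl m g)⁻¹⁻¹ * _ = _
    rw [inv_inv]
  obtain ⟨h, l, hl⟩ := section_eq hm (f'.comp (incl m)) fun i hi => by
    obtain ⟨a, ha⟩ := hf i hi
    have h1 : incl m g⁻¹ * loopHom m a = loopHom m (artin m g⁻¹ a) * incl m g⁻¹ :=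
      incl_mul_loopHom _ _
    refine ⟨artin m g⁻¹ a * w m ^ (-k), ?_⟩
    rw [MonoidHom.comp_apply, hf', incl_sg hi, ha, ex_sg (by omega), mul_one, ← map_inv, ← mul_assoc, h1,
      mul_assoc (loopHom m _), mul_assoc (loopHom m _), mul_assoc (loopHom m _), ← map_mul, ← map_mul,
      ← mul_assoc g⁻¹, ← mul_assoc g⁻¹, inv_mul_cancel, one_mul, inv_mul_cancel_right,
      (commute_zz_zpow (sg m i) k).eq, map_mul,
      ← incl_sg hi,
      mul_assoc, (commute_zz_zpow (incl m (sg m i)) (-k)).eq, ← mul_assoc, ← mul_assoc,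
      mul_zz_zpow]
  refine Std.of_conj (incl m g)⁻¹ (Std.of_twist (-k) (Std.of_conj (loopHom m h)⁻¹ ?_))
  refine std_of_section hm (a := -l) (b := l) (fun i hi => ?_) ?_
  · change (loopHom m h)⁻¹ * f' (sg (m + 1) i) * (loopHom m h)⁻¹⁻¹ = _
    have := hl i hi
    rw [MonoidHom.comp_apply, incl_sg hi] at this
    rw [this, zz_zpow_succ, map_zpow, map_zpow]
    group
  · change perm _ ((loopHom m h)⁻¹ * f' (sg (m + 1) m) * (loopHom m h)⁻¹⁻¹) = _
    rw [hf', map_mul, map_mul, map_inv, map_inv, map_inv, perm_loopHom, map_mul, map_mul,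
      map_mul, map_inv, perm_zz_zpow, hg', hp m (by omega), perm_sg (by omega)]
    simp

/-- The inductive step for endomorphisms which are the identity on permutations. -/
theorem std_succ {m : ℕ} (hm : 2 ≤ m)
    (ih : ∀ f : Br m →* Br m, (∀ i < m, perm m (f (sg m i)) = perm m (sg m i)) → Std f)
    {f : Br (m + 1) →* Br (m + 1)}
    (hp : ∀ i < m + 1, perm (m + 1) (f (sg (m + 1) i)) = perm (m + 1) (sg (m + 1) i)) : Std f := by
  have hpf : ∀ b, perm (m + 1) (f b) = perm (m + 1) b := fun b => by
    have : (perm (m + 1)).comp f = perm (m + 1) := hom_ext hp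
    exact DFunLike.congr_fun this b
  have hfix : ∀ b, perm (m + 1) (f (incl m b)) (m + 1) = m + 1 := fun b => by
    rw [hpf, perm_incl, perm_apply_of_gt _ (Nat.lt_succ_self m)]
  let f' : Br m →* Br m :=
    { toFun b := Gr.pr (Gr.ofBr (f (incl m b)))
      map_one' := by
        have h := Gr.ofBr_mul (f (incl m 1)) (hfix 1)
        rw [← map_mul, ← map_mul, mul_one] at h
        rw [right_eq_mul.1 h, map_one]
      map_mul' a b := by rw [map_mul, map_mul, Gr.ofBr_mul _ (hfix b), map_mul] }
  have hf' : ∀ b, ∃ a, f (incl m b) = loopHom m a * incl m (f' b) := fun b =>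
    ⟨(Gr.ofBr (f (incl m b))).left, (Gr.toBr_ofBr (hfix b)).symm⟩
  obtain ⟨g, ε, k, hε, hk⟩ := ih f' fun i hi => by
    obtain ⟨a, ha⟩ := hf' (sg m i)
    have := congrArg (perm (m + 1)) ha
    rw [hpf, map_mul, perm_loopHom, perm_incl, perm_incl, one_mul] at this
    exact this.symm
  rcases hε with rfl | rfl
  · refine std_of_lift hm (g := g) (k := k) hp fun i hi => ?_
    obtain ⟨a, ha⟩ := hf' (sg m i)
    exact ⟨a, by rw [← incl_sg hi, ha, hk i hi, zpow_one]⟩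
  · refine Std.of_mirror (std_of_lift hm (g := g) (k := -k) (fun i hi => ?_) fun i hi => ?_)
    · rw [MonoidHom.comp_apply, mirror_sg, map_inv, map_inv, hp i hi, perm_sg hi, Equiv.swap_inv]
    · obtain ⟨a, ha⟩ := hf' (sg m i)⁻¹
      refine ⟨a, ?_⟩
      rw [MonoidHom.comp_apply, mirror_sg, ← incl_sg hi, ← map_inv, ha, map_inv, hk i hi, zpow_neg,
        zpow_one, zpow_neg,
        mul_inv_rev, mul_inv_rev, mul_inv_rev, inv_inv, inv_inv, mul_assoc g,
        ← (commute_zz_zpow (sg m i) k).inv_right.eq]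

end Br

namespace Br

open Fr (w wp artin cnt)

/-- The permutation of a braid, as a permutation of the set of strands. -/
def permFin (m : ℕ) : Br m →* Equiv.Perm (Fin (m + 1)) :=
  MonoidHom.mk' (fun b =>
    { toFun i := ⟨perm m b i, Nat.lt_succ_of_le (perm_apply_le b (Nat.le_of_lt_succ i.2))⟩
      invFun i := ⟨perm m b⁻¹ i, Nat.lt_succ_of_le (perm_apply_le b⁻¹ (Nat.le_of_lt_succ i.2))⟩
      left_inv i := by simp
      right_inv i := by simp }) fun a b => by
    ext i
    simp

theorem coe_permFin {m : ℕ} (b : Br m) (i : Fin (m + 1)) : (permFin m b i : ℕ) = perm m b i := rfl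

theorem permFin_eq_iff {m : ℕ} {a b : Br m} : permFin m a = permFin m b ↔ perm m a = perm m b := by
  refine ⟨fun h => perm_injOn fun i hi => ?_, fun h => Equiv.ext fun i => Fin.ext ?_⟩
  · have := congrArg Fin.val (DFunLike.congr_fun h ⟨i, Nat.lt_succ_of_le hi⟩)
    exact this
  · rw [coe_permFin, coe_permFin, h]

theorem permFin_eq_one_iff {m : ℕ} {a : Br m} : permFin m a = 1 ↔ perm m a = 1 := by
  rw [← map_one (permFin m), permFin_eq_iff, map_one]

theorem permFin_sg {m k : ℕ} (hk : k < m) :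
    permFin m (sg m k) = Equiv.swap ⟨k, by omega⟩ ⟨k + 1, by omega⟩ := by
  ext i
  rw [coe_permFin, perm_sg hk, Equiv.swap_apply_def, Equiv.swap_apply_def]
  simp only [Fin.ext_iff]
  split_ifs <;> rfl

open Matrix

/-- The homology representation of the braid group on three strands. -/
def rho : Br 2 →* SpecialLinearGroup (Fin 2) ℤ :=
  lift (fun k => if k = 0 then ⟨!![1, -1; 0, 1], by decide⟩ else ⟨!![0, -1; 1, 2], by decide⟩)
    (fun k hk => by
      obtain rfl : k = 0 := by omega
      decide)
    (fun i j h hj => by omega)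

theorem rho_zero : rho (sg 2 0) = ⟨!![1, -1; 0, 1], by decide⟩ := lift_sg _ _ _ (by omega)

theorem rho_one : rho (sg 2 1) = ⟨!![0, -1; 1, 2], by decide⟩ := lift_sg _ _ _ (by omega)

theorem rho_surjective : Function.Surjective rho := by
  rw [← MonoidHom.range_eq_top, ← top_le_iff, ← SpecialLinearGroup.SL2Z_generators,
    Subgroup.closure_le]
  rintro _ (rfl | rfl)
  · refine ⟨sg 2 1 * (sg 2 0 * sg 2 0), ?_⟩
    rw [map_mul, map_mul, rho_zero, rho_one]
    decide
  · refine ⟨(sg 2 0)⁻¹, ?_⟩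
    rw [map_inv, rho_zero]
    decide

theorem zz_two : zz 2 = sg 2 0 * sg 2 0 * (sg 2 1 * (sg 2 0 * sg 2 0) * sg 2 1) := by
  rw [zz_succ, zz_succ, W_succ, W_zero]
  simp only [zz, map_one, one_mul, map_mul]
  rw [incl_sg (by omega)]

theorem rho_zz : rho (zz 2) = -1 := by
  rw [zz_two]
  simp only [map_mul, rho_zero, rho_one]
  decide

/-- The homology representation, with values in all matrices. -/
def rhoMat : Br 2 →* Matrix (Fin 2) (Fin 2) ℤ where
  toFun b := (rho b).1
  map_one' := by rw [map_one]; rfl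
  map_mul' a b := by rw [map_mul]; rfl

theorem rhoMat_apply (b : Br 2) : rhoMat b = (rho b).1 := rfl

theorem rhoMat_zero : rhoMat (sg 2 0) = !![1, -1; 0, 1] := by rw [rhoMat_apply, rho_zero]

theorem rhoMat_one : rhoMat (sg 2 1) = !![0, -1; 1, 2] := by rw [rhoMat_apply, rho_one]

theorem rho_eq_iff {a b : Br 2} : rho a = rho b ↔ rhoMat a = rhoMat b := Subtype.ext_iff

/-- Reduction modulo two of the homology representation permutes the three nonzero vectors in the
same way as the braid permutes the strands. -/
theorem rhoMat_mod_two (b : Br 2) (i : Fin 3) :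
    (Int.castRingHom (ZMod 2)).mapMatrix (rhoMat b) *ᵥ (![![1, 1], ![0, 1], ![1, 0]] i) =
      (![![1, 1], ![0, 1], ![1, 0]] : Fin 3 → Fin 2 → ZMod 2) (permFin 2 b i) := by
  let v : Fin 3 → Fin 2 → ZMod 2 := ![![1, 1], ![0, 1], ![1, 0]]
  let S : Subgroup (Br 2) :=
    { carrier := {b | ∀ i, (Int.castRingHom (ZMod 2)).mapMatrix (rhoMat b) *ᵥ v i =
        v (permFin 2 b i)}
      one_mem' := fun i => by
        rw [map_one, map_one, map_one, Matrix.one_mulVec, Equiv.Perm.one_apply]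
      mul_mem' := fun {a b} ha hb i => by
        rw [map_mul, map_mul, map_mul, ← Matrix.mulVec_mulVec, hb i, ha, Equiv.Perm.mul_apply]
      inv_mem' := fun {a} ha i => by
        have := ha (permFin 2 a⁻¹ i)
        rw [← Equiv.Perm.mul_apply, ← map_mul, mul_inv_cancel, map_one, Equiv.Perm.one_apply] at this
        rw [← this, Matrix.mulVec_mulVec, ← map_mul, ← map_mul, inv_mul_cancel, map_one, map_one,
          Matrix.one_mulVec] }
  have hS : ∀ k < 2, sg 2 k ∈ S := by
    intro k hk j
    interval_cases k
    · rw [rhoMat_zero, permFin_sg Nat.zero_lt_two]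
      revert j
      decide
    · rw [rhoMat_one, permFin_sg Nat.one_lt_two]
      revert j
      decide
  have : b ∈ S := mem_of_sg S hS b
  exact this i

theorem perm_eq_one_of_rho {b : Br 2} (hb : rho b = 1 ∨ rho b = -1) : perm 2 b = 1 := by
  rw [← permFin_eq_one_iff]
  ext1 i
  have h := rhoMat_mod_two b i
  have hb' : (Int.castRingHom (ZMod 2)).mapMatrix (rhoMat b) = 1 := by
    rcases hb with hb | hb <;> rw [rhoMat_apply, hb] <;> decide
  rw [hb', Matrix.one_mulVec] at h
  have hv : ∀ i j : Fin 3, ![![1, 1], ![0, 1], ![1, 0]] i =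
      (![![1, 1], ![0, 1], ![1, 0]] : Fin 3 → Fin 2 → ZMod 2) j → j = i := by decide
  exact hv _ _ h

open CongruenceSubgroup

/-- The generators of Sanov's free group. -/
def sanovGen : Fin 2 → Gamma 2 :=
  ![⟨⟨!![1, 0; 2, 1], by decide⟩, Gamma_mem'.mpr (by decide)⟩,
    ⟨⟨!![1, -2; 0, 1], by decide⟩, Gamma_mem'.mpr (by decide)⟩]

theorem sanovGen_zero_mul (g : Gamma 2) : (sanovGen 0 * g).1.1 0 0 = g.1.1 0 0 ∧
    (sanovGen 0 * g).1.1 1 0 = 2 * g.1.1 0 0 + g.1.1 1 0 := by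
  have := Matrix.two_mul_expl (sanovGen 0).1.1 g.1.1
  exact ⟨this.1.trans (by simp [sanovGen]), this.2.2.1.trans (by simp [sanovGen])⟩

theorem sanovGen_one_mul (g : Gamma 2) : (sanovGen 1 * g).1.1 0 0 = g.1.1 0 0 - 2 * g.1.1 1 0 ∧
    (sanovGen 1 * g).1.1 1 0 = g.1.1 1 0 := by
  have := Matrix.two_mul_expl (sanovGen 1).1.1 g.1.1
  exact ⟨this.1.trans (by simp [sanovGen]; ring), this.2.2.1.trans (by simp [sanovGen])⟩

open Pointwise in
/-- Sanov's theorem. -/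
theorem sanov_injective : Function.Injective (FreeGroup.lift sanovGen) := by
  have hodd : ∀ g : Gamma 2, g.1.1 0 0 % 2 = 1 ∧ g.1.1 1 0 % 2 = 0 := by
    rintro ⟨g, hg⟩
    rw [Gamma_mem] at hg
    have h1 : ((g.1 0 0 - 1 : ℤ) : ZMod 2) = 0 := by push_cast; rw [hg.1]; decide
    have h2 := hg.2.2.1
    rw [ZMod.intCast_zmod_eq_zero_iff_dvd] at h1 h2
    push_cast at h1 h2
    exact ⟨by change g.1 0 0 % 2 = 1; omega, by change g.1 1 0 % 2 = 0; omega⟩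
  let PX : Fin 2 → ℤ → ℤ → Prop := ![fun x y => (0 ≤ x ∧ x < y) ∨ (x ≤ 0 ∧ y < x),
    fun x y => (y ≤ 0 ∧ -y < x) ∨ (0 ≤ y ∧ x < -y)]
  let PY : Fin 2 → ℤ → ℤ → Prop := ![fun x y => (x < 0 ∧ -x < y) ∨ (0 < x ∧ y < -x),
    fun x y => (0 < y ∧ y < x) ∨ (y < 0 ∧ x < y)]
  refine FreeGroup.injective_lift_of_ping_pong (α := Gamma 2) _
    (fun i => {g | PX i (g.1.1 0 0) (g.1.1 1 0)}) (fun i => {g | PY i (g.1.1 0 0) (g.1.1 1 0)})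
    ?_ ?_ ?_ ?_ ?_ ?_
  · intro i
    fin_cases i
    · exact ⟨sanovGen 0, Or.inl (by decide)⟩
    · exact ⟨1, Or.inl (by decide)⟩
  · intro i j hij
    rw [Function.onFun, Set.disjoint_left]
    intro g hg hg'
    fin_cases i <;> fin_cases j <;> simp [PX] at hij hg hg' <;> omega
  · intro i j hij
    rw [Function.onFun, Set.disjoint_left]
    intro g hg hg'
    fin_cases i <;> fin_cases j <;> simp [PY] at hij hg hg' <;> omega
  · intro i j
    rw [Set.disjoint_left]
    intro g hg hg'
    fin_cases i <;> fin_cases j <;> simp [PX, PY] at hg hg' <;> omega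
  · rintro i _ ⟨g, hg, rfl⟩
    have h := hodd g
    fin_cases i
    · have hm := sanovGen_zero_mul g
      change PX 0 ((sanovGen 0 * g).1.1 0 0) ((sanovGen 0 * g).1.1 1 0)
      rw [hm.1, hm.2]
      simp [PX, PY] at hg ⊢
      omega
    · have hm := sanovGen_one_mul g
      change PX 1 ((sanovGen 1 * g).1.1 0 0) ((sanovGen 1 * g).1.1 1 0)
      rw [hm.1, hm.2]
      simp [PX, PY] at hg ⊢
      omega
  · rintro i _ ⟨g, hg, rfl⟩
    obtain ⟨h, rfl⟩ : ∃ h, g = sanovGen i * h := ⟨(sanovGen i)⁻¹ * g, by group⟩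
    have h2 := hodd h
    fin_cases i
    · have hm := sanovGen_zero_mul h
      change ¬PX 0 ((sanovGen 0 * h).1.1 0 0) ((sanovGen 0 * h).1.1 1 0) at hg
      rw [hm.1, hm.2] at hg
      simp [PX, PY] at hg ⊢
      omega
    · have hm := sanovGen_one_mul h
      change ¬PX 1 ((sanovGen 1 * h).1.1 0 0) ((sanovGen 1 * h).1.1 1 0) at hg
      rw [hm.1, hm.2] at hg
      simp [PX, PY] at hg ⊢
      omega

theorem rho_loopHom (a : Fr 1) :
    rho (sg 2 0 * sg 2 1 * sg 2 0) * (FreeGroup.lift sanovGen a).1 =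
      rho (loopHom 1 a) * rho (sg 2 0 * sg 2 1 * sg 2 0) := by
  rw [← eq_inv_mul_iff_mul_eq]
  have : (Gamma 2).subtype.comp (FreeGroup.lift sanovGen) =
      (MulAut.conj (rho (sg 2 0 * sg 2 1 * sg 2 0))⁻¹).toMonoidHom.comp (rho.comp (loopHom 1)) := by
    refine Fr.hom_ext fun k hk => ?_
    have h2 : loop 1 0 = (sg 2 1)⁻¹ * sg 2 0 ^ 2 * sg 2 1 := by
      rw [loop, zero_add, tau_succ le_rfl, tau_gt (by omega), mul_one]
    interval_cases k
    · change (FreeGroup.lift sanovGen (FreeGroup.of 0)).1 = _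
      rw [FreeGroup.lift_apply_of]
      simp only [MonoidHom.comp_apply, MulEquiv.coe_toMonoidHom,
        loopHom_X (Nat.zero_le 1), h2, map_mul, map_pow, map_inv, rho_zero, rho_one, sanovGen]
      decide
    · change (FreeGroup.lift sanovGen (FreeGroup.of 1)).1 = _
      rw [FreeGroup.lift_apply_of]
      simp only [MonoidHom.comp_apply, MulEquiv.coe_toMonoidHom,
        loopHom_X le_rfl, loop_last, map_mul, map_pow, map_inv, rho_zero, rho_one, sanovGen]
      decide
  have h := DFunLike.congr_fun this a
  simp only [MonoidHom.comp_apply, MulEquiv.coe_toMonoidHom, MulAut.conj_apply, inv_inv,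
    Subgroup.coe_subtype] at h
  rw [h, mul_assoc]

/-- A braid with scalar image in the homology representation is a power of the full twist. -/
theorem exists_zz_zpow_of_rho {b : Br 2} (hb : rho b = 1 ∨ rho b = -1) : ∃ k : ℤ, b = zz 2 ^ k := by
  have hp := perm_eq_one_of_rho hb
  obtain ⟨a, c, rfl, hc⟩ := exists_toBr (m := 1) (b := b) (by rw [hp]; rfl)
  obtain ⟨k, rfl⟩ := mem_zpowers_one c (hc.trans hp)
  have h1 := mul_zz_zpow 1 a k
  have hsq : (-1 : SpecialLinearGroup (Fin 2) ℤ) ^ 2 = 1 := by decide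
  have h2 : rho (loopHom 1 (a * w 1 ^ (-k))) ^ 2 = 1 := by
    have hz : rho (zz 2 ^ (-k)) ^ 2 = 1 := by
      rw [map_zpow, rho_zz, ← zpow_natCast, zpow_comm, zpow_natCast, hsq, _root_.one_zpow]
    rw [← h1, map_mul, ((commute_zz_zpow (m := 2) _ _).map rho).mul_pow, hz, mul_one]
    rcases hb with hb | hb <;> rw [hb]
    · exact one_pow _
    · exact hsq
  have h3 := rho_loopHom ((a * w 1 ^ (-k)) ^ 2)
  rw [map_pow (loopHom 1), map_pow rho, h2, one_mul, mul_eq_left] at h3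
  have h4 : (a * w 1 ^ (-k)) ^ 2 = 1 := sanov_injective (by rw [map_one]; exact Subtype.ext h3)
  have h5 : a * w 1 ^ (-k) = 1 := (pow_eq_one_iff_left two_ne_zero).mp h4
  rw [h5, map_one, _root_.zpow_neg, mul_inv_eq_one] at h1
  exact ⟨k, h1⟩

theorem exists_zz_zpow_of_rho_eq_one {b : Br 2} (hb : rho b = 1) :
    ∃ k : ℤ, b = zz 2 ^ (2 * k) := by
  obtain ⟨k, rfl⟩ := exists_zz_zpow_of_rho (.inl hb)
  rw [map_zpow, rho_zz] at hb
  rcases Int.even_or_odd' k with ⟨l, rfl | rfl⟩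
  · exact ⟨l, rfl⟩
  · rw [_root_.zpow_add, _root_.zpow_mul] at hb
    revert hb
    have : (-1 : SpecialLinearGroup (Fin 2) ℤ) ^ (2 : ℤ) = 1 := by decide
    rw [this, _root_.one_zpow]
    exact fun h => absurd h (by decide)

end Br

namespace FreeGroup

variable {H : Type*} [Group H]

/-- The homomorphism from the free group of rank two determined by two elements. -/
def lift₂ (a b : H) : FreeGroup (Fin 2) →* H := lift ![a, b]

theorem lift₂_zero (a b : H) : lift₂ a b (of 0) = a := lift_apply_of

theorem lift₂_one (a b : H) : lift₂ a b (of 1) = b := lift_apply_of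

theorem hom_ext₂ {f g : FreeGroup (Fin 2) →* H} (h0 : f (of 0) = g (of 0))
    (h1 : f (of 1) = g (of 1)) : f = g :=
  ext_hom f g (Fin.forall_fin_two.2 ⟨h0, h1⟩)

theorem mulAut_ext₂ {f g : MulAut (FreeGroup (Fin 2))} (h0 : f (of 0) = g (of 0))
    (h1 : f (of 1) = g (of 1)) : f = g := by
  ext x
  exact DFunLike.congr_fun (hom_ext₂ (f := f.toMonoidHom) (g := g.toMonoidHom) h0 h1) x

/-- The automorphism of the free group of rank two with prescribed values, and inverse with
prescribed values. -/
def mulAut₂ (a b a' b' : FreeGroup (Fin 2)) (h : lift₂ a' b' a = of 0 ∧ lift₂ a' b' b = of 1)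
    (h' : lift₂ a b a' = of 0 ∧ lift₂ a b b' = of 1) : MulAut (FreeGroup (Fin 2)) :=
  MonoidHom.toMulEquiv (lift₂ a b) (lift₂ a' b')
    (hom_ext₂ (by simpa [lift₂_zero] using h.1) (by simpa [lift₂_one] using h.2))
    (hom_ext₂ (by simpa [lift₂_zero] using h'.1) (by simpa [lift₂_one] using h'.2))

theorem mulAut₂_apply {a b a' b' : FreeGroup (Fin 2)} (h h') (g : FreeGroup (Fin 2)) :
    mulAut₂ a b a' b' h h' g = lift₂ a b g := rfl

/-- The abelianization of the free group of rank two. -/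
def abHom : FreeGroup (Fin 2) →* Multiplicative (Fin 2 → ℤ) :=
  lift₂ (Multiplicative.ofAdd ![1, 0]) (Multiplicative.ofAdd ![0, 1])

/-- The exponent sums of an element of the free group of rank two. -/
def ab (g : FreeGroup (Fin 2)) : Fin 2 → ℤ := (abHom g).toAdd

theorem ab_mul (g h : FreeGroup (Fin 2)) : ab (g * h) = ab g + ab h := by
  rw [ab, _root_.map_mul]; rfl

theorem ab_inv (g : FreeGroup (Fin 2)) : ab g⁻¹ = -ab g := by
  rw [ab, _root_.map_inv]; rfl

theorem ab_zero : ab (of 0) = ![1, 0] := congrArg Multiplicative.toAdd (lift₂_zero _ _)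

theorem ab_one : ab (of 1) = ![0, 1] := congrArg Multiplicative.toAdd (lift₂_one _ _)

theorem eq_of_conj_eq {g h : FreeGroup (Fin 2)} (hgh : MulAut.conj g = MulAut.conj h) : g = h := by
  have key : ∀ i : Fin 2, Commute (h⁻¹ * g) (of i) := fun i => by
    have := DFunLike.congr_fun hgh (of i)
    rw [MulAut.conj_apply, MulAut.conj_apply, mul_inv_eq_iff_eq_mul] at this
    rw [Commute, SemiconjBy, mul_assoc, this]
    group
  have hmem : ∀ i : Fin 2, h⁻¹ * g ∈ Subgroup.zpowers (of i) := fun i =>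
    mem_zpowers_of_commute (lift fun _ => Multiplicative.ofAdd 1) lift_apply_of (key i).symm
  obtain ⟨k, hk⟩ := hmem 0
  obtain ⟨l, hl⟩ := hmem 1
  have hk' := congrArg (fun g => ab g 0) (hk.trans hl.symm)
  have e0 : ab (of 0 ^ k) 0 = k := by
    rw [ab, _root_.map_zpow, toAdd_zpow]
    change k * ab (of 0) 0 = k
    rw [ab_zero]; simp
  have e1 : ab (of 1 ^ l) 0 = 0 := by
    rw [ab, _root_.map_zpow, toAdd_zpow]
    change l * ab (of 1) 0 = 0
    rw [ab_one]; simp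
  simp only [e0, e1] at hk'
  rw [hk'] at hk
  rw [← inv_mul_eq_one]
  have : h⁻¹ * g = 1 := by rw [← hk]; rfl
  rw [← inv_inj, mul_inv_rev, inv_inv, inv_one] at this
  exact this

end FreeGroup

namespace Br

open FreeGroup (of lift₂ lift₂_zero lift₂_one hom_ext₂ mulAut_ext₂ mulAut₂ mulAut₂_apply ab)

/-- The retraction of the braid group on four strands onto the one on three strands. -/
def retr : Br 3 →* Br 2 :=
  lift (fun k => if k = 1 then sg 2 1 else sg 2 0)
    (fun k hk => by
      have h := sg_braid (m := 2) (k := 0) (by omega)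
      obtain rfl | rfl : k = 0 ∨ k = 1 := by omega
      · exact h
      · exact h.symm)
    (fun i j h hj => by
      obtain ⟨rfl, rfl⟩ : i = 0 ∧ j = 2 := by omega
      rfl)

theorem retr_zero : retr (sg 3 0) = sg 2 0 := lift_sg _ _ _ (by omega)

theorem retr_one : retr (sg 3 1) = sg 2 1 := lift_sg _ _ _ (by omega)

theorem retr_two : retr (sg 3 2) = sg 2 0 := lift_sg _ _ _ (by omega)

theorem retr_incl (b : Br 2) : retr (incl 2 b) = b := by
  have : retr.comp (incl 2) = MonoidHom.id _ := hom_ext fun k hk => by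
    rw [MonoidHom.comp_apply, incl_sg hk]
    interval_cases k
    · exact retr_zero
    · exact retr_one
  exact DFunLike.congr_fun this b

theorem ex_retr (b : Br 3) : ex (retr b) = ex b := by
  rw [ex_hom (by omega), retr_zero, ex_sg (by omega), one_mul]

/-- The kernel of the retraction, parametrized by a free group. -/
def kerHom : FreeGroup (Fin 2) →* Br 3 :=
  lift₂ (sg 3 2 * (sg 3 0)⁻¹) (sg 3 1 * (sg 3 2 * (sg 3 0)⁻¹) * (sg 3 1)⁻¹)

theorem retr_kerHom (g : FreeGroup (Fin 2)) : retr (kerHom g) = 1 := by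
  have : retr.comp kerHom = 1 := hom_ext₂
    (by rw [MonoidHom.comp_apply, kerHom, lift₂_zero, map_mul, map_inv, retr_two, retr_zero]; simp)
    (by rw [MonoidHom.comp_apply, kerHom, lift₂_one]
        simp only [map_mul, map_inv, retr_two, retr_zero]; simp)
  exact DFunLike.congr_fun this g

/-- The action of the zeroth generator on the kernel of the retraction. -/
def kerAut₀ : MulAut (FreeGroup (Fin 2)) :=
  mulAut₂ (of 0) ((of 0)⁻¹ * of 1) (of 0) (of 0 * of 1)
    (by simp [lift₂_zero, lift₂_one]) (by simp [lift₂_zero, lift₂_one])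

/-- The action of the first generator on the kernel of the retraction. -/
def kerAut₁ : MulAut (FreeGroup (Fin 2)) :=
  mulAut₂ (of 1) (of 1 * (of 0)⁻¹ * of 1) (of 0 * (of 1)⁻¹ * of 0) (of 0)
    (by simp [lift₂_zero, lift₂_one, mul_assoc]) (by simp [lift₂_zero, lift₂_one, mul_assoc])

/-- The action of the second generator on the kernel of the retraction. -/
def kerAut₂ : MulAut (FreeGroup (Fin 2)) :=
  mulAut₂ (of 0) (of 1 * (of 0)⁻¹) (of 0) (of 1 * of 0)
    (by simp [lift₂_zero, lift₂_one]) (by simp [lift₂_zero, lift₂_one])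

/-- The action by conjugation on the kernel of the retraction. -/
def kerAct : Br 3 →* MulAut (FreeGroup (Fin 2)) :=
  lift (fun k => if k = 0 then kerAut₀ else if k = 1 then kerAut₁ else kerAut₂)
    (fun k hk => by
      obtain rfl | rfl : k = 0 ∨ k = 1 := by omega
      · refine mulAut_ext₂ ?_ ?_ <;>
        simp [kerAut₀, kerAut₁, MulAut.mul_apply, mulAut₂_apply, lift₂_zero, lift₂_one, mul_assoc]
      · refine mulAut_ext₂ ?_ ?_ <;>
        simp [kerAut₂, kerAut₁, MulAut.mul_apply, mulAut₂_apply, lift₂_zero, lift₂_one, mul_assoc])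
    (fun i j h hj => by
      obtain ⟨rfl, rfl⟩ : i = 0 ∧ j = 2 := by omega
      refine mulAut_ext₂ ?_ ?_ <;>
      simp [kerAut₂, kerAut₀, MulAut.mul_apply, mulAut₂_apply, lift₂_zero, lift₂_one, mul_assoc])

theorem kerAct_zero : kerAct (sg 3 0) = kerAut₀ := lift_sg _ _ _ (by omega)

theorem kerAct_one : kerAct (sg 3 1) = kerAut₁ := lift_sg _ _ _ (by omega)

theorem kerAct_two : kerAct (sg 3 2) = kerAut₂ := lift_sg _ _ _ (by omega)

theorem braid_identity₁ {G : Type*} [Group G] {a b c : G} (hab : a * b * a = b * a * b)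
    (hbc : b * c * b = c * b * c) :
    a * (b * (c * a⁻¹) * b⁻¹) = (c * a⁻¹)⁻¹ * (b * (c * a⁻¹) * b⁻¹) * a := by
  have hab' : a⁻¹ * b⁻¹ * a⁻¹ = b⁻¹ * a⁻¹ * b⁻¹ := by
    simpa [mul_assoc] using congrArg (·⁻¹) hab
  rw [mul_assoc (c * a⁻¹)⁻¹, eq_inv_mul_iff_mul_eq]
  calc _ = (c * b * c) * (a⁻¹ * b⁻¹ * a⁻¹) * a := by group
    _ = (b * c * b) * (b⁻¹ * a⁻¹ * b⁻¹) * a := by rw [hab', hbc]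
    _ = _ := by group

theorem braid_identity₂ {G : Type*} [Group G] {a b c : G} (hab : a * b * a = b * a * b)
    (hbc : b * c * b = c * b * c) (hac : a * c = c * a) :
    b * (b * (c * a⁻¹) * b⁻¹) =
      b * (c * a⁻¹) * b⁻¹ * (c * a⁻¹)⁻¹ * (b * (c * a⁻¹) * b⁻¹) * b := by
  have hab' : a⁻¹ * b⁻¹ * a⁻¹ = b⁻¹ * a⁻¹ * b⁻¹ := by
    simpa [mul_assoc] using congrArg (·⁻¹) hab
  have h1 : a⁻¹ * b⁻¹ * a = b * a⁻¹ * b⁻¹ := by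
    calc _ = b * (b⁻¹ * a⁻¹ * b⁻¹) * a := by group
      _ = _ := by rw [← hab']; group
  have h2 : c⁻¹ * b * c = b * c * b⁻¹ := by
    calc _ = c⁻¹ * (b * c * b) * b⁻¹ := by group
      _ = _ := by rw [hbc]; group
  have h3 : a⁻¹ * c = c * a⁻¹ := by rw [inv_mul_eq_iff_eq_mul, ← mul_assoc, hac, mul_inv_cancel_right]
  symm
  calc _ = b * c * (a⁻¹ * b⁻¹ * a) * (c⁻¹ * b * c) * a⁻¹ := by group
    _ = b * c * b * (a⁻¹ * c) * b⁻¹ * a⁻¹ := by rw [h1, h2]; group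
    _ = b * (c * b * c) * (a⁻¹ * b⁻¹ * a⁻¹) := by rw [h3]; group
    _ = b * (b * c * b) * (b⁻¹ * a⁻¹ * b⁻¹) := by rw [hab', hbc]
    _ = _ := by group

theorem mul_kerHom (b : Br 3) (g : FreeGroup (Fin 2)) :
    b * kerHom g = kerHom (kerAct b g) * b := by
  let S : Subgroup (Br 3) :=
    { carrier := {b | ∀ g, b * kerHom g = kerHom (kerAct b g) * b}
      one_mem' := fun g => by simp
      mul_mem' := fun {a b} ha hb g => by
        rw [mul_assoc, hb, ← mul_assoc, ha, map_mul, MulAut.mul_apply, mul_assoc]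
      inv_mem' := fun {a} ha g => by
        have := ha (kerAct a⁻¹ g)
        rw [← MulAut.mul_apply, ← map_mul, mul_inv_cancel, map_one, MulAut.one_apply] at this
        rw [inv_mul_eq_iff_eq_mul, ← mul_assoc, this, mul_inv_cancel_right] }
  have hS : ∀ k, sg 3 k * kerHom (of 0) = kerHom (kerAct (sg 3 k) (of 0)) * sg 3 k →
      sg 3 k * kerHom (of 1) = kerHom (kerAct (sg 3 k) (of 1)) * sg 3 k → sg 3 k ∈ S := by
    intro k h0 h1 g
    rw [← mul_inv_eq_iff_eq_mul]
    have := hom_ext₂ (f := (MulAut.conj (sg 3 k)).toMonoidHom.comp kerHom)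
      (g := kerHom.comp (kerAct (sg 3 k)).toMonoidHom)
      (mul_inv_eq_iff_eq_mul.2 h0) (mul_inv_eq_iff_eq_mul.2 h1)
    exact DFunLike.congr_fun this g
  have e0 : kerHom (of 0) = sg 3 2 * (sg 3 0)⁻¹ := lift₂_zero _ _
  have e1 : kerHom (of 1) = sg 3 1 * (sg 3 2 * (sg 3 0)⁻¹) * (sg 3 1)⁻¹ := lift₂_one _ _
  have hab := sg_braid (m := 3) (k := 0) (by omega)
  have hbc := sg_braid (m := 3) (k := 1) (by omega)
  have hac := sg_comm (m := 3) (i := 0) (j := 2) (by omega)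
  have h0 : sg 3 0 ∈ S := hS 0
    (by rw [kerAct_zero, kerAut₀, mulAut₂_apply, lift₂_zero, e0, ← mul_assoc, hac]; group)
    (by rw [kerAct_zero, kerAut₀, mulAut₂_apply, lift₂_one, map_mul, map_inv, e0, e1]
        exact braid_identity₁ hab hbc)
  have h1 : sg 3 1 ∈ S := hS 1
    (by rw [kerAct_one, kerAut₁, mulAut₂_apply, lift₂_zero, e0, e1]; group)
    (by rw [kerAct_one, kerAut₁, mulAut₂_apply, lift₂_one, map_mul, map_mul, map_inv, e0, e1]
        exact braid_identity₂ hab hbc hac)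
  have h2 : sg 3 2 ∈ S := by
    have e : kerAct (sg 3 2) = MulAut.conj (of 0) * kerAct (sg 3 0) := by
      rw [kerAct_two, kerAct_zero]
      refine mulAut_ext₂ ?_ ?_ <;> simp [kerAut₂, kerAut₀, mulAut₂_apply, lift₂_zero, lift₂_one]
    intro g
    have e' : sg 3 2 = kerHom (of 0) * sg 3 0 := by rw [e0, inv_mul_cancel_right]
    rw [e, MulAut.mul_apply, MulAut.conj_apply, map_mul, map_mul, map_inv, e', mul_assoc, h0 g]
    group
  exact mem_of_sg S (fun k hk => by interval_cases k <;> assumption) b g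

theorem kerAct_kerHom (a : FreeGroup (Fin 2)) : kerAct (kerHom a) = MulAut.conj a := by
  have : kerAct.comp kerHom = MulAut.conj := hom_ext₂
    (by
      rw [MonoidHom.comp_apply, kerHom, lift₂_zero, map_mul, map_inv, mul_inv_eq_iff_eq_mul,
        kerAct_two, kerAct_zero]
      refine mulAut_ext₂ ?_ ?_ <;> simp [kerAut₂, kerAut₀, mulAut₂_apply, lift₂_zero, lift₂_one])
    (by
      rw [MonoidHom.comp_apply, kerHom, lift₂_one, map_mul, map_mul, map_inv, map_mul, map_inv,
        kerAct_two, kerAct_zero, kerAct_one, mul_inv_eq_iff_eq_mul, ← mul_assoc,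
        mul_inv_eq_iff_eq_mul]
      refine mulAut_ext₂ ?_ ?_ <;>
      simp [kerAut₂, kerAut₁, kerAut₀, mulAut₂_apply, lift₂_zero, lift₂_one, mul_assoc])
  exact DFunLike.congr_fun this a

theorem kerHom_injective : Function.Injective kerHom := fun a b h => by
  apply FreeGroup.eq_of_conj_eq
  rw [← kerAct_kerHom, ← kerAct_kerHom, h]

theorem exists_eq_kerHom_mul (b : Br 3) : ∃ a, b = kerHom a * incl 2 (retr b) := by
  let S : Subgroup (Br 3) :=
    { carrier := {b | ∃ a, b = kerHom a * incl 2 (retr b)}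
      one_mem' := ⟨1, by simp⟩
      mul_mem' := by
        rintro b b' ⟨a, ha⟩ ⟨a', ha'⟩
        refine ⟨a * kerAct (incl 2 (retr b)) a', ?_⟩
        rw [map_mul retr, map_mul (incl 2), map_mul kerHom, mul_assoc, ← mul_assoc (kerHom _) (incl 2 _),
          ← mul_kerHom, mul_assoc (incl 2 _), ← ha', ← mul_assoc, ← ha]
      inv_mem' := by
        rintro b ⟨a, ha⟩
        refine ⟨kerAct (incl 2 (retr b))⁻¹ a⁻¹, ?_⟩
        rw [map_inv retr, map_inv (incl 2), ← mul_kerHom, map_inv kerHom, ← mul_inv_rev, ← ha] }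
  refine mem_of_sg S (fun k hk => ?_) b
  interval_cases k
  · exact ⟨1, by rw [map_one, retr_zero, incl_sg (by omega), one_mul]⟩
  · exact ⟨1, by rw [map_one, retr_one, incl_sg (by omega), one_mul]⟩
  · exact ⟨of 0, by rw [retr_two, incl_sg (by omega), kerHom, lift₂_zero, inv_mul_cancel_right]⟩

theorem exists_eq_kerHom {b : Br 3} (hb : retr b = 1) : ∃ a, kerHom a = b := by
  obtain ⟨a, ha⟩ := exists_eq_kerHom_mul b
  exact ⟨a, by rw [ha, hb, map_one, mul_one]⟩

open Matrix

theorem ab_kerAct (b : Br 3) (g : FreeGroup (Fin 2)) :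
    ab (kerAct b g) = rhoMat (retr b) *ᵥ ab g := by
  let S : Subgroup (Br 3) :=
    { carrier := {b | ∀ g, ab (kerAct b g) = rhoMat (retr b) *ᵥ ab g}
      one_mem' := fun g => by simp
      mul_mem' := fun {a b} ha hb g => by
        rw [map_mul, MulAut.mul_apply, ha, hb, Matrix.mulVec_mulVec, map_mul, map_mul]
      inv_mem' := fun {a} ha g => by
        have := ha (kerAct a⁻¹ g)
        rw [← MulAut.mul_apply, ← map_mul, mul_inv_cancel, map_one, MulAut.one_apply] at this
        rw [this, Matrix.mulVec_mulVec, ← map_mul, ← map_mul, inv_mul_cancel, map_one, map_one,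
          Matrix.one_mulVec] }
  have hS : ∀ k, ab (kerAct (sg 3 k) (of 0)) = rhoMat (retr (sg 3 k)) *ᵥ ab (of 0) →
      ab (kerAct (sg 3 k) (of 1)) = rhoMat (retr (sg 3 k)) *ᵥ ab (of 1) → sg 3 k ∈ S := by
    intro k h0 h1 g
    have := hom_ext₂ (f := FreeGroup.abHom.comp (kerAct (sg 3 k)).toMonoidHom)
      (g := (Matrix.mulVecLin (rhoMat (retr (sg 3 k)))).toAddMonoidHom.toMultiplicative.comp
        FreeGroup.abHom) h0 h1
    exact DFunLike.congr_fun this g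
  refine mem_of_sg S (fun k hk => ?_) b g
  interval_cases k
  · refine hS 0 ?_ ?_ <;>
    simp only [kerAct_zero, kerAut₀, mulAut₂_apply, lift₂_zero, lift₂_one, retr_zero, rhoMat_zero,
      FreeGroup.ab_mul, FreeGroup.ab_inv, FreeGroup.ab_zero, FreeGroup.ab_one] <;> decide
  · refine hS 1 ?_ ?_ <;>
    simp only [kerAct_one, kerAut₁, mulAut₂_apply, lift₂_zero, lift₂_one, retr_one, rhoMat_one,
      FreeGroup.ab_mul, FreeGroup.ab_inv, FreeGroup.ab_zero, FreeGroup.ab_one] <;> decide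
  · refine hS 2 ?_ ?_ <;>
    simp only [kerAct_two, kerAut₂, mulAut₂_apply, lift₂_zero, lift₂_one, retr_two, rhoMat_zero,
      FreeGroup.ab_mul, FreeGroup.ab_inv, FreeGroup.ab_zero, FreeGroup.ab_one] <;> decide

theorem exists_perm_kerHom : ∃ p q : Equiv.Perm ℕ, ∀ g,
    perm 3 (kerHom g) = p ^ ab g 0 * q ^ ab g 1 := by
  have hc : Commute (perm 3 (kerHom (of 0))) (perm 3 (kerHom (of 1))) := by
    have : permFin 3 (kerHom (of 0) * kerHom (of 1)) = permFin 3 (kerHom (of 1) * kerHom (of 0)) := by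
      rw [kerHom, lift₂_zero, lift₂_one]
      simp only [map_mul, map_inv, permFin_sg (show 0 < 3 by omega),
        permFin_sg (show 1 < 3 by omega), permFin_sg (show 2 < 3 by omega)]
      decide
    rw [permFin_eq_iff, map_mul, map_mul] at this
    exact this
  refine ⟨perm 3 (kerHom (of 0)), perm 3 (kerHom (of 1)), fun g => ?_⟩
  have hof : ∀ i, perm 3 (kerHom (of i)) =
      perm 3 (kerHom (of 0)) ^ ab (of i) 0 * perm 3 (kerHom (of 1)) ^ ab (of i) 1 := fun i => by
    fin_cases i <;> simp [FreeGroup.ab_zero, FreeGroup.ab_one]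
  refine FreeGroup.induction_on g (by simp [ab]) hof (fun i hi => ?_) (fun a b ha hb => ?_)
  · rw [map_inv, map_inv, hi, FreeGroup.ab_inv, _root_.mul_inv_rev, Pi.neg_apply, Pi.neg_apply, _root_.zpow_neg,
      _root_.zpow_neg]
    exact ((hc.zpow_zpow _ _).inv_inv).eq.symm
  · rw [map_mul, map_mul, ha, hb, FreeGroup.ab_mul, Pi.add_apply, Pi.add_apply, _root_.zpow_add,
      _root_.zpow_add, mul_assoc, ← mul_assoc (_ ^ ab a 1), ← (hc.zpow_zpow (ab b 0) (ab a 1)).eq]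
    group

theorem perm_kerHom_of_ab {g : FreeGroup (Fin 2)} (hg : ab g = 0) : perm 3 (kerHom g) = 1 := by
  obtain ⟨p, q, h⟩ := exists_perm_kerHom
  rw [h, hg]
  simp

end Br

theorem Int.exists_primitive {ι : Type*} [Fintype ι] {v : ι → ℤ} (hv : v ≠ 0) :
    ∃ (G : ℤ) (u x : ι → ℤ), G ≠ 0 ∧ (∀ i, v i = G * u i) ∧ ∑ i, x i * u i = 1 := by
  obtain ⟨G, hG⟩ := (IsPrincipalIdealRing.principal (Ideal.span (Set.range v))).principal
  have hdvd : ∀ i, ∃ u, v i = G * u := fun i => by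
    have : v i ∈ Ideal.span (Set.range v) := Ideal.subset_span ⟨i, rfl⟩
    rw [hG] at this
    exact Ideal.mem_span_singleton.1 this
  choose u hu using hdvd
  have hmem : G ∈ Ideal.span (Set.range v) := by
    rw [hG]
    exact Submodule.mem_span_singleton_self G
  obtain ⟨x, hx⟩ := Ideal.mem_span_range_iff_exists_fun.1 hmem
  have h0 : G ≠ 0 := by
    rintro rfl
    exact hv (funext fun i => by rw [hu, zero_mul]; rfl)
  refine ⟨G, u, x, h0, hu, mul_left_cancel₀ h0 ?_⟩
  rw [mul_one, Finset.mul_sum]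
  refine Eq.trans (Finset.sum_congr rfl fun i _ => ?_) hx
  rw [hu]
  ring

namespace Matrix

/-- An integral matrix of determinant one which is conjugate to a commuting one. -/
theorem eq_or_mul_eq_one_of_conj {A C g : Matrix (Fin 2) (Fin 2) ℤ} (hA : A.det = 1)
    (hC : C.det = 1) (hg : g.det = 1) (hc : A * C = C * A) (hconj : C * g = g * A) :
    C = A ∨ A * C = 1 := by
  have hgg : g * g.adjugate = 1 := by rw [mul_adjugate, hg, one_smul]
  have hC' : C = g * A * g.adjugate := by rw [← hconj, mul_assoc, hgg, mul_one]
  have htr : C.trace = A.trace := by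
    rw [hC', trace_mul_comm, ← mul_assoc, adjugate_mul, hg, one_smul, one_mul]
  obtain ⟨a, b, c, d, rfl⟩ : ∃ a b c d, A = !![a, b; c, d] := ⟨_, _, _, _, eta_fin_two A⟩
  obtain ⟨a', b', c', d', rfl⟩ : ∃ a b c d, C = !![a, b; c, d] := ⟨_, _, _, _, eta_fin_two C⟩
  obtain ⟨p, q, r, s, rfl⟩ : ∃ a b c d, g = !![a, b; c, d] := ⟨_, _, _, _, eta_fin_two g⟩
  simp only [det_fin_two_of, trace_fin_two_of, adjugate_fin_two_of, mul_fin_two] at *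
  obtain ⟨k1, k2, k3, k4⟩ : _ ∧ _ ∧ _ ∧ _ := by
    simpa only [← Matrix.ext_iff, Fin.forall_fin_two, of_apply, cons_val_zero, cons_val_one, and_assoc]
      using hC'
  obtain ⟨c1, c2, c3, c4⟩ : _ ∧ _ ∧ _ ∧ _ := by
    simpa only [← Matrix.ext_iff, Fin.forall_fin_two, of_apply, cons_val_zero, cons_val_one, and_assoc]
      using hc
  clear hC' hc hconj hgg
  by_cases hv : ![b, c, d - a] = 0
  · have hb : b = 0 := congrFun hv 0
    have hc : c = 0 := congrFun hv 1
    have hd : d = a := sub_eq_zero.1 (congrFun hv 2)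
    subst hb hc hd
    left
    simp only [← Matrix.ext_iff, Fin.forall_fin_two, of_apply, cons_val_zero, cons_val_one]
    exact ⟨⟨by linear_combination k1 + d * hg, by linear_combination k2⟩,
      by linear_combination k3, by linear_combination k4 + d * hg⟩
  obtain ⟨G, u, x, hG, hu, hx⟩ := Int.exists_primitive hv
  rw [Fin.forall_fin_succ, Fin.forall_fin_two] at hu
  rw [Fin.sum_univ_three] at hx
  obtain ⟨u0, u1, u2⟩ : b = G * u 0 ∧ c = G * u 1 ∧ d - a = G * u 2 := hu
  obtain ⟨l, hl⟩ : ∃ l, l = x 0 * b' + x 1 * c' + x 2 * (d' - a') := ⟨_, rfl⟩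
  have p1 : u 0 * c' = b' * u 1 := mul_left_cancel₀ hG <| by
    linear_combination c1 - u0 * c' + u1 * b'
  have p2 : u 0 * (d' - a') = b' * u 2 := mul_left_cancel₀ hG <| by
    linear_combination c2 - u0 * (d' - a') + u2 * b'
  have p3 : c' * u 2 = u 1 * (d' - a') := mul_left_cancel₀ hG <| by
    linear_combination c3 + u1 * (d' - a') - u2 * c'
  have v0 : b' = l * u 0 := by
    linear_combination -b' * hx - u 0 * hl - x 1 * p1 - x 2 * p2
  have v1 : c' = l * u 1 := by
    linear_combination -c' * hx - u 1 * hl + x 0 * p1 + x 2 * p3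
  have v2 : d' - a' = l * u 2 := by
    linear_combination (a' - d') * hx - u 2 * hl + x 0 * p2 - x 1 * p3
  have h1 : G ∣ l := by
    have e0 : b' = G * (p ^ 2 * u 0 - q ^ 2 * u 1 + p * q * u 2) := by
      linear_combination k2 + p ^ 2 * u0 - q ^ 2 * u1 + p * q * u2
    have e1 : c' = G * (s ^ 2 * u 1 - r ^ 2 * u 0 - r * s * u 2) := by
      linear_combination k3 + s ^ 2 * u1 - r ^ 2 * u0 - r * s * u2
    have e2 : d' - a' = G * (2 * p * r * u 0 - 2 * q * s * u 1 + (p * s + q * r) * u 2) := by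
      linear_combination k4 - k1 + 2 * p * r * u0 - 2 * q * s * u1 + (p * s + q * r) * u2
    rw [hl, e0, e1, e2]
    exact dvd_add (dvd_add (Dvd.intro _ rfl |>.mul_left _) (Dvd.intro _ rfl |>.mul_left _))
      (Dvd.intro _ rfl |>.mul_left _)
  have h2 : l ∣ G := by
    have e0 : b = l * (s ^ 2 * u 0 - q ^ 2 * u 1 - s * q * u 2) := by
      linear_combination s ^ 2 * (v0 - k2) - q ^ 2 * (v1 - k3) - s * q * (v2 - k4 + k1) -
        (p * s - q * r + 1) * b * hg
    have e1 : c = l * (p ^ 2 * u 1 - r ^ 2 * u 0 + p * r * u 2) := by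
      linear_combination p ^ 2 * (v1 - k3) - r ^ 2 * (v0 - k2) + p * r * (v2 - k4 + k1) -
        (p * s - q * r + 1) * c * hg
    have e2 : d - a = l * (2 * q * p * u 1 - 2 * s * r * u 0 + (p * s + q * r) * u 2) := by
      linear_combination 2 * q * p * (v1 - k3) - 2 * s * r * (v0 - k2) +
        (p * s + q * r) * (v2 - k4 + k1) - (p * s - q * r + 1) * (d - a) * hg
    have e : G = x 0 * b + x 1 * c + x 2 * (d - a) := by
      linear_combination -G * hx - x 0 * u0 - x 1 * u1 - x 2 * u2
    rw [e]
    exact dvd_add (dvd_add (Dvd.dvd.mul_left ⟨_, e0⟩ _) (Dvd.dvd.mul_left ⟨_, e1⟩ _))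
      (Dvd.dvd.mul_left ⟨_, e2⟩ _)
  simp only [← Matrix.ext_iff, Fin.forall_fin_two, of_apply, cons_val_zero, cons_val_one]
  rcases Int.natAbs_eq_natAbs_iff.1 (Int.natAbs_eq_of_dvd_dvd h2 h1) with h | h
  · subst h
    exact Or.inl ⟨⟨by linarith, by linarith⟩, by linarith, by linarith⟩
  · have eb : b' = -b := by rw [v0, u0, h, neg_mul]
    have ec : c' = -c := by rw [v1, u1, h, neg_mul]
    have ee : d' - a' = -(d - a) := by rw [v2, u2, h, neg_mul]
    obtain rfl : a' = d := by linarith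
    obtain rfl : d' = a := by linarith
    subst eb ec
    exact Or.inr ⟨⟨by simpa [← sub_eq_add_neg] using hA, by simp; ring⟩,
      by simp; ring, by simp; linarith⟩

theorem exists_eq_smul_of_intertwine {M : Matrix (Fin 2) (Fin 2) ℤ} (hM : M ≠ 0)
    (h : ∀ N : Matrix (Fin 2) (Fin 2) ℤ, ∃ N' : Matrix (Fin 2) (Fin 2) ℤ, M * N = N' * M) :
    ∃ (G : ℤ) (U : Matrix (Fin 2) (Fin 2) ℤ), G ≠ 0 ∧ M = G • U ∧ (U.det = 1 ∨ U.det = -1) := by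
  obtain ⟨G, u, x, hG, hu, hx⟩ := Int.exists_primitive
    (v := fun i : Fin 2 × Fin 2 => M i.1 i.2) (fun h0 => hM (Matrix.ext fun i j => congrFun h0 (i, j)))
  let U : Matrix (Fin 2) (Fin 2) ℤ := of fun i j => u (i, j)
  have hU : M = G • U := Matrix.ext fun i j => hu (i, j)
  refine ⟨G, U, hG, hU, Int.isUnit_iff.1 (isUnit_of_dvd_one ?_)⟩
  have key : ∀ i k l j, U.det ∣ U i k * U.adjugate l j := fun i k l j => by
    obtain ⟨N, hN⟩ := h (single k l 1)
    have h1 : U * single k l 1 * U.adjugate = U.det • N := by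
      rw [hU, smul_mul, Matrix.mul_smul] at hN
      rw [smul_right_injective _ hG hN, mul_assoc, mul_adjugate, Matrix.mul_smul, mul_one]
    refine ⟨N i j, ?_⟩
    rw [← smul_eq_mul (U.det), ← smul_apply, ← h1]
    fin_cases k <;> fin_cases l <;> simp [mul_apply, Fin.sum_univ_two, single]
  have key' : ∀ i j, U.det ∣ u i * u j := fun i j => by
    obtain ⟨i1, i2⟩ := i
    obtain ⟨j1, j2⟩ := j
    have := key i1 i2 (j2 + 1) (j1 + 1)
    rw [adjugate_fin_two] at this
    fin_cases j1 <;> fin_cases j2 <;> simpa [U] using this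
  have : (1 : ℤ) = ∑ i, ∑ j, x i * x j * (u i * u j) := by
    rw [← one_mul (1 : ℤ), ← hx, Finset.sum_mul_sum]
    exact Finset.sum_congr rfl fun i _ => Finset.sum_congr rfl fun j _ => by ring
  rw [this]
  exact Finset.dvd_sum fun i _ => Finset.dvd_sum fun j _ => (key' i j).mul_left _

end Matrix

namespace Br

open FreeGroup (of lift₂ lift₂_zero lift₂_one hom_ext₂ mulAut_ext₂ mulAut₂ mulAut₂_apply ab)
open Fr (w artin)

theorem eq_of_commute_of_conj {p g : Br 2} (h : Commute p (g * p * g⁻¹)) (ho : Odd (ex p)) :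
    g * p * g⁻¹ = p := by
  have hdet : ∀ b : Br 2, (rhoMat b).det = 1 := fun b => (rho b).2
  rcases Matrix.eq_or_mul_eq_one_of_conj (hdet p) (hdet (g * p * g⁻¹)) (hdet g)
    (by rw [← map_mul, ← map_mul, h.eq]) (by rw [← map_mul, ← map_mul, inv_mul_cancel_right])
    with e | e
  · obtain ⟨k, hk⟩ := exists_zz_zpow_of_rho_eq_one (b := g * p * g⁻¹ * p⁻¹) (by
      rw [map_mul, map_inv, mul_inv_eq_one, rho_eq_iff, e])
    have := congrArg ex hk
    rw [ex_mul, ex_conj, ex_inv, ex_zpow, ex_zz] at this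
    obtain rfl : k = 0 := by push_cast at this; omega
    rwa [mul_zero, zpow_zero, mul_inv_eq_one] at hk
  · obtain ⟨k, hk⟩ := exists_zz_zpow_of_rho_eq_one (b := p * (g * p * g⁻¹)) (by
      rw [← map_one rho, rho_eq_iff, map_mul, e, map_one])
    have := congrArg ex hk
    rw [ex_mul, ex_conj, ex_zpow, ex_zz] at this
    push_cast at this
    obtain ⟨l, hl⟩ := ho
    omega

theorem exists_conj_sg {m k l : ℕ} (hk : k < m) (hl : l < m) :
    ∃ t : Br m, sg m l = t * sg m k * t⁻¹ := by
  have hs : ∀ k, k + 1 < m → IsConj (sg m k) (sg m (k + 1)) := fun k hk =>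
    isConj_iff.2 ⟨sg m k * sg m (k + 1), by
      rw [mul_inv_eq_iff_eq_mul, sg_braid hk, mul_assoc]⟩
  have h0 : ∀ k, k < m → IsConj (sg m 0) (sg m k) := fun k => by
    induction k with
    | zero => exact fun _ => IsConj.refl _
    | succ k ih => exact fun hk => (ih (by omega)).trans (hs k hk)
  obtain ⟨t, ht⟩ := isConj_iff.1 ((h0 k hk).symm.trans (h0 l hl))
  exact ⟨t, ht.symm⟩

theorem eq_of_commute_incl_zz_zpow {m : ℕ} (hm : 2 ≤ m) {H : Br (m + 1)} {j : ℤ} (hj : j ≠ 0)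
    (h : Commute H (incl m (zz m) ^ j)) :
    ∃ (l : ℤ) (c : Br m), H = zz (m + 1) ^ l * incl m c := by
  have hfix : perm (m + 1) H (m + 1) = m + 1 := by
    by_contra hne
    have hle := perm_apply_le H (le_refl (m + 1))
    obtain ⟨q, hq, hqp⟩ : ∃ q ≤ m, q ≠ perm (m + 1) H (m + 1) := by
      rcases Nat.eq_zero_or_pos (perm (m + 1) H (m + 1)) with h | h
      · exact ⟨1, by omega, by omega⟩
      · exact ⟨0, by omega, by omega⟩
    obtain ⟨i, rfl⟩ := (perm (m + 1) H).surjective q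
    have := cr_conj H (incl m (zz m) ^ j) (by rw [map_zpow, perm_incl, perm_zz, one_zpow]) (m + 1) i
    rw [h.eq, mul_inv_cancel_right, cr_incl_zz_zpow, cr_incl_zz_zpow,
      (cr_gt _ (Nat.lt_succ_self m) i).1, cr_zz (by omega) hq (Ne.symm hqp)] at this
    omega
  obtain ⟨a, c, rfl, -⟩ := exists_toBr hfix
  have ha : artin m (zz m ^ j) a = a := by
    refine (loop_incl_inj (c := zz m ^ j * c) (c' := zz m ^ j * c) ?_).1
    rw [map_mul, ← mul_assoc, ← incl_mul_loopHom, map_zpow, mul_assoc, ← h.eq, mul_assoc,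
      ← map_zpow, ← map_mul, ← map_mul, (commute_zz_zpow c j).eq]
  have hartin : ∀ (k : ℤ) (a : Fr m), artin m (zz m ^ k) a = (w m ^ k)⁻¹ * a * w m ^ k := by
    intro k a
    have : artin m (zz m) = MulAut.conj (w m)⁻¹ := MulEquiv.ext fun a => by
      rw [artin_zz, MulAut.conj_apply, inv_inv]
    rw [map_zpow, this, ← map_zpow, MulAut.conj_apply, inv_zpow, inv_inv]
  rw [hartin, mul_assoc, inv_mul_eq_iff_eq_mul] at ha
  obtain ⟨l, rfl⟩ := mem_zpowers_w hj ha.symm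
  refine ⟨l, zz m ^ (-l) * c, ?_⟩
  have := mul_zz_zpow m 1 (-l)
  rw [map_one, one_mul, one_mul, neg_neg] at this
  rw [← this, map_mul, (commute_zz_zpow _ l).eq, mul_assoc]

theorem retr_zz : retr (zz 3) = zz 2 ^ 2 := by
  have h : retr (zz 3) ∈ Subgroup.center (Br 2) := Subgroup.mem_center_iff.2 fun b => by
    rw [← retr_incl b, ← map_mul, ← map_mul, (commute_zz _).eq]
  rw [center_eq le_rfl] at h
  obtain ⟨k, hk⟩ := h
  have := congrArg ex hk
  change ex (zz 2 ^ k) = _ at this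
  rw [ex_zpow, ex_retr, ex_zz, ex_zz] at this
  obtain rfl : k = 2 := by push_cast at this; omega
  exact hk.symm

theorem kerAct_zz : kerAct (zz 3) = 1 := MulEquiv.ext fun a => kerHom_injective <| by
  rw [← mul_left_inj (zz 3), ← mul_kerHom, MulAut.one_apply, (commute_zz _).eq]

theorem zz_two_eq : zz 2 = (sg 2 0 * sg 2 1) ^ 3 := by
  have h := sg_braid (m := 2) (k := 0) (by omega)
  have h' (x : Br 2) : sg 2 0 * (sg 2 1 * (sg 2 0 * x)) = sg 2 1 * (sg 2 0 * (sg 2 1 * x)) := by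
    rw [← mul_assoc, ← mul_assoc, h]
    simp only [mul_assoc]
  rw [zz_two]
  simp only [pow_succ, pow_zero, one_mul, mul_assoc]
  rw [h' (sg 2 0 * sg 2 1)]

theorem incl_zz_sq :
    incl 2 (zz 2) ^ 2 = kerHom ((of 1)⁻¹ * of 0 * of 1 * (of 0)⁻¹) * zz 3 := by
  obtain ⟨c, hc⟩ := exists_eq_kerHom (b := incl 2 (zz 2) ^ 2 * (zz 3)⁻¹) (by
    rw [map_mul, map_inv, map_pow, retr_incl, retr_zz, mul_inv_cancel])
  rw [← mul_inv_eq_iff_eq_mul, ← hc]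
  congr 1
  apply FreeGroup.eq_of_conj_eq
  rw [← kerAct_kerHom, hc, map_mul, map_inv, kerAct_zz, zz_two_eq, inv_one, mul_one, ← map_pow,
    ← pow_mul]
  have hd : kerAct (incl 2 (sg 2 0 * sg 2 1)) = kerAut₀ * kerAut₁ := by
    rw [map_mul, map_mul, incl_sg (by omega), incl_sg (by omega), kerAct_zero, kerAct_one]
  rw [map_pow, map_pow, hd]
  refine mulAut_ext₂ ?_ ?_ <;>
  simp [pow_succ, MulAut.mul_apply, kerAut₀, kerAut₁, mulAut₂_apply, lift₂_zero, lift₂_one, mul_assoc]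

theorem mulAut_pow_apply {G : Type*} [Group G] {A : MulAut G} {a b : G} (ha : A a = a)
    (hb : A b = b * a) (N : ℕ) : (A ^ N) a = a ∧ (A ^ N) b = b * a ^ N := by
  induction N with
  | zero => simp
  | succ N ih =>
    rw [pow_succ, MulAut.mul_apply, MulAut.mul_apply, ha, hb, map_mul, ih.1, ih.2, pow_succ, mul_assoc]
    exact ⟨rfl, rfl⟩

theorem exists_isConj_kerAct {g : FreeGroup (Fin 2)} (h : ∀ b, IsConj (kerAct b g) g) :
    ∃ k : ℤ, IsConj g (((of 1)⁻¹ * of 0 * of 1 * (of 0)⁻¹) ^ k) := by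
  have h1 (N : ℕ) := mulAut_pow_apply (A := kerAct (sg 3 2)⁻¹) (a := of 0) (b := of 1)
    (by
      rw [map_inv, MulAut.inv_apply, MulEquiv.symm_apply_eq, kerAct_two]
      simp [kerAut₂, mulAut₂_apply, lift₂_zero])
    (by
      rw [map_inv, MulAut.inv_apply, MulEquiv.symm_apply_eq, kerAct_two]
      simp [kerAut₂, mulAut₂_apply, lift₂_zero, lift₂_one]) N
  have h2 (N : ℕ) := mulAut_pow_apply (A := kerAct (sg 3 1 * sg 3 0 * (sg 3 1)⁻¹))
    (a := of 1) (b := of 0)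
    (by
      rw [map_mul, map_mul, map_inv, MulAut.mul_apply]
      have : (kerAct (sg 3 1))⁻¹ (of 1) = of 0 := by
        rw [MulAut.inv_apply, MulEquiv.symm_apply_eq, kerAct_one, kerAut₁, mulAut₂_apply, lift₂_zero]
      rw [this]
      simp [MulAut.mul_apply, kerAct_zero, kerAct_one, kerAut₀, kerAut₁, mulAut₂_apply, lift₂_zero])
    (by
      rw [map_mul, map_mul, map_inv, MulAut.mul_apply]
      have : (kerAct (sg 3 1))⁻¹ (of 0) = of 0 * (of 1)⁻¹ * of 0 := by
        rw [MulAut.inv_apply, MulEquiv.symm_apply_eq, kerAct_one]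
        simp [kerAut₁, mulAut₂_apply, lift₂_zero, lift₂_one, mul_assoc]
      rw [this]
      simp [MulAut.mul_apply, kerAct_zero, kerAct_one, kerAut₀, kerAut₁, mulAut₂_apply, lift₂_zero,
        lift₂_one, mul_assoc]) N
  obtain ⟨k, hk⟩ := FreeGroup.isConj_zpow_commutator (g := g) (x := (0 : Fin 2)) (y := 1) (by decide)
    (by decide)
    (fun N => ⟨(kerAct (sg 3 2)⁻¹ ^ N).toMonoidHom, (h1 N).1, (h1 N).2, by
      rw [← map_pow]; exact h _⟩)
    (fun N => ⟨(kerAct (sg 3 1 * sg 3 0 * (sg 3 1)⁻¹) ^ N).toMonoidHom, (h2 N).1, (h2 N).2, by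
      rw [← map_pow]; exact h _⟩)
  refine ⟨k, hk.trans (isConj_iff.2 ⟨(of 1)⁻¹, ?_⟩)⟩
  rw [← conj_zpow]
  group

theorem eq_of_braid_of_commute {G : Type*} [Group G] {a b u v : G} (h : a * b * a = b * a * b)
    (h' : a * u * (b * v) * (a * u) = b * v * (a * u) * (b * v)) (ha : Commute a u) (ha' : Commute a v)
    (hb : Commute b u) (hb' : Commute b v) (huv : Commute u v) : u = v := by
  rw [hb.symm.mul_mul_mul_comm, (ha.mul_right ha').symm.mul_mul_mul_comm,
    ha'.symm.mul_mul_mul_comm, (hb'.mul_right hb).symm.mul_mul_mul_comm, h, mul_right_inj,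
    huv.eq] at h'
  rw [huv.symm.eq, mul_assoc, mul_assoc, mul_right_inj] at h'
  exact mul_left_cancel h'

theorem pow_two_or_pow_three_eq_one : ∀ π : Equiv.Perm (Fin 4), π ^ 6 = 1 → π ^ 2 = 1 ∨ π ^ 3 = 1 := by
  decide +kernel

set_option maxRecDepth 100000 in
theorem std_of_retr_of_map_zz {f : Br 3 →* Br 3} (hr : ∀ b, retr (f (incl 2 b)) = b)
    (hp : perm 3 (f (sg 3 0)) ≠ perm 3 (f (sg 3 2))) {k : ℤ}
    (hk : f (incl 2 (zz 2) ^ 2) = (incl 2 (zz 2) ^ 2) ^ k * zz 3 ^ (1 - k)) : Std f := by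
  have hk0 : k ≠ 0 := by
    rintro rfl
    rw [zpow_zero, one_mul, sub_zero, zpow_one, zz_two_eq, ← map_pow, ← pow_mul, map_pow, map_pow] at hk
    obtain ⟨t, ht⟩ : ∃ t, t = f (incl 2 (sg 2 0 * sg 2 1)) := ⟨_, rfl⟩
    rw [← ht] at hk
    have hπ : permFin 3 t ^ 6 = 1 := by rw [← map_pow, hk, permFin_eq_one_iff, perm_zz]
    rcases pow_two_or_pow_three_eq_one _ hπ with h | h <;> rw [← map_pow, permFin_eq_one_iff] at h
    · obtain ⟨j, hj⟩ := eq_zz_zpow_of_pow h (l := 3) (by omega) (k := 1)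
        (by rw [← pow_mul, zpow_one, hk])
      have := zz_zpow_inj (m := 3) (by omega) (i := j * 3) (j := 1) (by
        rw [zpow_mul, ← hj, zpow_one, ← hk, pow_mul t 2 3]
        exact zpow_natCast (t ^ 2) 3)
      omega
    · obtain ⟨j, hj⟩ := eq_zz_zpow_of_pow h (l := 2) (by omega) (k := 1)
        (by rw [← pow_mul, zpow_one, hk])
      have := zz_zpow_inj (m := 3) (by omega) (i := j * 2) (j := 1) (by
        rw [zpow_mul, ← hj, zpow_one, ← hk, pow_mul t 3 2]
        exact zpow_natCast (t ^ 3) 2)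
      omega
  obtain ⟨u, hu⟩ : ∃ u : Br 3, u = incl 2 (zz 2) ^ (-2 : ℤ) * zz 3 := ⟨_, rfl⟩
  have hcomm : ∀ b, Commute (incl 2 b) u := fun b => by
    rw [hu]
    exact (((commute_zz b).symm.map (incl 2)).zpow_right _).mul_right (commute_zz _).symm
  have key : ∀ b : Br 2, ∃ l : ℤ, f (incl 2 b) = incl 2 b * u ^ l := fun b => by
    obtain ⟨a, ha⟩ := exists_eq_kerHom_mul (f (incl 2 b))
    rw [hr] at ha
    have h1 : Commute (kerHom a * incl 2 b) ((incl 2 (zz 2) ^ 2) ^ k * zz 3 ^ (1 - k)) := by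
      rw [← ha, ← hk, ← map_pow]
      exact (((commute_zz b).symm.pow_right 2).map (incl 2)).map f
    have h2 : Commute (incl 2 b) ((incl 2 (zz 2) ^ 2) ^ k * zz 3 ^ (1 - k)) :=
      ((((commute_zz b).symm.map (incl 2)).pow_right 2).zpow_right k).mul_right
        (commute_zz_zpow _ _)
    have h3 := h1.mul_left h2.inv_left
    rw [mul_inv_cancel_right] at h3
    have h4 := h3.mul_right (commute_zz_zpow (kerHom a) (1 - k)).inv_right
    rw [mul_inv_cancel_right, ← zpow_natCast, ← zpow_mul] at h4
    obtain ⟨l, c, hc⟩ := eq_of_commute_incl_zz_zpow le_rfl (by omega) h4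
    have h5 := congrArg retr hc
    rw [retr_kerHom, map_mul, retr_incl, map_zpow, retr_zz] at h5
    refine ⟨l, ?_⟩
    have hc' : c = zz 2 ^ (-2 * l) := by
      rw [eq_inv_of_mul_eq_one_right h5.symm, ← zpow_natCast, ← zpow_mul, ← zpow_neg, neg_mul]
      rfl
    have h6 := ((hcomm b).zpow_right l).eq.symm
    rw [hu, (commute_zz _).symm.mul_zpow] at h6
    rw [ha, hc, hc', ← (commute_zz_zpow _ l).eq, map_zpow, zpow_mul, hu, (commute_zz _).symm.mul_zpow]
    exact h6
  obtain ⟨l, hl⟩ := key (sg 2 0)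
  obtain ⟨n, hn⟩ := key (sg 2 1)
  have hln : u ^ l = u ^ n := by
    have h := braid_map f (k := 0) (show 0 + 1 < 3 by omega)
    have h0 := sg_braid (m := 3) (k := 0) (by omega)
    rw [incl_sg (by omega)] at hl hn
    have hc0 : Commute (sg 3 0) u := by rw [← incl_sg (by omega)]; exact hcomm _
    have hc1 : Commute (sg 3 1) u := by rw [← incl_sg (by omega)]; exact hcomm _
    rw [hl, hn] at h
    exact eq_of_braid_of_commute h0 h (hc0.zpow_right _) (hc0.zpow_right _) (hc1.zpow_right _)
      (hc1.zpow_right _) (Commute.refl u |>.zpow_zpow _ _)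
  have hf : ∀ i < 2, f (sg 3 i) = sg 3 i * incl 2 (zz 2) ^ (-2 * l) * zz 3 ^ l := fun i hi => by
    have : f (incl 2 (sg 2 i)) = incl 2 (sg 2 i) * u ^ l := by
      interval_cases i
      · exact hl
      · rw [hln, hn]
    rw [incl_sg hi] at this
    rw [this, hu, (commute_zz _).symm.mul_zpow, zpow_mul, mul_assoc]
  refine std_of_section le_rfl hf ?_
  have h0 : permFin 3 (f (sg 3 0)) = Equiv.swap 0 1 := by
    refine Eq.trans (permFin_eq_iff.2 ?_) (permFin_sg (show 0 < 3 by omega))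
    rw [hf 0 (by omega), map_mul, map_mul, perm_zz_zpow,
      map_zpow, perm_incl, perm_zz, one_zpow, mul_one, mul_one]
  have h1 : permFin 3 (f (sg 3 1)) = Equiv.swap 1 2 := by
    refine Eq.trans (permFin_eq_iff.2 ?_) (permFin_sg (show 1 < 3 by omega))
    rw [hf 1 (by omega), map_mul, map_mul, perm_zz_zpow,
      map_zpow, perm_incl, perm_zz, one_zpow, mul_one, mul_one]
  refine Eq.trans (permFin_eq_iff.1 ?_) (perm_sg (show 2 < 3 by omega))
  rw [permFin_sg (show 2 < 3 by omega)]
  have hp' : permFin 3 (f (sg 3 2)) ≠ Equiv.swap 0 1 := by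
    rw [← h0, ne_eq, permFin_eq_iff]
    exact hp.symm
  have hc := ((commute_sg (m := 3) (i := 0) (j := 2) (Or.inl (by omega))).map f).map (permFin 3)
  have hb := congrArg (permFin 3) (braid_map f (k := 1) (show 1 + 1 < 3 by omega))
  simp only [map_mul] at hb
  rw [h0] at hc
  rw [h1] at hb
  have key : ∀ π : Equiv.Perm (Fin 4), π ≠ Equiv.swap 0 1 →
      Equiv.swap 0 1 * π = π * Equiv.swap 0 1 →
      Equiv.swap 1 2 * π * Equiv.swap 1 2 = π * Equiv.swap 1 2 * π → π = Equiv.swap 2 3 := by decide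
  exact key _ hp' hc.eq hb

end Br

namespace Br

open FreeGroup (of lift₂ lift₂_zero lift₂_one hom_ext₂ mulAut_ext₂ mulAut₂ mulAut₂_apply ab)
open Matrix

theorem std_of_retr {f : Br 3 →* Br 3} (hr : ∀ b, retr (f b) = retr b)
    (hp : perm 3 (f (sg 3 0)) ≠ perm 3 (f (sg 3 2))) : Std f := by
  obtain ⟨g, hg⟩ := exists_eq_kerHom (b := f (incl 2 (zz 2) ^ 2) * (zz 3)⁻¹) (by
    rw [map_mul, hr, map_pow, retr_incl, map_inv, retr_zz, mul_inv_cancel])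
  have hconj : ∀ b, IsConj (kerAct b g) g := fun b => by
    obtain ⟨c, hc⟩ := exists_eq_kerHom_mul b
    obtain ⟨a, ha⟩ := exists_eq_kerHom_mul (f (incl 2 (retr b)))
    rw [hr, retr_incl] at ha
    have h1 : kerAct (f (incl 2 (retr b))) g = g := kerHom_injective <| by
      rw [← mul_left_inj (f (incl 2 (retr b))), ← mul_kerHom, hg]
      exact (((((commute_zz (retr b)).symm.map (incl 2)).pow_right 2).map f).mul_right
        (commute_zz _).symm.inv_right).eq
    rw [ha, map_mul, kerAct_kerHom, MulAut.mul_apply, MulAut.conj_apply] at h1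
    rw [hc, map_mul, kerAct_kerHom, MulAut.mul_apply, MulAut.conj_apply]
    exact (isConj_iff.2 ⟨c, rfl⟩).symm.trans (isConj_iff.2 ⟨a, h1⟩)
  obtain ⟨k, hk⟩ := exists_isConj_kerAct hconj
  obtain ⟨u, hu⟩ := isConj_iff.1 hk
  refine Std.of_conj (kerHom u) (std_of_retr_of_map_zz (k := k) (fun b => ?_) ?_ ?_)
  · change retr (kerHom u * f (incl 2 b) * (kerHom u)⁻¹) = b
    rw [map_mul, map_mul, map_inv, retr_kerHom, hr, retr_incl]
    simp
  · change perm 3 (kerHom u * f (sg 3 0) * (kerHom u)⁻¹) ≠ perm 3 (kerHom u * f (sg 3 2) * (kerHom u)⁻¹)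
    simpa using hp
  · change kerHom u * f (incl 2 (zz 2) ^ 2) * (kerHom u)⁻¹ = _
    rw [eq_mul_inv_iff_mul_eq] at hg
    have h := congrArg kerHom hu
    rw [map_zpow, ← mul_inv_eq_iff_eq_mul.2 incl_zz_sq,
      ((commute_zz (incl 2 (zz 2) ^ 2)).symm.inv_right).mul_zpow, _root_.inv_zpow, map_mul, map_mul,
      map_inv] at h
    rw [← hg, ← mul_assoc, mul_assoc, (commute_zz (kerHom u)⁻¹).eq, ← mul_assoc, h, sub_eq_add_neg,
      _root_.zpow_add, (Commute.refl _ |>.zpow_zpow _ _).eq, _root_.zpow_one, mul_assoc, _root_.zpow_neg]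

theorem std_of_intertwine {f : Br 3 →* Br 3} {U : Matrix (Fin 2) (Fin 2) ℤ} (hU : U.det = 1)
    (h : ∀ b, U * rhoMat b = rhoMat (retr (f (incl 2 b))) * U)
    (h2 : retr (f (sg 3 2)) = retr (f (sg 3 0)))
    (hp : perm 3 (f (sg 3 0)) ≠ perm 3 (f (sg 3 2))) : Std f := by
  obtain ⟨g, hg⟩ := rho_surjective ⟨U, hU⟩
  have hgU : rhoMat g = U := congrArg Subtype.val hg
  have key : ∀ b : Br 2, ∃ k : ℤ, retr (f (incl 2 b)) = g * b * g⁻¹ * zz 2 ^ (2 * k) := fun b => by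
    obtain ⟨k, hk⟩ := exists_zz_zpow_of_rho_eq_one (b := (g * b * g⁻¹)⁻¹ * retr (f (incl 2 b))) (by
      rw [map_mul, map_inv, inv_mul_eq_one, map_mul, map_inv, mul_inv_eq_iff_eq_mul, ← map_mul,
        rho_eq_iff, map_mul rhoMat, map_mul rhoMat, hgU, h])
    exact ⟨k, by rw [← hk, mul_inv_cancel_left]⟩
  obtain ⟨k, hk⟩ := key (sg 2 0)
  obtain ⟨l, hl⟩ := key (sg 2 1)
  obtain rfl : l = k := by
    obtain ⟨t, ht⟩ := exists_conj_sg (m := 2) (k := 0) (l := 1) (by omega) (by omega)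
    have h1 : ex (retr (f (incl 2 (sg 2 1)))) = ex (retr (f (incl 2 (sg 2 0)))) := by
      rw [ht]
      simp only [map_mul, map_inv]
      exact ex_conj _ _
    rw [hk, hl, ex_mul (g * _ * g⁻¹), ex_mul (g * _ * g⁻¹), ex_conj, ex_conj, ex_sg (by omega),
      ex_sg (by omega), ex_zpow, ex_zpow, ex_zz] at h1
    push_cast at h1
    omega
  refine Std.of_conj (incl 2 g⁻¹) (Std.of_twist (-l) (std_of_retr ?_ ?_))
  · have h0 : ∀ b, ex b = 1 → retr (f b) = g * retr b * g⁻¹ * zz 2 ^ (2 * l) →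
        retr (twist ((MulAut.conj (incl 2 g⁻¹)).toMonoidHom.comp f) (-l) b) = retr b := fun b h1 h2 => by
      rw [twist_apply, h1, map_mul, map_zpow, retr_zz]
      change retr (incl 2 g⁻¹ * f b * (incl 2 g⁻¹)⁻¹) * _ = _
      rw [map_mul, map_mul, map_inv retr, retr_incl, h2, ← zpow_natCast, ← _root_.zpow_mul, mul_assoc _ _ g⁻¹⁻¹,
        mul_assoc _ (zz 2 ^ _), ← (commute_zz_zpow g⁻¹⁻¹ _).eq, mul_one, Nat.cast_ofNat, mul_neg,
        _root_.zpow_neg]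
      group
    have h1 : ∀ i < 2, retr (f (sg 3 i)) = g * retr (sg 3 i) * g⁻¹ * zz 2 ^ (2 * l) := fun i hi => by
      rw [← incl_sg hi, retr_incl]
      interval_cases i
      · exact hk
      · exact hl
    refine DFunLike.congr_fun (f := retr.comp _) (g := retr) (hom_ext fun i hi => ?_)
    refine h0 (sg 3 i) (ex_sg hi) ?_
    interval_cases i
    · exact h1 0 (by omega)
    · exact h1 1 (by omega)
    · rw [h2, retr_two, ← retr_zero]
      exact h1 0 (by omega)
  · rw [perm_twist, perm_twist]
    change perm 3 (incl 2 g⁻¹ * f (sg 3 0) * (incl 2 g⁻¹)⁻¹) ≠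
      perm 3 (incl 2 g⁻¹ * f (sg 3 2) * (incl 2 g⁻¹)⁻¹)
    simpa using hp

theorem rhoMat_inv_zero : rhoMat (sg 2 0)⁻¹ = !![1, 1; 0, 1] := by
  rw [rhoMat_apply, map_inv, rho_zero]
  decide

theorem rhoMat_inv_one : rhoMat (sg 2 1)⁻¹ = !![2, 1; -1, 0] := by
  rw [rhoMat_apply, map_inv, rho_one]
  decide

theorem rhoMat_mirror (b : Br 2) :
    rhoMat (mirror 2 b) * !![1, 2; 0, -1] = !![1, 2; 0, -1] * rhoMat b := by
  let S : Subgroup (Br 2) :=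
    { carrier := {b | rhoMat (mirror 2 b) * !![1, 2; 0, -1] = !![1, 2; 0, -1] * rhoMat b}
      one_mem' := by
        change rhoMat (mirror 2 1) * _ = _ * rhoMat 1
        rw [map_one, map_one, one_mul, mul_one]
      mul_mem' := fun {a b} ha hb => by
        change rhoMat (mirror 2 (a * b)) * _ = _ * rhoMat (a * b)
        rw [map_mul, map_mul, map_mul, mul_assoc, show _ = _ from hb, ← mul_assoc,
          show _ = _ from ha, mul_assoc]
      inv_mem' := fun {a} ha => by
        change rhoMat (mirror 2 a⁻¹) * _ = _ * rhoMat a⁻¹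
        have h1 : rhoMat a * rhoMat a⁻¹ = 1 := by rw [← map_mul, mul_inv_cancel, map_one]
        have h2 : rhoMat (mirror 2 a⁻¹) * rhoMat (mirror 2 a) = 1 := by
          rw [← map_mul, ← map_mul, inv_mul_cancel, map_one, map_one]
        have ha' : rhoMat (mirror 2 a) * !![1, 2; 0, -1] = !![1, 2; 0, -1] * rhoMat a := ha
        rw [← mul_one (rhoMat (mirror 2 a⁻¹) * _), ← h1, ← mul_assoc, mul_assoc _ _ (rhoMat a), ← ha',
          ← mul_assoc, h2, one_mul] }
  refine mem_of_sg S (fun k hk => ?_) b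
  change rhoMat (mirror 2 (sg 2 k)) * _ = _ * rhoMat (sg 2 k)
  interval_cases k
  · rw [mirror_sg, rhoMat_inv_zero, rhoMat_zero]
    decide
  · rw [mirror_sg, rhoMat_inv_one, rhoMat_one]
    decide

theorem exists_intertwine {f : Br 3 →* Br 3} (h2 : retr (f (sg 3 2)) = retr (f (sg 3 0)))
    (hp : perm 3 (f (sg 3 0)) ≠ perm 3 (f (sg 3 2))) :
    ∃ U : Matrix (Fin 2) (Fin 2) ℤ, (U.det = 1 ∨ U.det = -1) ∧
      ∀ b, U * rhoMat b = rhoMat (retr (f (incl 2 b))) * U := by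
  have hr : ∀ b, retr (f b) = retr (f (incl 2 (retr b))) := by
    refine DFunLike.congr_fun (f := retr.comp f) (g := retr.comp (f.comp ((incl 2).comp retr)))
      (hom_ext fun i hi => ?_)
    change retr (f _) = retr (f (incl 2 (retr _)))
    interval_cases i
    · rw [retr_zero, incl_sg (by omega)]
    · rw [retr_one, incl_sg (by omega)]
    · rw [retr_two, incl_sg (by omega), h2]
  have hφ : ∀ a, ∃ a', kerHom a' = f (kerHom a) := fun a =>
    exists_eq_kerHom (by rw [hr, retr_kerHom, map_one, map_one, map_one])
  choose φ hφ using hφ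
  let φ' : FreeGroup (Fin 2) →* FreeGroup (Fin 2) := MonoidHom.mk' φ fun a b => kerHom_injective <| by
    rw [hφ, map_mul, map_mul, map_mul, hφ, hφ]
  have hφ' : ∀ b a, φ' (kerAct b a) = kerAct (f b) (φ' a) := fun b a => kerHom_injective <| by
    rw [← mul_left_inj (f b), ← mul_kerHom]
    change kerHom (φ _) * _ = _ * kerHom (φ _)
    rw [hφ, hφ, ← map_mul, ← mul_kerHom, map_mul]
  let M : Matrix (Fin 2) (Fin 2) ℤ := Matrix.of fun i j => ab (φ' (of j)) i
  have hM : ∀ a, ab (φ' a) = M *ᵥ ab a := by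
    refine DFunLike.congr_fun (f := FreeGroup.abHom.comp φ')
      (g := (Matrix.mulVecLin M).toAddMonoidHom.toMultiplicative.comp FreeGroup.abHom)
      (hom_ext₂ ?_ ?_)
    · change ab (φ' (of 0)) = M *ᵥ ab (of 0)
      rw [FreeGroup.ab_zero]
      ext i
      simp [M, mulVec, dotProduct]
    · change ab (φ' (of 1)) = M *ᵥ ab (of 1)
      rw [FreeGroup.ab_one]
      ext i
      simp [M, mulVec, dotProduct]
  have hMr : ∀ b, M * rhoMat b = rhoMat (retr (f (incl 2 b))) * M := fun b => by
    have : ∀ a, (M * rhoMat b) *ᵥ ab a = (rhoMat (retr (f (incl 2 b))) * M) *ᵥ ab a := fun a => by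
      rw [← mulVec_mulVec, ← mulVec_mulVec, ← hM, ← ab_kerAct, ← hφ', hM, ab_kerAct, retr_incl]
    have h0 := this (of 0)
    have h1 := this (of 1)
    rw [FreeGroup.ab_zero] at h0
    rw [FreeGroup.ab_one] at h1
    ext i j
    have h0' := congrFun h0 i
    have h1' := congrFun h1 i
    simp only [mulVec, dotProduct, Fin.sum_univ_two] at h0' h1'
    fin_cases j
    · simpa using h0'
    · simpa using h1'
  have hM0 : M ≠ 0 := fun h0 => hp <| by
    have h1 : ab (φ' (of 0)) = 0 := by rw [hM, h0, zero_mulVec]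
    have h2 := perm_kerHom_of_ab h1
    change perm 3 (kerHom (φ (of 0))) = 1 at h2
    rw [hφ, kerHom, lift₂_zero, map_mul, map_inv, map_mul, map_inv, mul_inv_eq_one] at h2
    exact h2.symm
  let R : Subring (Matrix (Fin 2) (Fin 2) ℤ) :=
    { carrier := {N | ∃ N', M * N = N' * M}
      zero_mem' := ⟨0, by simp⟩
      one_mem' := ⟨1, by simp⟩
      add_mem' := by
        rintro N P ⟨N', hN⟩ ⟨P', hP⟩
        exact ⟨N' + P', by rw [mul_add, hN, hP, add_mul]⟩
      mul_mem' := by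
        rintro N P ⟨N', hN⟩ ⟨P', hP⟩
        exact ⟨N' * P', by rw [← mul_assoc, hN, mul_assoc, hP, mul_assoc]⟩
      neg_mem' := by
        rintro N ⟨N', hN⟩
        exact ⟨-N', by rw [mul_neg, hN, neg_mul]⟩ }
  have hR : ∀ b, rhoMat b ∈ R := fun b => ⟨_, hMr b⟩
  have e1 : !![0, 1; 0, 0] ∈ R := by
    have := R.sub_mem R.one_mem (hR (sg 2 0))
    rw [rhoMat_zero] at this
    convert this using 1
    decide
  have e2 : !![0, 0; 1, 0] ∈ R := by
    have := R.sub_mem (R.mul_mem (R.mul_mem (hR (sg 2 0)⁻¹) (hR (sg 2 1))) (hR (sg 2 0))) R.one_mem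
    rw [rhoMat_zero, rhoMat_one, rhoMat_inv_zero] at this
    convert this using 1
    decide
  have hall : ∀ N, N ∈ R := fun N => by
    have := R.add_mem (R.add_mem (R.zsmul_mem (R.mul_mem e1 e2) (N 0 0)) (R.zsmul_mem e1 (N 0 1)))
      (R.add_mem (R.zsmul_mem e2 (N 1 0)) (R.zsmul_mem (R.mul_mem e2 e1) (N 1 1)))
    convert this using 1
    ext i j
    fin_cases i <;> fin_cases j <;> simp
  obtain ⟨G, U, hG, hMU, hU⟩ := exists_eq_smul_of_intertwine hM0 hall
  refine ⟨U, hU, fun b => smul_right_injective _ hG ?_⟩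
  have := hMr b
  rw [hMU, smul_mul, Matrix.mul_smul] at this
  exact this

/-- Endomorphisms of the braid group on four strands. -/
theorem std_three {f : Br 3 →* Br 3} (ho : Odd (ex (f (sg 3 0))))
    (hp : perm 3 (f (sg 3 0)) ≠ perm 3 (f (sg 3 2))) : Std f := by
  have h2 : retr (f (sg 3 2)) = retr (f (sg 3 0)) := by
    obtain ⟨t, ht⟩ := exists_conj_sg (m := 3) (k := 0) (l := 2) (by omega) (by omega)
    have hc := ((commute_sg (m := 3) (i := 0) (j := 2) (Or.inl (by omega))).map f).map retr
    rw [ht, map_mul, map_mul, map_inv, map_mul, map_mul, map_inv] at hc ⊢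
    exact eq_of_commute_of_conj hc (by rwa [ex_retr])
  obtain ⟨U, hU | hU, h⟩ := exists_intertwine h2 hp
  · exact std_of_intertwine hU h h2 hp
  · refine Std.of_mirror (std_of_intertwine (U := U * !![1, 2; 0, -1]) ?_ (fun b => ?_) ?_ ?_)
    · rw [det_mul, hU, det_fin_two_of]
      norm_num
    · have : mirror 3 (incl 2 b) = incl 2 (mirror 2 b) := by
        refine DFunLike.congr_fun (f := (mirror 3).comp (incl 2)) (g := (incl 2).comp (mirror 2))
          (hom_ext fun i hi => ?_) b
        change mirror 3 (incl 2 (sg 2 i)) = incl 2 (mirror 2 (sg 2 i))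
        rw [incl_sg hi, mirror_sg, mirror_sg, map_inv, incl_sg hi]
      rw [MonoidHom.comp_apply, this, mul_assoc, ← rhoMat_mirror, ← mul_assoc, h, mul_assoc]
    · rw [MonoidHom.comp_apply, MonoidHom.comp_apply, mirror_sg, mirror_sg, map_inv, map_inv, map_inv,
        map_inv, h2]
    · rw [MonoidHom.comp_apply, MonoidHom.comp_apply, mirror_sg, mirror_sg, map_inv, map_inv, map_inv,
        map_inv]
      exact fun e => hp (inv_injective e)

end Br

namespace Br

/-- The shift of the generators by `d`. -/
def shift (m d : ℕ) : Br m →* Br (m + d) :=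
  lift (fun k => sg (m + d) (k + d))
    (fun k hk => by
      rw [show k + 1 + d = k + d + 1 by omega]
      exact sg_braid (by omega))
    (fun i j h hj => sg_comm (by omega))

theorem shift_sg {m d k : ℕ} (hk : k < m) : shift m d (sg m k) = sg (m + d) (k + d) :=
  lift_sg _ _ _ hk

/-- The product of all the generators, in increasing order. -/
def del : (m : ℕ) → Br m
  | 0 => 1
  | m + 1 => incl m (del m) * sg (m + 1) m

theorem ex_del (m : ℕ) : ex (del m) = m := by
  induction m with
  | zero => exact ex_one
  | succ m ih => rw [del, ex_mul, ex_incl, ih, ex_sg (by omega)]; push_cast; ring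

theorem shift_incl {m : ℕ} (b : Br m) : shift (m + 1) 1 (incl m b) = incl (m + 1) (shift m 1 b) := by
  refine DFunLike.congr_fun (f := (shift (m + 1) 1).comp (incl m))
    (g := (incl (m + 1)).comp (shift m 1)) (hom_ext fun k hk => ?_) b
  change shift (m + 1) 1 (incl m (sg m k)) = incl (m + 1) (shift m 1 (sg m k))
  rw [incl_sg hk, shift_sg (by omega), shift_sg hk, incl_sg (by omega)]

theorem del_succ' (m : ℕ) : del (m + 1) = sg (m + 1) 0 * shift m 1 (del m) := by
  induction m with
  | zero => simp [del]
  | succ m ih =>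
    rw [del, ih, map_mul, incl_sg (by omega), ← shift_incl, mul_assoc, ← shift_sg (by omega),
      ← map_mul, ← del, ih]

theorem del_mul_sg {m k : ℕ} (hk : k + 1 < m) : del m * sg m k = sg m (k + 1) * del m := by
  induction m with
  | zero => omega
  | succ m ih =>
    rcases Nat.lt_succ_iff_lt_or_eq.1 hk with hk | rfl
    · rw [del, mul_assoc, ← sg_comm (by omega), ← incl_sg (by omega), ← mul_assoc, ← map_mul, ih hk,
        map_mul, incl_sg hk, mul_assoc]
    · rw [del, del, map_mul, incl_sg (by omega), mul_assoc, mul_assoc, mul_assoc, ← mul_assoc (sg _ k),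
        sg_braid (by omega), ← mul_assoc, ← mul_assoc, ← (commute_incl_incl (del k)).eq]
      simp only [mul_assoc]

theorem shift_mul_del {m : ℕ} (b : Br m) : shift m 1 b * del (m + 1) = del (m + 1) * incl m b := by
  rw [← eq_mul_inv_iff_mul_eq]
  refine DFunLike.congr_fun (f := shift m 1)
    (g := (MulAut.conj (del (m + 1))).toMonoidHom.comp (incl m)) (hom_ext fun k hk => ?_) b
  change _ = del (m + 1) * incl m (sg m k) * (del (m + 1))⁻¹
  rw [shift_sg hk, incl_sg hk, eq_mul_inv_iff_mul_eq, del_mul_sg (by omega)]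

theorem del_sq_mul_sg (m : ℕ) : del (m + 1) ^ 2 * sg (m + 1) m = sg (m + 1) 0 * del (m + 1) ^ 2 := by
  have h : del (m + 1) ^ 2 = shift m 1 (del m) * del (m + 1) * sg (m + 1) m := by
    rw [shift_mul_del, mul_assoc, pow_two]
    rfl
  conv_rhs => rw [h, ← mul_assoc, ← mul_assoc, ← del_succ', ← pow_two]

theorem del_pow_mul_sg {m k : ℕ} (hk : k < m) : del m ^ k * sg m 0 = sg m k * del m ^ k := by
  induction k with
  | zero => rw [pow_zero, one_mul, mul_one]
  | succ k ih => rw [pow_succ', mul_assoc, ih (by omega), ← mul_assoc, del_mul_sg hk, mul_assoc]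

theorem del_pow {m : ℕ} (hm : 2 ≤ m) : del m ^ (m + 1) = zz m := by
  obtain ⟨m, rfl⟩ : ∃ k, m = k + 1 := ⟨m - 1, by omega⟩
  have h0 : Commute (del (m + 1) ^ (m + 2)) (sg (m + 1) 0) := by
    change _ * _ = _ * _
    rw [add_comm m 2, pow_add, mul_assoc, del_pow_mul_sg (by omega), ← mul_assoc, del_sq_mul_sg,
      mul_assoc]
  have h : ∀ b, Commute (del (m + 1) ^ (m + 2)) b := commute_of_sg fun k hk => by
    rw [eq_mul_inv_of_mul_eq (del_pow_mul_sg hk).symm]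
    exact (((Commute.refl _).pow_pow _ _).mul_right h0).mul_right
      ((Commute.refl _).pow_pow _ _).inv_right
  have hc : del (m + 1) ^ (m + 2) ∈ Subgroup.center (Br (m + 1)) :=
    Subgroup.mem_center_iff.2 fun b => (h b).eq.symm
  rw [center_eq hm, Subgroup.mem_zpowers_iff] at hc
  obtain ⟨k, hk⟩ := hc
  have he := congrArg ex hk
  rw [ex_zpow, ex_zz, ex_pow, ex_del] at he
  push_cast at he
  obtain rfl : k = 1 := by
    refine mul_right_cancel₀ (b := ((m : ℤ) + 1) * (m + 1 + 1)) (by positivity) ?_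
    linarith
  rw [← hk, zpow_one]

theorem sign_permFin {m : ℕ} (b : Br m) : Equiv.Perm.sign (permFin m b) = (-1) ^ ex b := by
  refine DFunLike.congr_fun (f := Equiv.Perm.sign.comp (permFin m))
    (g := (zpowersHom ℤˣ (-1)).comp (expo m)) (hom_ext fun k hk => ?_) b
  change Equiv.Perm.sign (permFin m (sg m k)) = (-1) ^ ex (sg m k)
  rw [permFin_sg hk, ex_sg hk, zpow_one, Equiv.Perm.sign_swap (by simp)]

theorem odd_ex_iff {m : ℕ} {b : Br m} : Odd (ex b) ↔ Equiv.Perm.sign (permFin m b) = -1 := by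
  rw [sign_permFin]
  rcases Int.even_or_odd (ex b) with h | h
  · rw [h.neg_one_zpow, ← Int.not_even_iff_odd]
    simp [h]
  · rw [h.neg_one_zpow]
    simp [h]

theorem std_of_perm {m : ℕ} (hm : 3 ≤ m) (f : Br m →* Br m)
    (hf : ∀ i < m, perm m (f (sg m i)) = perm m (sg m i)) : Std f := by
  induction m, hm using Nat.le_induction with
  | base =>
    refine std_three ?_ ?_
    · rw [odd_ex_iff, permFin_eq_iff.2 (hf 0 (by omega)), permFin_sg (by omega),
        Equiv.Perm.sign_swap (by simp)]
    · rw [hf 0 (by omega), hf 2 (by omega), Ne, ← permFin_eq_iff, permFin_sg (show 0 < 3 by omega),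
        permFin_sg (show 2 < 3 by omega)]
      decide
  | succ m hm ih => exact std_succ (by omega) ih hf

theorem permFin_surjective (m : ℕ) : Function.Surjective (permFin m) := by
  rw [← MonoidHom.mrange_eq_top, ← top_le_iff, ← Equiv.Perm.mclosure_swap_castSucc_succ,
    Submonoid.closure_le]
  rintro _ ⟨i, rfl⟩
  exact ⟨sg m i, permFin_sg i.2⟩

end Br

namespace Equiv.Perm

variable {α : Type*} [DecidableEq α] {s t : Perm α}

theorem IsSwap.eq_swap_of_ne (hs : s.IsSwap) {x : α} (hx : s x ≠ x) : s = Equiv.swap x (s x) := by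
  obtain ⟨a, b, hab, rfl⟩ := hs
  rcases eq_or_ne x a with rfl | ha
  · rw [Equiv.swap_apply_left]
  rcases eq_or_ne x b with rfl | hb
  · rw [Equiv.swap_apply_right, Equiv.swap_comm]
  · exact absurd (Equiv.swap_apply_of_ne_of_ne ha hb) hx

theorem IsSwap.apply_eq_of_commute (hs : s.IsSwap) (ht : t.IsSwap) (h : Commute s t) (hst : s ≠ t)
    {x : α} (hx : s x ≠ x) : t x = x := by
  by_contra hx'
  have h1 : s (t x) = t (s x) := DFunLike.congr_fun h.eq x
  by_cases h2 : t x = s x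
  · rw [hs.eq_swap_of_ne hx, ht.eq_swap_of_ne hx', h2] at hst
    exact hst rfl
  · rw [hs.eq_swap_of_ne hx, Equiv.swap_apply_of_ne_of_ne hx' h2, ← hs.eq_swap_of_ne hx] at h1
    exact hx (t.injective h1).symm

end Equiv.Perm

namespace Br

open Equiv Equiv.Perm

/-- Distinct transpositions satisfying the braid relations form a chain. -/
theorem exists_chain {α : Type*} [DecidableEq α] {m : ℕ} (hm : 2 ≤ m) (f : Br m →* Perm α)
    (hs : ∀ i < m, (f (sg m i)).IsSwap) (hne : ∀ i j, i < j → j < m → f (sg m i) ≠ f (sg m j)) :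
    ∃ v : ℕ → α, (∀ i j, i < j → j ≤ m → v i ≠ v j) ∧
      ∀ i < m, f (sg m i) = swap (v i) (v (i + 1)) := by
  obtain ⟨x, hx0, hx1⟩ : ∃ x, f (sg m 0) x ≠ x ∧ f (sg m 1) x = x := by
    by_contra! h
    obtain ⟨a, b, hab, h0⟩ := hs 0 (by omega)
    have ha := h a (by rw [h0, swap_apply_left]; exact hab.symm)
    have hb := h b (by rw [h0, swap_apply_right]; exact hab)
    rw [(hs 1 (by omega)).eq_swap_of_ne ha] at hb
    have hb' : b = f (sg m 1) a := by
      by_contra hb'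
      exact hb (swap_apply_of_ne_of_ne hab.symm hb')
    exact hne 0 1 (by omega) (by omega) (by rw [h0, (hs 1 (by omega)).eq_swap_of_ne ha, hb'])
  let v : ℕ → α := fun i => Nat.rec x (fun i y => f (sg m i) y) i
  have hv : ∀ i, v (i + 1) = f (sg m i) (v i) := fun i => rfl
  have key : ∀ i < m, f (sg m i) (v i) ≠ v i ∧ (i + 1 < m → f (sg m (i + 1)) (v i) = v i) := by
    intro i
    induction i with
    | zero => exact fun _ => ⟨hx0, fun _ => hx1⟩
    | succ i ih =>
      intro hi
      obtain ⟨h1, h2⟩ := ih (by omega)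
      have h3 : f (sg m i) (v (i + 1)) ≠ v (i + 1) := fun h => h1 ((f (sg m i)).injective h)
      refine ⟨fun h => hne i (i + 1) (by omega) hi (eq_of_commute_of_braid (braid_map f hi) ?_),
        fun hi' => (hs i (by omega)).apply_eq_of_commute (hs (i + 2) hi')
          ((commute_sg (Or.inl le_rfl)).map f) (hne i (i + 2) (by omega) hi') h3⟩
      rw [(hs i (by omega)).eq_swap_of_ne h1, ← hv, commute_iff_eq, Equiv.mul_swap_eq_swap_mul, h,
        h2 hi]
  have hw : ∀ i < m, f (sg m i) = swap (v i) (v (i + 1)) := fun i hi =>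
    (hs i hi).eq_swap_of_ne (key i hi).1
  refine ⟨v, fun i j hij hj h => ?_, hw⟩
  obtain ⟨j, rfl⟩ : ∃ k, j = k + 1 := ⟨j - 1, by omega⟩
  have hj' : f (sg m j) (v (j + 1)) ≠ v (j + 1) := fun h =>
    (key j (by omega)).1 ((f (sg m j)).injective h)
  rcases Nat.lt_succ_iff_lt_or_eq.1 hij with hij | rfl
  · rcases Nat.lt_or_ge (i + 1) j with hij' | hij'
    · refine hj' ?_
      rw [← h]
      exact (hs i (by omega)).apply_eq_of_commute (hs j (by omega)) ((commute_sg (Or.inl hij')).map f)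
        (hne i j hij (by omega)) (key i (by omega)).1
    · obtain rfl : j = i + 1 := by omega
      refine hj' ?_
      rw [← h]
      exact (key i (by omega)).2 (by omega)
  · exact (key i (by omega)).1 h.symm

theorem std_of_isSwap {m : ℕ} (hm : 3 ≤ m) {f : Br m →* Br m}
    (hs : (permFin m (f (sg m 0))).IsSwap)
    (hne : ∀ i j, i < j → j < m → permFin m (f (sg m i)) ≠ permFin m (f (sg m j))) : Std f := by
  obtain ⟨v, hv, hf⟩ := exists_chain (by omega) ((permFin m).comp f) (fun i hi => by
    obtain ⟨t, ht⟩ := exists_conj_sg (m := m) (k := 0) (by omega) hi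
    obtain ⟨a, b, hab, h⟩ := hs
    refine ⟨permFin m (f t) a, permFin m (f t) b, fun e => hab (Equiv.injective _ e), ?_⟩
    rw [ht, map_mul, map_mul, map_inv, MonoidHom.comp_apply, MonoidHom.comp_apply, h,
      swap_apply_apply]) hne
  have hv' : Function.Injective fun i : Fin (m + 1) => v i := fun i j hij => by
    by_contra h
    rcases lt_or_gt_of_ne h with h | h
    · exact hv i j h (Nat.le_of_lt_succ j.2) hij
    · exact hv j i h (Nat.le_of_lt_succ i.2) hij.symm
  obtain ⟨g, hg⟩ := permFin_surjective m (Equiv.ofBijective _ (Finite.injective_iff_bijective.1 hv'))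
  refine Std.of_conj g⁻¹ (std_of_perm hm _ fun i hi => permFin_eq_iff.1 ?_)
  change permFin m (g⁻¹ * f (sg m i) * g⁻¹⁻¹) = _
  rw [inv_inv, map_mul, map_mul, map_inv, mul_assoc, inv_mul_eq_iff_eq_mul, permFin_sg hi,
    Equiv.mul_swap_eq_swap_mul, hg]
  congr 1
  exact hf i hi

end Br

namespace Equiv.Perm

variable {α : Type*} [Fintype α] [DecidableEq α]

open OnCycleFactors in
theorem commute_of_mem_ker_toPermHom {g : Perm α} {p q : Subgroup.centralizer {g}}
    (hp : toPermHom g p = 1) (hq : toPermHom g q = 1)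
    (h : ∀ x, g x = x → p.1 (q.1 x) = q.1 (p.1 x)) : Commute p.1 q.1 := by
  have hp' : p.1 ∈ (kerParam g).range := by
    rw [kerParam_range_eq]
    exact ⟨p, hp, rfl⟩
  have hq' : q.1 ∈ (kerParam g).range := by
    rw [kerParam_range_eq]
    exact ⟨q, hq, rfl⟩
  obtain ⟨⟨a, a'⟩, ha⟩ := hp'
  obtain ⟨⟨b, b'⟩, hb⟩ := hq'
  rw [← ha, ← hb]
  refine Commute.map ?_ (kerParam g)
  have hx : ∀ (u : Perm (Function.fixedPoints g)) v (x : Function.fixedPoints g),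
      kerParam g (u, v) x = u x := fun u v x => by
    rw [kerParam_apply, dif_neg, ofSubtype_apply_coe]
    rw [cycleOf_mem_cycleFactorsFinset_iff, notMem_support]
    exact x.2
  refine Prod.ext (Equiv.ext fun x => Subtype.ext ?_)
    (funext fun c => IsMulCommutative.is_comm.comm (a' c) (b' c))
  have := h x x.2
  rwa [← ha, ← hb, hx, hx, hx, hx] at this

theorem card_cycleFactorsFinset_mul_two_le (g : Perm α) :
    g.cycleFactorsFinset.card * 2 ≤ g.support.card := by
  rw [← sum_cycleType]
  have := Multiset.card_nsmul_le_sum (s := g.cycleType) (a := 2) fun x hx => two_le_of_mem_cycleType hx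
  rwa [cycleType_def, Multiset.card_map, smul_eq_mul] at this

theorem card_fixedPoints_add_card_support (g : Perm α) :
    Fintype.card (Function.fixedPoints g) + g.support.card = Fintype.card α := by
  rw [card_fixedPoints, sum_cycleType, Nat.sub_add_cancel (Finset.card_le_univ _)]

theorem three_le_card_support {g : Perm α} (h1 : g ≠ 1) (hs : ¬ g.IsSwap) : 3 ≤ g.support.card := by
  have h := two_le_card_support_of_ne_one h1
  have h2 := card_support_eq_two (f := g)
  rcases h.lt_or_eq with h | h
  · exact h
  · exact absurd (h2.1 h.symm) hs

end Equiv.Perm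

namespace Br

open Equiv Equiv.Perm

theorem exists_perm_hom {α : Type*} [Finite α] {n : ℕ} (h : Nat.card α ≤ n) :
    ∃ f : Perm α →* Perm (Fin n), Function.Injective f := by
  obtain ⟨e⟩ : Nonempty (α ↪ Fin n) := by
    have := Fintype.ofFinite α
    rw [Function.Embedding.nonempty_iff_card_le, Fintype.card_fin, ← Nat.card_eq_fintype_card]
    exact h
  exact ⟨viaEmbeddingHom e, viaEmbeddingHom_injective e⟩

theorem map_eq_of_card_le_two {α : Type*} [Finite α] (h : Nat.card α ≤ 2) {m : ℕ} (hm : 2 ≤ m)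
    (f : Br m →* Perm α) : f (sg m 0) = f (sg m 1) := by
  obtain ⟨e, he⟩ := exists_perm_hom h
  refine eq_of_commute_of_braid (braid_map f (by omega)) (he ?_)
  rw [map_mul, map_mul]
  generalize e (f (sg m 0)) = a
  generalize e (f (sg m 1)) = b
  revert a b
  decide

theorem commute_of_card_le_three {α : Type*} [Finite α] (h : Nat.card α ≤ 3) {m : ℕ} (hm : 3 ≤ m)
    (f : Br m →* Perm α) :
    Commute (f (sg m 1) * (f (sg m 0))⁻¹) (f (sg m 2) * (f (sg m 0))⁻¹) := by
  obtain ⟨e, he⟩ := exists_perm_hom h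
  obtain ⟨s, hs⟩ := exists_conj_sg (m := m) (k := 0) (l := 1) (by omega) (by omega)
  obtain ⟨t, ht⟩ := exists_conj_sg (m := m) (k := 0) (l := 2) (by omega) (by omega)
  refine he ?_
  rw [hs, ht]
  simp only [map_mul, map_inv]
  generalize e (f (sg m 0)) = a
  generalize e (f s) = b
  generalize e (f t) = c
  revert a b c
  decide +kernel

theorem map_eq_of_card_le_four {α : Type*} [Finite α] (h : Nat.card α ≤ 4) {m : ℕ} (hm : 4 ≤ m)
    (f : Br m →* Perm α) : f (sg m 0) = f (sg m 1) := by
  obtain ⟨e, he⟩ := exists_perm_hom h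
  let V : Subgroup (Perm (Fin 4)) :=
    { carrier := {a | a * a = 1 ∧ sign a = 1}
      one_mem' := by decide
      mul_mem' := by decide +kernel
      inv_mem' := by decide }
  have hV : ∀ a, a ∈ V ↔ a * a = 1 ∧ sign a = 1 := fun a => Iff.rfl
  let K := (expo m).ker.map (e.comp f)
  have hK : K ≤ ⁅K, K⁆ := by
    rw [← Subgroup.map_commutator]
    exact Subgroup.map_mono (ker_expo_perfect hm)
  have h1 : K ≤ (sign : Perm (Fin 4) →* ℤˣ).ker := hK.trans <| Subgroup.commutator_le.2
    fun a _ b _ => by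
      rw [MonoidHom.mem_ker, map_commutatorElement, commutatorElement_eq_one_iff_mul_comm, mul_comm]
  have h2 : K ≤ V := hK.trans <| Subgroup.commutator_le.2 fun a ha' b hb' => by
    have ha := h1 ha'
    have hb := h1 hb'
    rw [MonoidHom.mem_ker] at ha hb
    rw [hV, commutatorElement_def]
    clear * - ha hb
    revert a b
    decide +kernel
  have h3 : K ≤ ⊥ := hK.trans <| Subgroup.commutator_le.2 fun a ha' b hb' => by
    have ha := h2 ha'
    have hb := h2 hb'
    rw [hV] at ha hb
    rw [Subgroup.mem_bot, commutatorElement_def]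
    clear * - ha hb
    revert a b
    decide +kernel
  have : e (f (sg m 0 * (sg m 1)⁻¹)) = 1 := Subgroup.mem_bot.1 <| h3
    ⟨_, by
      rw [SetLike.mem_coe, MonoidHom.mem_ker, map_mul, map_inv, expo_sg (by omega), expo_sg (by omega),
        mul_inv_cancel], rfl⟩
  rw [map_eq_one_iff e he, map_mul, map_inv, mul_inv_eq_one] at this
  exact this

/-- The braids on the last strands act on the cycles and on the fixed points of the image of the
first generator. -/
theorem map_eq_of_centralizer {α : Type*} [Fintype α] [DecidableEq α] {k : ℕ} (hk : 3 ≤ k)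
    (f : Br (k + 2) →* Perm α)
    (hC : ∀ h : Br k →* Perm (f (sg (k + 2) 0)).cycleFactorsFinset, h (sg k 0) = h (sg k 1))
    (hF : ∀ h : Br k →* Perm (Function.fixedPoints (f (sg (k + 2) 0))),
      Commute (h (sg k 1) * (h (sg k 0))⁻¹) (h (sg k 2) * (h (sg k 0))⁻¹)) :
    f (sg (k + 2) 0) = f (sg (k + 2) 1) := by
  let s := f (sg (k + 2) 0)
  have hcomm : ∀ b, f (shift k 2 b) ∈ Subgroup.centralizer {s} := fun b => by
    refine mem_of_sg ((Subgroup.centralizer {s}).comap (f.comp (shift k 2))) (fun i hi => ?_) b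
    change f (shift k 2 (sg k i)) ∈ Subgroup.centralizer {f (sg (k + 2) 0)}
    rw [shift_sg hi, Subgroup.mem_centralizer_singleton_iff]
    exact ((commute_sg (Or.inr (by omega))).map f).eq
  let g : Br k →* Subgroup.centralizer {s} := (f.comp (shift k 2)).codRestrict _ hcomm
  have hg : ∀ b, (g b).1 = f (shift k 2 b) := fun b => rfl
  have hfix : ∀ b x, s ((g b).1 x) = (g b).1 x ↔ s x = x := fun b x => by
    have := DFunLike.congr_fun (Subgroup.mem_centralizer_singleton_iff.1 (g b).2) x
    rw [mul_apply, mul_apply] at this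
    rw [← this, (g b).1.injective.eq_iff]
  let h : Br k →* Perm (Function.fixedPoints s) :=
    MonoidHom.mk' (fun b => (g b).1.subtypePerm (hfix b)) fun a b =>
      Equiv.ext fun x => Subtype.ext <| by
        change (g (a * b)).1 x = (g a).1 ((g b).1 x)
        rw [map_mul]
        rfl
  have hcyc : ∀ i < k, OnCycleFactors.toPermHom s (g (sg k i * (sg k 0)⁻¹)) = 1 := fun i hi => by
    rw [map_mul, map_mul, map_inv, map_inv, mul_inv_eq_one]
    exact map_eq_of_adjacent ((OnCycleFactors.toPermHom s).comp g) (by omega) (hC _) hi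
  have := commute_of_mem_ker_toPermHom (hcyc 1 (by omega)) (hcyc 2 (by omega)) fun x hx => by
    have := congrArg Subtype.val (DFunLike.congr_fun (hF h).eq ⟨x, hx⟩)
    rw [← map_inv, ← map_mul, ← map_mul] at this
    exact this
  rw [hg, hg, map_mul, map_mul, map_mul, map_mul, map_inv, map_inv, shift_sg (by omega),
    shift_sg (by omega), shift_sg (by omega)] at this
  have h24 : f (sg (k + 2) 2) = f (sg (k + 2) 4) := eq_of_metabelian (braid_map f (by omega))
    (braid_map f (by omega)) ((commute_sg (Or.inl le_rfl)).map f) this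
  rw [map_eq_of_skip (by omega) f (k := 2) (by omega) h24 (i := 0) (by omega),
    map_eq_of_skip (by omega) f (k := 2) (by omega) h24 (i := 1) (by omega)]

end Br

namespace Br

open Equiv Equiv.Perm

theorem map_eq_of_map_eq {G : Type*} [Group G] {m : ℕ} (hm : 4 ≤ m) (f : Br m →* G) {i j : ℕ}
    (hij : i < j) (hj : j < m) (h : f (sg m i) = f (sg m j)) : f (sg m 0) = f (sg m 1) := by
  have key : ∀ {k}, k + 1 < m → f (sg m k) = f (sg m (k + 1)) → f (sg m 0) = f (sg m 1) :=
    fun hk h => (map_eq_of_adjacent f hk h (by omega)).trans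
      (map_eq_of_adjacent f hk h (by omega)).symm
  rcases Nat.lt_or_ge (i + 1) j with hij' | hij'
  · rcases Nat.eq_zero_or_pos i with rfl | hi
    · rcases Nat.lt_or_ge 2 j with hj' | hj'
      · refine key (k := 0) (by omega) (eq_of_commute_of_braid (braid_map f (by omega)) ?_)
        rw [h]
        exact (commute_sg (Or.inr hj')).map f
      · obtain rfl : j = 2 := by omega
        exact (map_eq_of_skip hm f (k := 0) (by omega) h (by omega)).trans
          (map_eq_of_skip hm f (k := 0) (by omega) h (by omega)).symm
    · obtain ⟨i, rfl⟩ : ∃ k, i = k + 1 := ⟨i - 1, by omega⟩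
      refine key (k := i) (by omega) (eq_of_commute_of_braid (braid_map f (by omega)) ?_)
      rw [h]
      exact (commute_sg (Or.inl (by omega))).map f
  · obtain rfl : j = i + 1 := by omega
    exact key hj h

theorem map_eq_of_map_eq_one {G : Type*} [Group G] {m : ℕ} (hm : 2 ≤ m) {f : Br m →* G}
    (h : f (sg m 0) = 1) : f (sg m 0) = f (sg m 1) := by
  obtain ⟨t, ht⟩ := exists_conj_sg (m := m) (k := 0) (l := 1) (by omega) (by omega)
  rw [ht, map_mul, map_mul, map_inv, h, mul_one, mul_inv_cancel]

section
variable {α : Type*} [Fintype α] [DecidableEq α]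

theorem lt_card_of_isSwap {m : ℕ} (hm : 4 ≤ m) {f : Br m →* Perm α}
    (hne : f (sg m 0) ≠ f (sg m 1)) (hs : (f (sg m 0)).IsSwap) : m < Fintype.card α := by
  obtain ⟨v, hv, -⟩ := exists_chain (by omega) f (fun i hi => by
    obtain ⟨t, ht⟩ := exists_conj_sg (m := m) (k := 0) (by omega) hi
    obtain ⟨a, b, hab, h⟩ := hs
    refine ⟨f t a, f t b, fun e => hab (Equiv.injective _ e), ?_⟩
    rw [ht, map_mul, map_mul, map_inv, h, swap_apply_apply])
    fun i j hij hj h => hne (map_eq_of_map_eq hm f hij hj h)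
  have hv' : Function.Injective fun i : Fin (m + 1) => v i := fun i j hij => by
    by_contra h
    rcases lt_or_gt_of_ne h with h | h
    · exact hv i j h (Nat.le_of_lt_succ j.2) hij
    · exact hv j i h (Nat.le_of_lt_succ i.2) hij.symm
  simpa using Fintype.card_le_of_injective _ hv'


theorem isSwap_of_card_le_three_cycles {f : Br 5 →* Perm α} (hne : f (sg 5 0) ≠ f (sg 5 1))
    (h : Fintype.card α ≤ 6)
    (h3 : (f (sg 5 0)).cycleFactorsFinset.card ≤ 2) :
    (f (sg 5 0)).IsSwap := by
  by_contra hs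
  have h1 := three_le_card_support (fun h1 => hne (map_eq_of_map_eq_one (by omega) h1)) hs
  have h2 := card_fixedPoints_add_card_support (f (sg 5 0))
  refine hne (map_eq_of_centralizer (k := 3) (by omega) f (fun g => ?_) (fun g => ?_))
  · exact map_eq_of_card_le_two (by simpa using h3) (by omega) g
  · refine commute_of_card_le_three ?_ (by omega) g
    rw [Nat.card_eq_fintype_card]
    change Fintype.card (Function.fixedPoints (f (sg 5 0))) ≤ 3
    omega

theorem isSwap_of_forall {k : ℕ} (hk : 4 ≤ k) {f : Br (k + 2) →* Perm α}
    (hne : f (sg (k + 2) 0) ≠ f (sg (k + 2) 1)) (h : Fintype.card α ≤ k + 3)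
    (hZ : ∀ n ≤ k, ∀ f : Br k →* Perm (Fin n), f (sg k 0) = f (sg k 1)) :
    (f (sg (k + 2) 0)).IsSwap := by
  by_contra hs
  have h1 := three_le_card_support (fun h1 => hne (map_eq_of_map_eq_one (by omega) h1)) hs
  have h2 := card_fixedPoints_add_card_support (f (sg (k + 2) 0))
  have h3 := card_cycleFactorsFinset_mul_two_le (f (sg (k + 2) 0))
  have hZ' : ∀ {β : Type _} [Finite β] (_ : Nat.card β ≤ k) (g : Br k →* Perm β),
      g (sg k 0) = g (sg k 1) := fun {β} _ hβ g => by
    obtain ⟨e, he⟩ := exists_perm_hom hβ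
    exact he (hZ k le_rfl (e.comp g))
  refine hne (map_eq_of_centralizer (by omega) f (fun g => hZ' ?_ g) (fun g => ?_))
  · rw [Nat.card_eq_fintype_card, Fintype.card_coe]
    omega
  · rw [← hZ' (by rw [Nat.card_eq_fintype_card]; omega) g, mul_inv_cancel]
    exact Commute.one_left _

end

theorem map_eq_of_card_le {m : ℕ} (hm : 4 ≤ m) : ∀ n ≤ m, ∀ f : Br m →* Perm (Fin n),
    f (sg m 0) = f (sg m 1) := by
  induction m using Nat.strong_induction_on with
  | _ m ih =>
    intro n hn f
    by_contra hne
    rcases hm.eq_or_lt' with rfl | hm'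
    · exact hne (map_eq_of_card_le_four (by simpa using hn) le_rfl f)
    · refine absurd (lt_card_of_isSwap hm hne ?_) (by simpa using hn)
      rcases (show m = 5 ∨ 6 ≤ m by omega) with rfl | hm'
      · refine isSwap_of_card_le_three_cycles hne (by simp; omega) ?_
        have := card_cycleFactorsFinset_mul_two_le (f (sg 5 0))
        have := Finset.card_le_univ (f (sg 5 0)).support
        simp only [Fintype.card_fin] at this
        omega
      · obtain ⟨k, rfl⟩ : ∃ k, m = k + 2 := ⟨m - 2, by omega⟩
        exact isSwap_of_forall (by omega) hne (by simp; omega) (ih k (by omega) (by omega))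

end Br

namespace Br

open Equiv Equiv.Perm

/-- Endomorphisms which induce injective endomorphisms modulo the center. -/
structure InjModCenter {m : ℕ} (f : Br m →* Br m) : Prop where
  exists_map_zz : ∃ k : ℤ, f (zz m) = zz m ^ k
  mem_center {b : Br m} : f b ∈ Subgroup.center (Br m) → b ∈ Subgroup.center (Br m)

namespace InjModCenter

variable {m : ℕ} {f : Br m →* Br m}

theorem conj (hf : InjModCenter f) (g : Br m) :
    InjModCenter ((MulAut.conj g).toMonoidHom.comp f) where
  exists_map_zz := by
    obtain ⟨k, hk⟩ := hf.exists_map_zz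
    refine ⟨k, ?_⟩
    change g * f (zz m) * g⁻¹ = _
    rw [hk, (commute_zz_zpow g k).eq, mul_inv_cancel_right]
  mem_center {b} hb := by
    refine hf.mem_center ?_
    have h := Subgroup.Normal.conj_mem inferInstance _ hb g⁻¹
    have h1 : g⁻¹ * ((MulAut.conj g).toMonoidHom.comp f) b * g⁻¹⁻¹ = f b := by
      change g⁻¹ * (g * f b * g⁻¹) * g⁻¹⁻¹ = f b
      group
    rwa [h1] at h

theorem permFin_eq_one (hm : 2 ≤ m) (hf : InjModCenter f) {b : Br m} {l : ℕ} (hl : l ≠ 0)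
    (hb : b ^ l = zz m) (h : permFin m (f b) = 1) : permFin m b = 1 := by
  obtain ⟨k, hk⟩ := hf.exists_map_zz
  obtain ⟨j, hj⟩ := eq_zz_zpow_of_pow (permFin_eq_one_iff.1 h) hl (k := k) (by rw [← map_pow, hb, hk])
  have h1 : b ∈ Subgroup.center (Br m) := hf.mem_center (by
    rw [center_eq hm]
    exact ⟨j, hj.symm⟩)
  rw [center_eq hm] at h1
  obtain ⟨i, rfl⟩ := h1
  rw [permFin_eq_one_iff, perm_zz_zpow]

theorem permFin_map_zz (hf : InjModCenter f) : permFin m (f (zz m)) = 1 := by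
  obtain ⟨k, hk⟩ := hf.exists_map_zz
  rw [permFin_eq_one_iff, hk, perm_zz_zpow]

theorem permFin_map_ne (hm : 4 ≤ m) (hf : InjModCenter f) :
    permFin m (f (sg m 0)) ≠ permFin m (f (sg m 1)) := by
  intro h
  have hs : ∀ b, permFin m (f b) = permFin m (f (sg m 0)) ^ ex b := by
    have : (permFin m).comp f = (zpowersHom _ (permFin m (f (sg m 0)))).comp (expo m) :=
      hom_ext fun k hk => by
        rw [MonoidHom.comp_apply (zpowersHom _ _), expo_sg hk, zpowersHom_apply, toAdd_ofAdd, zpow_one]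
        exact (map_eq_of_adjacent ((permFin m).comp f) (k := 0) (by omega) h hk)
    exact fun b => DFunLike.congr_fun this b
  have h1 : sg m 0 * (sg m 1)⁻¹ ∈ (expo m).ker := by
    rw [MonoidHom.mem_ker, map_mul, map_inv, expo_sg (by omega), expo_sg (by omega), mul_inv_cancel]
  have h2 := hom_eq_one_of_perfect (ker_expo_perfect hm) f (fun b hb => by
    rw [← permFin_eq_one_iff, hs, ex, MonoidHom.mem_ker.1 hb, toAdd_one, zpow_zero]) h1
  have h3 := hf.mem_center (h2 ▸ Subgroup.one_mem _)
  rw [center_eq (by omega)] at h3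
  obtain ⟨i, hi⟩ := h3
  have h4 : permFin m (zz m ^ i) = 1 := permFin_eq_one_iff.2 (perm_zz_zpow m i)
  change zz m ^ i = _ at hi
  rw [hi, map_mul, map_inv, mul_inv_eq_one, permFin_sg (by omega), permFin_sg (by omega)] at h4
  have h5 := congrArg Fin.val (DFunLike.congr_fun h4 ⟨0, by omega⟩)
  rw [swap_apply_left, swap_apply_of_ne_of_ne (by simp) (by simp)] at h5
  exact absurd h5 (by simp)

theorem std_of_isSwap (hm : 4 ≤ m) (hf : InjModCenter f)
    (hs : (permFin m (f (sg m 0))).IsSwap) : Std f :=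
  Br.std_of_isSwap (by omega) hs fun _ _ hij hj h => hf.permFin_map_ne hm
    (map_eq_of_map_eq hm ((permFin m).comp f) hij hj h)

theorem std_of_six_le (hm : 6 ≤ m) (hf : InjModCenter f) : Std f := by
  obtain ⟨k, rfl⟩ : ∃ k, m = k + 2 := ⟨m - 2, by omega⟩
  exact hf.std_of_isSwap (by omega) (isSwap_of_forall (by omega)
    (f := (permFin (k + 2)).comp f) (hf.permFin_map_ne (by omega)) (by simp)
    (map_eq_of_card_le (by omega)))

/-- The images of the generators are conjugate by powers of the image of `del m`. -/
theorem permFin_map_sg (f : Br m →* Br m) {k : ℕ} (hk : k < m) : permFin m (f (sg m k)) =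
    permFin m (f (del m)) ^ k * permFin m (f (sg m 0)) * (permFin m (f (del m)) ^ k)⁻¹ := by
  rw [eq_mul_inv_iff_mul_eq, ← map_pow, ← map_pow, ← map_mul, ← map_mul, ← map_mul, ← map_mul,
    del_pow_mul_sg hk]

theorem permFin_map_del_pow (hm : 2 ≤ m) (hf : InjModCenter f) :
    permFin m (f (del m)) ^ (m + 1) = 1 := by
  rw [← map_pow, ← map_pow, del_pow hm, hf.permFin_map_zz]

theorem sign_of_pow_four {c : Perm (Fin 4)} (h4 : c ^ 4 = 1) (h2 : c ^ 2 ≠ 1) : sign c = -1 := by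
  revert c
  decide +kernel

theorem std_of_eq_three {f : Br 3 →* Br 3} (hf : InjModCenter f) : Std f := by
  have hd : del 3 = sg 3 0 * sg 3 1 * sg 3 2 := by
    simp [del, incl_sg]
  have hz := del_pow (m := 3) (by omega)
  have he : (sg 3 0 * del 3) ^ 3 = zz 3 := by
    rw [← hz]
    have h1 := del_pow_mul_sg (m := 3) (k := 1) (by omega)
    have h2 := del_pow_mul_sg (m := 3) (k := 2) (by omega)
    calc (sg 3 0 * del 3) ^ 3 = sg 3 0 * (del 3 ^ 1 * sg 3 0) * del 3 * sg 3 0 * del 3 := by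
          simp only [pow_succ, pow_zero, one_mul, mul_assoc]
      _ = sg 3 0 * sg 3 1 * (del 3 ^ 2 * sg 3 0) * del 3 := by
          rw [h1]
          simp only [pow_succ, pow_zero, one_mul, mul_assoc]
      _ = sg 3 0 * sg 3 1 * sg 3 2 * del 3 ^ 3 := by
          rw [h2]
          simp only [pow_succ, pow_zero, one_mul, mul_assoc]
      _ = del 3 ^ (3 + 1) := by rw [← hd, ← pow_succ']
  have h4 : permFin 3 (f (del 3)) ^ 4 = 1 := hf.permFin_map_del_pow (by omega)
  have h2 : permFin 3 (f (del 3)) ^ 2 ≠ 1 := fun h => by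
    rw [← map_pow, ← map_pow] at h
    have h := hf.permFin_eq_one (by omega) (l := 2) (by omega) (by rw [← pow_mul, hz]) h
    rw [hd, map_pow, map_mul, map_mul, permFin_sg (by omega), permFin_sg (by omega),
      permFin_sg (by omega)] at h
    clear * - h
    revert h
    decide
  have h1 : permFin 3 (f (sg 3 0 * del 3)) ≠ 1 := fun h => by
    have h := hf.permFin_eq_one (by omega) (l := 3) (by omega) he h
    rw [hd, map_mul, map_mul, map_mul, permFin_sg (by omega), permFin_sg (by omega),
      permFin_sg (by omega)] at h
    clear * - h
    revert h
    decide
  have hs1 := permFin_map_sg f (k := 1) (by omega)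
  have hs2 := permFin_map_sg f (k := 2) (by omega)
  have hb := braid_map ((permFin 3).comp f) (k := 0) (by omega)
  have hc : permFin 3 (f (del 3)) = permFin 3 (f (sg 3 0)) * permFin 3 (f (sg 3 1)) *
      permFin 3 (f (sg 3 2)) := by
    rw [hd]
    simp only [map_mul]
  refine std_three (odd_ex_iff.2 ?_) fun h => h1 ?_
  · have := sign_of_pow_four h4 h2
    rw [hc, hs1, hs2] at this
    simp only [map_mul, map_inv, mul_inv_cancel_comm] at this
    rw [← this, mul_assoc, Int.units_mul_self, mul_one]
  · rw [← permFin_eq_iff] at h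
    change permFin 3 (f (sg 3 0)) * permFin 3 (f (sg 3 1)) * permFin 3 (f (sg 3 0)) =
      permFin 3 (f (sg 3 1)) * permFin 3 (f (sg 3 0)) * permFin 3 (f (sg 3 1)) at hb
    rw [map_mul, map_mul]
    rw [← h] at hc
    generalize permFin 3 (f (sg 3 0)) = a at *
    generalize permFin 3 (f (sg 3 1)) = b at *
    generalize permFin 3 (f (del 3)) = c at *
    have h3 : (a * b) ^ 3 = c ^ 2 := by
      calc (a * b) ^ 3 = a * b * a * (b * a * b) := by simp only [pow_succ, pow_zero, one_mul, mul_assoc]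
        _ = c ^ 2 := by rw [← hb, ← hc, pow_two]
    have h6 : (a * b) ^ 2 = 1 := (pow_two_or_pow_three_eq_one (a * b) (by
      rw [pow_mul _ 3 2, h3, ← pow_mul, h4])).resolve_right (by rwa [h3])
    have h5 : a * b * 1 = a * b * (a * c) := by
      rw [mul_one, ← mul_assoc, ← hc, ← pow_two, ← h3, pow_succ, h6, one_mul]
    exact (mul_left_cancel h5).symm

theorem finRotate_conj {n : ℕ} (s : Perm (Fin (n + 1))) (i : ℕ) (x : Fin (n + 1)) :
    (finRotate (n + 1) ^ i * s * (finRotate (n + 1) ^ i)⁻¹) x = s (x - i • 1) + i • 1 := by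
  have h : ∀ i : ℕ, ∀ x, (finRotate (n + 1) ^ i) x = x + i • 1 := fun i => by
    induction i with
    | zero => simp
    | succ i ih =>
      intro x
      rw [pow_succ, Perm.mul_apply, ih, finRotate_apply, succ_nsmul', add_assoc]
  rw [Perm.mul_apply, Perm.mul_apply, h]
  congr 2
  rw [Perm.inv_eq_iff_eq, h, sub_add_cancel]

set_option synthInstance.maxSize 2000 in
theorem isSwap_of_vec_five : ∀ a b : Fin 5, a ≠ b → ∀ c, c ≠ a → c ≠ b → ∀ d, d ≠ a → d ≠ b → d ≠ c →
    ∀ e, e ≠ a → e ≠ b → e ≠ c → e ≠ d → ((fun v : Fin 5 → Fin 5 =>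
      (∀ x, v (v (x - 2) + 2) = v (v x - 2) + 2) →
      (∀ x, v (v (v x - 1) + 1) = v (v (v (x - 1) + 1) - 1) + 1) →
      (∀ x, v x = v (x - 1) + 1) ∨ ∃ x y, x ≠ y ∧ ∀ z, v z = swap x y z) ![a, b, c, d, e]) := by
  decide +kernel

theorem isSwap_of_finRotate {s : Perm (Fin 5)}
    (hb : s * (finRotate 5 ^ 1 * s * (finRotate 5 ^ 1)⁻¹) * s =
      finRotate 5 ^ 1 * s * (finRotate 5 ^ 1)⁻¹ * s * (finRotate 5 ^ 1 * s * (finRotate 5 ^ 1)⁻¹))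
    (hc : Commute s (finRotate 5 ^ 2 * s * (finRotate 5 ^ 2)⁻¹))
    (hne : s ≠ finRotate 5 ^ 1 * s * (finRotate 5 ^ 1)⁻¹) : s.IsSwap := by
  have hi : ∀ i j, i ≠ j → s i ≠ s j := fun i j hij h => hij (s.injective h)
  have hv : ![s 0, s 1, s 2, s 3, s 4] = s := by
    ext x
    fin_cases x <;> rfl
  have key := isSwap_of_vec_five (s 0) (s 1) (hi _ _ (by decide)) (s 2) (hi _ _ (by decide))
    (hi _ _ (by decide)) (s 3) (hi _ _ (by decide)) (hi _ _ (by decide)) (hi _ _ (by decide))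
    (s 4) (hi _ _ (by decide)) (hi _ _ (by decide)) (hi _ _ (by decide)) (hi _ _ (by decide))
  rw [hv] at key
  have h1 := finRotate_conj s 1
  have h2 := finRotate_conj s 2
  generalize finRotate 5 ^ 1 * s * (finRotate 5 ^ 1)⁻¹ = p at hb hne h1
  generalize finRotate 5 ^ 2 * s * (finRotate 5 ^ 2)⁻¹ = q at hc h2
  rcases key (fun x => by
      have := DFunLike.congr_fun hc.eq x
      simp only [Perm.mul_apply, h2] at this
      exact this) (fun x => by
      have := DFunLike.congr_fun hb x
      simp only [Perm.mul_apply, h1] at this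
      exact this) with h | ⟨x, y, hxy, h⟩
  · exact absurd (Equiv.ext fun x => (h x).trans (h1 x).symm) hne
  · exact ⟨x, y, hxy, Equiv.ext h⟩

theorem isSwap_five {c : Perm (Fin 5)} (h5 : c ^ 5 = 1) {s : Perm (Fin 5)}
    (hb : s * (c ^ 1 * s * (c ^ 1)⁻¹) * s = c ^ 1 * s * (c ^ 1)⁻¹ * s * (c ^ 1 * s * (c ^ 1)⁻¹))
    (hs : Commute s (c ^ 2 * s * (c ^ 2)⁻¹))
    (hne : s ≠ c ^ 1 * s * (c ^ 1)⁻¹) : s.IsSwap := by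
  have h0 : orderOf c = 5 := by
    have : Fact (Nat.Prime 5) := ⟨by decide⟩
    refine orderOf_eq_prime h5 fun h => hne ?_
    simp [h]
  have hc : c.IsCycle := isCycle_of_prime_order'' (by decide) (by rw [Fintype.card_fin, h0])
  have hcc : IsConj (finRotate 5) c := by
    rw [isConj_iff_cycleType_eq, cycleType_finRotate, hc.cycleType, ← hc.orderOf, h0]
  obtain ⟨t, rfl⟩ := isConj_iff.1 hcc
  obtain ⟨s, rfl⟩ := (MulAut.conj t).surjective s
  rw [← MulAut.conj_apply t] at hb hs hne
  simp only [← map_mul, ← map_pow, ← map_inv, commute_iff_eq, (MulAut.conj t).injective.eq_iff,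
    (MulAut.conj t).injective.ne_iff] at hb hs hne
  obtain ⟨x, y, hxy, rfl⟩ := isSwap_of_finRotate hb hs hne
  exact ⟨t x, t y, t.injective.ne hxy, (swap_apply_apply t x y).symm⟩

theorem std_of_eq_four {f : Br 4 →* Br 4} (hf : InjModCenter f) : Std f := by
  refine hf.std_of_isSwap le_rfl (isSwap_five (c := permFin 4 (f (del 4)))
    (hf.permFin_map_del_pow (by omega)) ?_ ?_ ?_)
  · rw [← permFin_map_sg f (by omega)]
    exact braid_map ((permFin 4).comp f) (k := 0) (by omega)
  · rw [← permFin_map_sg f (by omega)]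
    exact ((commute_sg (Or.inl (by omega))).map f).map (permFin 4)
  · rw [← permFin_map_sg f (by omega)]
    exact hf.permFin_map_ne le_rfl

end InjModCenter

end Br

namespace Br.InjModCenter

open Equiv Equiv.Perm

theorem cycleType_eq_replicate {s : Perm (Fin 6)} (hs : 3 ≤ s.cycleFactorsFinset.card) :
    s.cycleType = Multiset.replicate 3 2 := by
  have h1 : 3 ≤ s.cycleType.card := by
    rwa [cycleType_def, Multiset.card_map]
  have h2 : s.cycleType.sum ≤ 6 := by
    rw [sum_cycleType]
    exact (Finset.card_le_univ _).trans_eq (Fintype.card_fin 6)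
  have h3 : ∀ n ∈ s.cycleType, 2 ≤ n := fun n hn => two_le_of_mem_cycleType hn
  generalize s.cycleType = M at h1 h2 h3
  have h4 := Multiset.card_nsmul_le_sum h3
  rw [smul_eq_mul] at h4
  refine Multiset.eq_replicate.2 ⟨by omega, fun n hn => ?_⟩
  obtain ⟨M, rfl⟩ := Multiset.exists_cons_of_mem hn
  have h5 := Multiset.card_nsmul_le_sum fun n hn => h3 n (Multiset.mem_cons_of_mem hn)
  rw [smul_eq_mul] at h5
  rw [Multiset.card_cons] at h1
  rw [Multiset.sum_cons] at h2
  have := h3 n hn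
  omega

set_option synthInstance.maxSize 4000 in
theorem eq_of_vec_six : ∀ a : Fin 6, a ≠ 0 → ∀ b, b ≠ 1 → (b = 0 ↔ a = 1) → b ≠ a →
    ∀ c, c ≠ 2 → (c = 0 ↔ a = 2) → (c = 1 ↔ b = 2) → c ≠ a → c ≠ b →
    ∀ d, d ≠ 3 → (d = 0 ↔ a = 3) → (d = 1 ↔ b = 3) → (d = 2 ↔ c = 3) → d ≠ a → d ≠ b → d ≠ c →
    ∀ e, e ≠ 4 → (e = 0 ↔ a = 4) → (e = 1 ↔ b = 4) → (e = 2 ↔ c = 4) → (e = 3 ↔ d = 4) →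
    ∀ f, f ≠ 5 → (f = 0 ↔ a = 5) → (f = 1 ↔ b = 5) → (f = 2 ↔ c = 5) → (f = 3 ↔ d = 5) →
      (f = 4 ↔ e = 5) → ((fun v : Fin 6 → Fin 6 =>
        (∀ x, v (v (x - 2) + 2) = v (v x - 2) + 2) →
        (∀ x, v (v (v x - 1) + 1) = v (v (v (x - 1) + 1) - 1) + 1) →
        (∀ x, v x = v (x - 1) + 1) ∨ ∀ x, v x = v (x - 2) + 2) ![a, b, c, d, e, f]) := by
  decide +kernel

theorem eq_of_finRotate_six {s : Perm (Fin 6)} (hs : ∀ x, s x ≠ x) (hss : ∀ x, s (s x) = x)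
    (hb : s * (finRotate 6 ^ 1 * s * (finRotate 6 ^ 1)⁻¹) * s =
      finRotate 6 ^ 1 * s * (finRotate 6 ^ 1)⁻¹ * s * (finRotate 6 ^ 1 * s * (finRotate 6 ^ 1)⁻¹))
    (hc : Commute s (finRotate 6 ^ 2 * s * (finRotate 6 ^ 2)⁻¹)) :
    s = finRotate 6 ^ 1 * s * (finRotate 6 ^ 1)⁻¹ ∨ s = finRotate 6 ^ 2 * s * (finRotate 6 ^ 2)⁻¹ := by
  have hi : ∀ i j, i ≠ j → s i ≠ s j := fun i j hij h => hij (s.injective h)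
  have he : ∀ i j, s i = j ↔ s j = i := fun i j =>
    ⟨fun h => by rw [← h, hss], fun h => by rw [← h, hss]⟩
  have hv : ![s 0, s 1, s 2, s 3, s 4, s 5] = s := by
    ext x
    fin_cases x <;> rfl
  have key := eq_of_vec_six (s 0) (hs 0) (s 1) (hs 1) (he _ _) (hi _ _ (by decide)) (s 2) (hs 2)
    (he _ _) (he _ _) (hi _ _ (by decide)) (hi _ _ (by decide)) (s 3) (hs 3)
    (he _ _) (he _ _) (he _ _) (hi _ _ (by decide)) (hi _ _ (by decide)) (hi _ _ (by decide)) (s 4)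
    (hs 4) (he _ _) (he _ _) (he _ _) (he _ _) (s 5) (hs 5) (he _ _) (he _ _) (he _ _) (he _ _)
    (he _ _)
  rw [hv] at key
  have h1 := finRotate_conj s 1
  have h2 := finRotate_conj s 2
  generalize finRotate 6 ^ 1 * s * (finRotate 6 ^ 1)⁻¹ = p at hb h1 ⊢
  generalize finRotate 6 ^ 2 * s * (finRotate 6 ^ 2)⁻¹ = q at hc h2 ⊢
  exact (key (fun x => by
      have := DFunLike.congr_fun hc.eq x
      simp only [Perm.mul_apply, h2] at this
      exact this) (fun x => by
      have := DFunLike.congr_fun hb x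
      simp only [Perm.mul_apply, h1] at this
      exact this)).imp (fun h => Equiv.ext fun x => (h x).trans (h1 x).symm)
        fun h => Equiv.ext fun x => (h x).trans (h2 x).symm

theorem cycleType_eq_of_pow_six {c : Perm (Fin 6)} (h6 : c ^ 6 = 1) (h2 : c ^ 2 ≠ 1)
    (h3 : c ^ 3 ≠ 1) : c.cycleType = {6} ∨ c.cycleType = {2, 3} := by
  have h4 : c.cycleType.sum ≤ 6 := by
    rw [sum_cycleType]
    exact (Finset.card_le_univ _).trans_eq (Fintype.card_fin 6)
  have h5 : ∀ n ∈ c.cycleType, n = 2 ∨ n = 3 ∨ n = 6 := fun n hn => by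
    have h1 := two_le_of_mem_cycleType hn
    have h2 : n ∣ 6 := (dvd_of_mem_cycleType hn).trans (orderOf_dvd_of_pow_eq_one h6)
    have h3 := Nat.le_of_dvd (by omega) h2
    interval_cases n <;> omega
  have hpow : ∀ l, c ^ l = 1 ↔ ∀ n ∈ c.cycleType, n ∣ l := fun l => by
    rw [← orderOf_dvd_iff_pow_eq_one, ← lcm_cycleType, Multiset.lcm_dvd]
  rw [Ne, hpow] at h2 h3
  clear hpow
  generalize c.cycleType = M at *
  by_cases hM : 6 ∈ M
  · obtain ⟨M, rfl⟩ := Multiset.exists_cons_of_mem hM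
    rw [Multiset.sum_cons] at h4
    left
    rw [Multiset.eq_zero_of_forall_notMem (s := M) fun n hn => ?_]
    · rfl
    · have := h5 n (Multiset.mem_cons_of_mem hn)
      have := Multiset.le_sum_of_mem hn
      omega
  · push Not at h2 h3
    obtain ⟨a, ha, ha'⟩ := h2
    obtain ⟨b, hb, hb'⟩ := h3
    have h6 : ∀ n ∈ M, n ≠ 6 := fun n hn h => hM (h ▸ hn)
    obtain rfl : a = 3 := by
      rcases h5 a ha with rfl | rfl | rfl
      · omega
      · rfl
      · exact absurd ha hM
    obtain rfl : b = 2 := by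
      rcases h5 b hb with rfl | rfl | rfl
      · rfl
      · omega
      · exact absurd hb hM
    obtain ⟨M, rfl⟩ := Multiset.exists_cons_of_mem hb
    obtain ⟨M, rfl⟩ := Multiset.exists_cons_of_mem ((Multiset.mem_cons.1 ha).resolve_left (by omega))
    rw [Multiset.sum_cons, Multiset.sum_cons] at h4
    right
    rw [Multiset.eq_zero_of_forall_notMem (s := M) fun n hn => ?_]
    · rfl
    · have := h5 n (Multiset.mem_cons_of_mem (Multiset.mem_cons_of_mem hn))
      have := Multiset.le_sum_of_mem hn
      omega

/-- The image of `del 5` when the generators are not mapped to transpositions. -/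
theorem cycleType_map_del_five {f : Br 5 →* Br 5} (hf : InjModCenter f)
    (hs : 3 ≤ (permFin 5 (f (sg 5 0))).cycleFactorsFinset.card) :
    (permFin 5 (f (del 5))).cycleType = {2, 3} := by
  have hs1 := permFin_map_sg f (k := 1) (by omega)
  have hs2 := permFin_map_sg f (k := 2) (by omega)
  have hs3 := permFin_map_sg f (k := 3) (by omega)
  have hs4 := permFin_map_sg f (k := 4) (by omega)
  have hb := braid_map ((permFin 5).comp f) (k := 0) (by omega)
  have hc : Commute (permFin 5 (f (sg 5 0))) (permFin 5 (f (sg 5 2))) :=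
    ((commute_sg (Or.inl (by omega))).map f).map (permFin 5)
  have h1 := hf.permFin_map_ne (by omega)
  have h2 : permFin 5 (f (sg 5 0)) ≠ permFin 5 (f (sg 5 2)) := fun h => h1
    (map_eq_of_map_eq (by omega) ((permFin 5).comp f) (i := 0) (j := 2) (by omega) (by omega) h)
  have h6 : permFin 5 (f (del 5)) ^ 6 = 1 := hf.permFin_map_del_pow (by omega)
  have hct := cycleType_eq_replicate hs
  change permFin 5 (f (sg 5 0)) * permFin 5 (f (sg 5 1)) * permFin 5 (f (sg 5 0)) =
    permFin 5 (f (sg 5 1)) * permFin 5 (f (sg 5 0)) * permFin 5 (f (sg 5 1)) at hb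
  have hd : sign (permFin 5 (f (del 5))) = sign (permFin 5 (f (sg 5 0))) := by
    have : del 5 = sg 5 0 * sg 5 1 * sg 5 2 * sg 5 3 * sg 5 4 := by
      simp [del, incl_sg]
    rw [this]
    simp only [map_mul]
    rw [hs1, hs2, hs3, hs4]
    simp only [map_mul, map_inv, mul_inv_cancel_comm, Int.units_mul_self, one_mul]
  rw [hs1] at hb h1
  rw [hs2] at hc h2
  refine (cycleType_eq_of_pow_six h6 (fun h => ?_) fun h => ?_).resolve_left fun h => ?_
  · rw [h] at h2
    simp at h2
  · have h' := congrArg sign h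
    rw [map_pow, hd, sign_of_cycleType, hct] at h'
    revert h'
    decide
  · have hcc : IsConj (finRotate 6) (permFin 5 (f (del 5))) := by
      rw [isConj_iff_cycleType_eq, cycleType_finRotate, h]
    generalize permFin 5 (f (del 5)) = c at *
    generalize permFin 5 (f (sg 5 0)) = s at *
    have hfix : ∀ x, s x ≠ x := fun x => by
      rw [← mem_support, (Finset.card_eq_iff_eq_univ s.support).1 (by
        rw [← sum_cycleType, hct]; rfl)]
      exact Finset.mem_univ _
    have hinv : s ^ 2 = 1 := by
      rw [← orderOf_dvd_iff_pow_eq_one, ← lcm_cycleType, hct]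
      decide
    obtain ⟨t, rfl⟩ := isConj_iff.1 hcc
    obtain ⟨s, rfl⟩ := (MulAut.conj t).surjective s
    rw [← MulAut.conj_apply t] at hb hc h1 h2
    simp only [← map_mul, ← map_pow, ← map_inv, commute_iff_eq, (MulAut.conj t).injective.eq_iff,
      (MulAut.conj t).injective.ne_iff, map_eq_one_iff _ (MulAut.conj t).injective] at hb hc h1 h2 hinv
    exact (eq_of_finRotate_six (fun x h => hfix (t x) (by
      rw [MulAut.conj_apply, Perm.mul_apply, Perm.mul_apply, ← Perm.mul_apply t⁻¹, inv_mul_cancel,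
        Perm.one_apply, h])) (fun x => by
      rw [← Perm.mul_apply, ← pow_two, hinv, Perm.one_apply]) hb hc).elim h1 h2

end Br.InjModCenter

namespace Br

open Equiv Equiv.Perm

/-- The affine transformations `(x, y) ↦ (c - y, x + y)` of `ℤ × ℤ`. -/
def affPerm (c : ℤ) : Perm (ℤ × ℤ) where
  toFun p := (c - p.2, p.1 + p.2)
  invFun p := (p.2 - c + p.1, c - p.1)
  left_inv p := by ext <;> simp
  right_inv p := by ext <;> simp

theorem affPerm_apply (c : ℤ) (p : ℤ × ℤ) : affPerm c p = (c - p.2, p.1 + p.2) := rfl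

/-- An affine action of the braid group on three strands. -/
def affHom : Br 2 →* Perm (ℤ × ℤ) :=
  lift (fun k => affPerm k)
    (fun k hk => by
      obtain rfl : k = 0 := by omega
      ext1 p
      simp only [Perm.mul_apply, affPerm_apply]
      ext <;> push_cast <;> ring)
    (fun i j _ _ => by omega)

theorem affHom_sg {k : ℕ} (hk : k < 2) : affHom (sg 2 k) = affPerm k := lift_sg _ _ _ hk

/-- The linear part of `affPerm c`. -/
def affLin : AddAut (ℤ × ℤ) :=
  { affPerm 0 with
    map_add' := fun p q => by
      change affPerm 0 (p + q) = affPerm 0 p + affPerm 0 q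
      simp only [affPerm_apply]
      ext <;> simp <;> ring }

theorem affLin_apply (p : ℤ × ℤ) : affLin p = (0 - p.2, p.1 + p.2) := rfl

theorem exists_affHom_eq (b : Br 2) : ∃ u, ∀ p, affHom b p = (ex b • affLin) p + u := by
  let S : Subgroup (Br 2) :=
    { carrier := {b | ∃ u, ∀ p, affHom b p = (ex b • affLin) p + u}
      one_mem' := ⟨0, fun p => by simp [ex_one]⟩
      mul_mem' := by
        rintro a b ⟨u, hu⟩ ⟨v, hv⟩
        refine ⟨(ex a • affLin) v + u, fun p => ?_⟩
        rw [map_mul, Perm.mul_apply, hv, hu, map_add, ex_mul, add_zsmul, AddAut.add_apply, add_assoc]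
      inv_mem' := by
        rintro a ⟨u, hu⟩
        refine ⟨-((-ex a) • affLin) u, fun p => ?_⟩
        rw [map_inv, Perm.inv_eq_iff_eq, hu, map_add, map_neg, ex_inv, ← AddAut.add_apply,
          ← AddAut.add_apply, ← add_zsmul, add_neg_cancel, zero_zsmul]
        simp }
  exact mem_of_sg S (fun k hk => ⟨(k, 0), fun p => by
    rw [affHom_sg hk, ex_sg hk, one_zsmul, affPerm_apply, affLin_apply]
    ext <;> simp
    ring⟩) b

/-- A map from `ℤ × ℤ` to the strands intertwining `affHom` and `perm 2`. -/
def affStrand (p : ℤ × ℤ) : ℕ :=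
  if (p.1 - p.2) % 3 = 0 then 2 else if (p.1 - p.2) % 3 = 1 then 1 else 0

theorem perm_affStrand (b : Br 2) : ∀ p, perm 2 b (affStrand p) = affStrand (affHom b p) := by
  let S : Subgroup (Br 2) :=
    { carrier := {b | ∀ p, perm 2 b (affStrand p) = affStrand (affHom b p)}
      one_mem' := fun p => by simp
      mul_mem' := fun {a b} ha hb p => by
        rw [map_mul, map_mul, Perm.mul_apply, Perm.mul_apply, hb, ha]
      inv_mem' := fun {a} ha p => by
        rw [map_inv, Perm.inv_eq_iff_eq, ha, map_inv, ← Perm.mul_apply, mul_inv_cancel,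
          Perm.one_apply] }
  refine mem_of_sg S (fun k hk p => ?_) b
  rw [affHom_sg hk, perm_sg hk, affPerm_apply, swap_apply_def]
  have : k = 0 ∨ k = 1 := by omega
  have h3 : (p.1 - p.2) % 3 = 0 ∨ (p.1 - p.2) % 3 = 1 ∨ (p.1 - p.2) % 3 = 2 := by omega
  rcases this with rfl | rfl <;> simp only [affStrand] <;> rcases h3 with h3 | h3 | h3 <;>
    split_ifs <;> first | contradiction | omega

theorem perm_eq_one_of_pow_three {b : Br 2} (h : b ^ 3 = 1) : perm 2 b = 1 := by
  have he : ex b = 0 := by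
    have := congrArg ex h
    rw [ex_pow, ex_one] at this
    omega
  obtain ⟨u, hu⟩ := exists_affHom_eq b
  simp only [he, zero_zsmul, AddAut.zero_apply] at hu
  have h1 : affHom b = 1 := by
    have h2 := DFunLike.congr_fun (congrArg affHom h) 0
    rw [map_pow, map_one, pow_succ, pow_two, Perm.mul_apply, Perm.mul_apply, hu, hu, hu,
      Perm.one_apply] at h2
    have h3 : u = 0 := by
      have h4 := congrArg Prod.fst h2
      have h5 := congrArg Prod.snd h2
      simp only [Prod.fst_add, Prod.snd_add, Prod.fst_zero, Prod.snd_zero] at h4 h5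
      ext
      · rw [Prod.fst_zero]
        omega
      · rw [Prod.snd_zero]
        omega
    ext1 p
    rw [hu, h3, add_zero, Perm.one_apply]
  have h2 : ∀ p, perm 2 b (affStrand p) = affStrand p := fun p => by
    rw [perm_affStrand, h1, Perm.one_apply]
  rw [← map_one (perm 2)]
  refine perm_injOn fun i hi => ?_
  rw [map_one, Perm.one_apply]
  interval_cases i
  · exact h2 (2, 0)
  · exact h2 (1, 0)
  · exact h2 (0, 0)

/-- Forgetting the last strand of a torsion braid. -/
theorem exists_pow_eq_one {m : ℕ} {p : Br (m + 1)} {l : ℕ} (hp : perm (m + 1) p (m + 1) = m + 1)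
    (h : p ^ l = 1) : ∃ c : Br m, perm m c = perm (m + 1) p ∧ c ^ l = 1 := by
  obtain ⟨a, c, rfl, hc⟩ := exists_toBr hp
  refine ⟨c, hc, ?_⟩
  rw [← Gr.toBr_x, ← Gr.toBr_s, ← map_mul, ← map_pow, ← map_one (Gr.toBr m)] at h
  have h2 := congrArg Gr.pr (Gr.toBr_injective m h)
  rw [map_pow, map_mul, map_one] at h2
  simpa only [SemidirectProduct.rightHom_inl, SemidirectProduct.rightHom_inr, one_mul] using h2

namespace InjModCenter

theorem cycleFactorsFinset_card_le_two {f : Br 5 →* Br 5} (hf : InjModCenter f) :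
    (permFin 5 (f (sg 5 0))).cycleFactorsFinset.card ≤ 2 := by
  by_contra! hs
  have hct := hf.cycleType_map_del_five hs
  have hcc : IsConj (permFin 5 (f (del 5)))
      ((swap 0 1 * swap 1 2 * swap 3 4 : Perm (Fin 6))) := by
    have h2 : (swap 3 4 : Perm (Fin 6)).cycleType = {2} :=
      isSwap_iff_cycleType.1 ⟨3, 4, by decide, rfl⟩
    have h3 : (swap 0 1 * swap 1 2 : Perm (Fin 6)).cycleType = {3} := by
      refine card_support_eq_three_iff.1 ?_
      decide
    rw [isConj_iff_cycleType_eq, hct, Disjoint.cycleType_mul, h2, h3]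
    · decide
    · rw [disjoint_iff_disjoint_support]
      decide
  obtain ⟨s, hc⟩ := isConj_iff.1 hcc
  obtain ⟨g, rfl⟩ := permFin_surjective 5 s
  have hg := hf.conj g
  rw [← map_inv, ← map_mul, ← map_mul] at hc
  change permFin 5 (((MulAut.conj g).toMonoidHom.comp f) (del 5)) = _ at hc
  clear hcc hct hs
  revert hg hc
  generalize (MulAut.conj g).toMonoidHom.comp f = f
  clear hf
  intro hf hc
  obtain ⟨k, hk⟩ := hf.exists_map_zz
  rw [← del_pow (by omega), map_pow, del_pow (by omega)] at hk
  generalize f (del 5) = d at hc hk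
  have h0 : permFin 5 (d ^ 2) = swap 0 1 * swap 1 2 * swap 0 1 * swap 1 2 := by
    rw [map_pow, hc]
    decide
  have h3 : perm 5 (d ^ 2) 3 = 3 := by
    have := coe_permFin (d ^ 2) 3
    rw [h0] at this
    exact this.symm
  have h4 : perm 5 (d ^ 2) 4 = 4 := by
    have := coe_permFin (d ^ 2) 4
    rw [h0] at this
    exact this.symm
  have h5 : perm 5 (d ^ 2) 5 = 5 := by
    have := coe_permFin (d ^ 2) 5
    rw [h0] at this
    exact this.symm
  rw [pow_mul d 2 3] at hk
  have h6 := congrArg (fun b => cr b 3 4) hk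
  have hd : (d ^ 2) ^ 3 = d ^ 2 * d ^ 2 * d ^ 2 := by rw [pow_succ, pow_two]
  rw [cr_zpow_pure _ (perm_zz 5), cr_zz (by omega) (by omega) (by omega), hd, cr_mul, cr_mul] at h6
  simp only [h3, h4] at h6
  obtain ⟨j, rfl⟩ : ∃ j, k = 3 * j := ⟨k / 3, by omega⟩
  have ht : perm 5 (d ^ 2 * zz 5 ^ (-j)) = perm 5 (d ^ 2) := by
    rw [map_mul, perm_zz_zpow, mul_one]
  obtain ⟨c, hc1, hc2⟩ := exists_pow_eq_one (p := d ^ 2 * zz 5 ^ (-j)) (l := 3)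
    (by rw [ht, h5]) (by
      rw [(commute_zz_zpow _ _).mul_pow, hk, ← zpow_natCast, ← zpow_mul, ← zpow_add]
      exact (congrArg _ (by push_cast; ring)).trans (zpow_zero _))
  obtain ⟨c', hc3, hc4⟩ := exists_pow_eq_one (by rw [hc1, ht, h4]) hc2
  obtain ⟨c'', hc5, hc6⟩ := exists_pow_eq_one (by rw [hc3, hc1, ht, h3]) hc4
  have h7 := perm_eq_one_of_pow_three hc6
  rw [hc5, hc3, hc1, ht, ← permFin_eq_one_iff, h0] at h7
  revert h7
  decide

theorem std_of_eq_five {f : Br 5 →* Br 5} (hf : InjModCenter f) : Std f :=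
  hf.std_of_isSwap (by omega) (isSwap_of_card_le_three_cycles (f := (permFin 5).comp f)
    (hf.permFin_map_ne (by omega)) (by simp) hf.cycleFactorsFinset_card_le_two)

theorem std {m : ℕ} {f : Br m →* Br m} (hm : 3 ≤ m) (hf : InjModCenter f) : Std f := by
  obtain rfl | rfl | rfl | h : m = 3 ∨ m = 4 ∨ m = 5 ∨ 6 ≤ m := by omega
  · exact hf.std_of_eq_three
  · exact hf.std_of_eq_four
  · exact hf.std_of_eq_five
  · exact hf.std_of_six_le h

end InjModCenter

end Br

namespace Br

variable {m : ℕ}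

theorem eq_of_mk_eq (hm : 2 ≤ m) {a b : Br m}
    (h : (a : Br m ⧸ Subgroup.center (Br m)) = b) (he : ex a = ex b) : a = b := by
  rw [QuotientGroup.eq, center_eq hm] at h
  obtain ⟨k, hk⟩ := h
  have h1 := congrArg ex hk
  change ex (zz m ^ k) = _ at h1
  rw [ex_mul, ex_inv, he, neg_add_cancel, ex_zpow] at h1
  rw [(mul_eq_zero.1 h1).resolve_right (ex_zz_ne_zero (by omega))] at hk
  exact (inv_mul_eq_one.1 (hk.symm.trans (zpow_zero _)))

/-- Endomorphisms of the quotient by the center lift to the braid group. -/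
theorem exists_lift (hm : 2 ≤ m)
    (ρ : Br m ⧸ Subgroup.center (Br m) →* Br m ⧸ Subgroup.center (Br m)) :
    ∃ f : Br m →* Br m, ∀ b : Br m, (f b : Br m ⧸ Subgroup.center (Br m)) = ρ b := by
  have hy : ∃ y : Br m, (y : Br m ⧸ Subgroup.center (Br m)) = ρ (sg m 0) :=
    QuotientGroup.mk_surjective _
  obtain ⟨y, hy⟩ := hy
  have key : ∀ k, ∃ x : Br m, k < m →
      (x : Br m ⧸ Subgroup.center (Br m)) = ρ (sg m k) ∧ ex x = ex y := fun k => by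
    by_cases hk : k < m
    · obtain ⟨t, ht⟩ := exists_conj_sg (k := 0) (l := k) (by omega) hk
      have hu : ∃ u : Br m, (u : Br m ⧸ Subgroup.center (Br m)) = ρ t :=
        QuotientGroup.mk_surjective _
      obtain ⟨u, hu⟩ := hu
      refine ⟨u * y * u⁻¹, fun _ => ⟨?_, ex_conj u y⟩⟩
      rw [ht]
      simp only [QuotientGroup.mk_mul, QuotientGroup.mk_inv, map_mul, map_inv, hu, hy]
    · exact ⟨1, fun h => absurd h hk⟩
  choose x hx using key
  refine ⟨lift x (fun k hk => eq_of_mk_eq hm ?_ ?_) fun i j hij hj => eq_of_mk_eq hm ?_ ?_, ?_⟩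
  · simp only [QuotientGroup.mk_mul, (hx k (by omega)).1, (hx _ hk).1]
    simp only [← map_mul, ← QuotientGroup.mk_mul, sg_braid hk]
  · simp only [ex_mul, (hx k (by omega)).2, (hx _ hk).2]
  · simp only [QuotientGroup.mk_mul, (hx i (by omega)).1, (hx j hj).1]
    simp only [← map_mul, ← QuotientGroup.mk_mul, (commute_sg (Or.inl hij)).eq]
  · simp only [ex_mul, (hx i (by omega)).2, (hx j hj).2]
  · refine DFunLike.congr_fun (f := (QuotientGroup.mk' _).comp (lift x _ _))
      (g := ρ.comp (QuotientGroup.mk' _)) (hom_ext fun k hk => ?_)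
    change ((lift x _ _ (sg m k) : Br m) : Br m ⧸ Subgroup.center (Br m)) = ρ (sg m k)
    rw [lift_sg _ _ _ hk, (hx k hk).1]

theorem injModCenter_of_injective (hm : 2 ≤ m)
    {ρ : Br m ⧸ Subgroup.center (Br m) →* Br m ⧸ Subgroup.center (Br m)}
    (hρ : Function.Injective ρ) {f : Br m →* Br m}
    (hf : ∀ b : Br m, (f b : Br m ⧸ Subgroup.center (Br m)) = ρ b) : InjModCenter f where
  exists_map_zz := by
    have h : f (zz m) ∈ Subgroup.center (Br m) := by
      rw [← QuotientGroup.eq_one_iff, hf, (QuotientGroup.eq_one_iff _).2, map_one]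
      rw [center_eq hm]
      exact Subgroup.mem_zpowers _
    rw [center_eq hm] at h
    obtain ⟨k, hk⟩ := h
    exact ⟨k, hk.symm⟩
  mem_center {b} hb := by
    rw [← QuotientGroup.eq_one_iff, hf] at hb
    exact (QuotientGroup.eq_one_iff b).1 (hρ (hb.trans (map_one ρ).symm))

theorem isConj_map_sg (hm : 3 ≤ m)
    {ρ : Br m ⧸ Subgroup.center (Br m) →* Br m ⧸ Subgroup.center (Br m)}
    (hρ : Function.Injective ρ) :
    IsConj (sg m 0 : Br m ⧸ Subgroup.center (Br m)) (ρ (sg m 0)) ∨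
      IsConj (sg m 0 : Br m ⧸ Subgroup.center (Br m))⁻¹ (ρ (sg m 0)) := by
  obtain ⟨f, hf⟩ := exists_lift (by omega) ρ
  obtain ⟨g, ε, k, hε, h⟩ := (injModCenter_of_injective (by omega) hρ hf).std hm
  have hz : ((zz m ^ k : Br m) : Br m ⧸ Subgroup.center (Br m)) = 1 := by
    rw [QuotientGroup.eq_one_iff, center_eq (by omega)]
    exact ⟨k, rfl⟩
  rw [← hf, h 0 (by omega), QuotientGroup.mk_mul, QuotientGroup.mk_mul, QuotientGroup.mk_mul, hz,
    mul_one, QuotientGroup.mk_inv]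
  rcases hε with rfl | rfl
  · exact Or.inl (isConj_iff.2 ⟨g, by rw [zpow_one]⟩)
  · exact Or.inr (isConj_iff.2 ⟨g, by rw [zpow_neg_one, QuotientGroup.mk_inv]⟩)

end Br

/-- For `n ≥ 4`, any injective endomorphism `ρ` of `B_n/Z(B_n)` is
half-twist preserving: the image of any half-twist (conjugate of `σ̄_1`) is a conjugate
of `σ̄_1` or of `σ̄_1⁻¹`. -/
theorem braidModCenter_halfTwist_preserving (n : ℕ) (hn : 4 ≤ n)
    (ρ : BraidGroup n ⧸ Subgroup.center (BraidGroup n) →*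
         BraidGroup n ⧸ Subgroup.center (BraidGroup n))
    (hρ : Function.Injective ρ) :
    ∀ b : BraidGroup n ⧸ Subgroup.center (BraidGroup n),
      IsConj (QuotientGroup.mk (braidσ n ⟨0, by omega⟩)) b →
      IsConj (QuotientGroup.mk (braidσ n ⟨0, by omega⟩)) (ρ b) ∨
      IsConj ((QuotientGroup.mk (braidσ n ⟨0, by omega⟩) :
                BraidGroup n ⧸ Subgroup.center (BraidGroup n))⁻¹) (ρ b) := by
  intro b hb
  have h0 : braidσ n ⟨0, by omega⟩ = sg (n - 1) 0 := by
    rw [sg, dif_pos (by omega)]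
    rfl
  rw [h0] at hb ⊢
  exact (Br.isConj_map_sg (by omega) hρ).imp (fun h => h.trans (ρ.map_isConj hb))
    fun h => h.trans (ρ.map_isConj hb)
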